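/- There exists an absolute constant C > 0 such that for every finite set P of n points in the plane ℝ², with n sufficiently large, the hinge energy E_H(P) — that is, the number of pairs of triples ((p,q,r),(p',q',r')) ∈ P³ × P³ satisfying simultaneously ‖p−q‖ = ‖p'−q'‖ and ‖r−q‖ = ‖r'−q'‖ — satisfies E_H(P) ≤ C · n⁴ · (log n)³. -/

import Mathlib

open scoped Classical

open MvPolynomial in
/-- The space of trivariate real polynomials of total degree at most `s`. -/
noncomputable abbrev PolyLE (s : ℕ) : Submodule ℝ (MvPolynomial (Fin 3) ℝ) :=
  restrictTotalDegree (Fin 3) ℝ s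

theorem six_mul_finrank_polyLE (s : ℕ) :
    6 * Module.finrank ℝ (PolyLE s) = (s + 1) * (s + 2) * (s + 3) := by
  have hset : {n : Fin 3 →₀ ℕ | (n.sum fun _ e => e) ≤ s} =
      (((Finset.range (s + 1)).biUnion fun k =>
        (Finset.univ : Finset (Fin 3)).finsuppAntidiag k : Finset (Fin 3 →₀ ℕ)) :
          Set (Fin 3 →₀ ℕ)) := by
    ext n
    simp only [Set.mem_ofPred_eq, Finset.coe_biUnion, Finset.coe_range, Set.mem_iUnion,
      Finset.mem_coe, Finset.mem_finsuppAntidiag, Set.mem_Iio]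
    rw [Finsupp.sum_fintype _ _ (fun _ => rfl)]
    constructor
    · intro h
      exact ⟨_, Nat.lt_succ_of_le h, rfl, Finset.subset_univ _⟩
    · rintro ⟨k, hk, rfl, -⟩
      exact Nat.le_of_lt_succ hk
  have hcard : Module.finrank ℝ (PolyLE s) =
      ∑ k ∈ Finset.range (s + 1), (k + 2).choose 2 := by
    have hb := Module.finrank_eq_nat_card_basis
      (MvPolynomial.basisRestrictSupport ℝ {n : Fin 3 →₀ ℕ | (n.sum fun _ e => e) ≤ s})
    have h2 : Module.finrank ℝ (PolyLE s) =
        Nat.card {n : Fin 3 →₀ ℕ | (n.sum fun _ e => e) ≤ s} := hb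
    rw [h2, hset, Nat.card_coe_set_eq, Set.ncard_coe_finset, Finset.card_biUnion]
    · refine Finset.sum_congr rfl fun k _ => ?_
      rw [Finset.card_finsuppAntidiag_nat_eq_choose]
      simp only [Finset.card_univ, Fintype.card_fin]
      have : 3 + k - 1 = k + 2 := by omega
      rw [this, Nat.choose_symm_add]
    · intro i _ j _ hij
      rw [Function.onFun, Finset.disjoint_left]
      intro a ha hb
      rw [Finset.mem_finsuppAntidiag] at ha hb
      exact hij (ha.1.symm.trans hb.1)
  rw [hcard]
  clear hset hcard
  induction s with
  | zero => decide
  | succ s ih =>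
    rw [Finset.sum_range_succ, mul_add, ih]
    have h := Nat.triangle_succ (s + 2)
    have h3 : (s + 1 + 2).choose 2 * 2 = (s + 3) * (s + 2) := by
      rw [Nat.choose_two_right]
      have : 2 ∣ (s + 1 + 2) * (s + 1 + 2 - 1) := (Nat.even_mul_pred_self _).two_dvd
      rw [Nat.div_mul_cancel this]
      rfl
    nlinarith

/-- A line in `ℝ³` that is a graph over the third coordinate. -/
@[ext] structure GLine where
  (a b c e : ℝ)

namespace GLine

/-- The point of the line at height `z`. -/
def pt (l : GLine) (z : ℝ) : Fin 3 → ℝ := ![l.a + l.c * z, l.b + l.e * z, z]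

/-- Incidence of a point and a line. -/
def Has (l : GLine) (x : Fin 3 → ℝ) : Prop := x 0 = l.a + l.c * x 2 ∧ x 1 = l.b + l.e * x 2

open Polynomial in
/-- Restriction of a polynomial to a line, as a univariate polynomial in the height. -/
noncomputable def restr (l : GLine) : MvPolynomial (Fin 3) ℝ →ₐ[ℝ] ℝ[X] :=
  MvPolynomial.aeval ![C l.a + C l.c * X, C l.b + C l.e * X, X]

theorem has_pt (l : GLine) (z : ℝ) : l.Has (l.pt z) := ⟨rfl, rfl⟩

theorem Has.eq_pt {l : GLine} {x : Fin 3 → ℝ} (h : l.Has x) : x = l.pt (x 2) := by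
  ext i
  fin_cases i
  · exact h.1
  · exact h.2
  · rfl

theorem eval_restr (l : GLine) (f : MvPolynomial (Fin 3) ℝ) (z : ℝ) :
    (l.restr f).eval z = MvPolynomial.eval (l.pt z) f := by
  have : (Polynomial.evalRingHom z).comp (l.restr : _ →+* _) = MvPolynomial.eval (l.pt z) := by
    apply MvPolynomial.ringHom_ext
    · intro r
      simp [restr]
    · intro i
      fin_cases i <;> simp [restr, pt]
  exact congrArg (fun φ => φ f) this

theorem natDegree_restr_le (l : GLine) (f : MvPolynomial (Fin 3) ℝ) :
    (l.restr f).natDegree ≤ f.totalDegree := by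
  have := MvPolynomial.aeval_natDegree_le (n := 1) f le_rfl
    (![Polynomial.C l.a + Polynomial.C l.c * Polynomial.X,
      Polynomial.C l.b + Polynomial.C l.e * Polynomial.X, Polynomial.X]) (by
      intro i
      fin_cases i
      · simp only [Fin.zero_eta, Matrix.cons_val_zero]
        compute_degree
      · simp only [Fin.mk_one, Matrix.cons_val_one, Matrix.cons_val_zero]
        compute_degree
      · simp)
  rw [mul_one] at this
  exact this

theorem restr_eq_zero_iff (l : GLine) (f : MvPolynomial (Fin 3) ℝ) :
    l.restr f = 0 ↔ ∀ z, MvPolynomial.eval (l.pt z) f = 0 := by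
  constructor
  · intro h z
    rw [← eval_restr, h, Polynomial.eval_zero]
  · intro h
    apply Polynomial.funext
    intro z
    rw [eval_restr, h, Polynomial.eval_zero]

theorem eval_eq_zero_of_has {l : GLine} {f : MvPolynomial (Fin 3) ℝ} (h : l.restr f = 0)
    {x : Fin 3 → ℝ} (hx : l.Has x) : MvPolynomial.eval x f = 0 := by
  rw [hx.eq_pt]
  exact (l.restr_eq_zero_iff f).1 h _

/-- A line contains at most `deg f` points of a zero set that does not contain it. -/
theorem card_le_of_restr_ne_zero {l : GLine} {f : MvPolynomial (Fin 3) ℝ} (h : l.restr f ≠ 0)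
    (X : Finset (Fin 3 → ℝ)) (hX : ∀ x ∈ X, l.Has x ∧ MvPolynomial.eval x f = 0) :
    X.card ≤ f.totalDegree := by
  refine le_trans ?_ (l.natDegree_restr_le f)
  refine le_trans ?_ (Polynomial.card_roots' _)
  refine le_trans ?_ (Multiset.toFinset_card_le _)
  refine Finset.card_le_card_of_injOn (fun x => x 2) ?_ ?_
  · intro x hx
    obtain ⟨h1, h2⟩ := hX x hx
    have : (l.restr f).eval (x 2) = 0 := by rw [eval_restr, ← h1.eq_pt, h2]
    simpa [h] using this
  · intro x hx y hy hxy
    rw [(hX x hx).1.eq_pt, (hX y hy).1.eq_pt]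
    exact congrArg _ hxy

theorem restr_eq_zero_of_card {l : GLine} {f : MvPolynomial (Fin 3) ℝ} {X : Finset (Fin 3 → ℝ)}
    (hX : ∀ x ∈ X, l.Has x ∧ MvPolynomial.eval x f = 0) (hc : f.totalDegree < X.card) :
    l.restr f = 0 := by
  by_contra h
  exact absurd (card_le_of_restr_ne_zero h X hX) (by omega)

/-- Distinct lines share at most one point. -/
theorem eq_of_has {l m : GLine} {x y : Fin 3 → ℝ} (hxy : x ≠ y) (h1 : l.Has x) (h2 : l.Has y)
    (h3 : m.Has x) (h4 : m.Has y) : l = m := by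
  have h : x 2 ≠ y 2 := by
    intro h
    exact hxy (by rw [h1.eq_pt, h2.eq_pt, h])
  have h' : x 2 - y 2 ≠ 0 := sub_ne_zero.2 h
  obtain ⟨a1, b1⟩ := h1
  obtain ⟨a2, b2⟩ := h2
  obtain ⟨a3, b3⟩ := h3
  obtain ⟨a4, b4⟩ := h4
  have hc : l.c = m.c := mul_right_cancel₀ h' (by linarith)
  have he : l.e = m.e := mul_right_cancel₀ h' (by linarith)
  ext
  · rw [hc] at a1; linarith
  · rw [he] at b1; linarith
  · exact hc
  · exact he

open MvPolynomial in
theorem exists_linear_form {l m : GLine} (h : l ≠ m) :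
    ∃ f : MvPolynomial (Fin 3) ℝ, f.totalDegree ≤ 1 ∧ l.restr f = 0 ∧ m.restr f ≠ 0 := by
  have hf : ∀ (i : Fin 3) (u v : ℝ), (X i - C u - C v * X 2 :
      MvPolynomial (Fin 3) ℝ).totalDegree ≤ 1 := by
    intro i u v
    refine (totalDegree_sub _ _).trans (max_le ((totalDegree_sub _ _).trans (max_le ?_ ?_)) ?_)
    · simp
    · simp
    · refine (totalDegree_mul _ _).trans ?_
      simp
  by_cases h1 : l.a = m.a ∧ l.c = m.c
  · refine ⟨X 1 - C l.b - C l.e * X 2, hf _ _ _, ?_, ?_⟩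
    · rw [restr_eq_zero_iff]
      intro z
      simp [pt]
    · intro h0
      rw [restr_eq_zero_iff] at h0
      have e0 := h0 0
      have e1 := h0 1
      simp [pt] at e0 e1
      apply h
      ext
      · exact h1.1
      · linarith
      · exact h1.2
      · linarith
  · refine ⟨X 0 - C l.a - C l.c * X 2, hf _ _ _, ?_, ?_⟩
    · rw [restr_eq_zero_iff]
      intro z
      simp [pt]
    · intro h0
      rw [restr_eq_zero_iff] at h0
      have e0 := h0 0
      have e1 := h0 1
      simp [pt] at e0 e1
      apply h1
      constructor <;> linarith

end GLine

/-- The univariate polynomials in the third variable. -/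
noncomputable def heightPoly : Polynomial ℝ →ₐ[ℝ] MvPolynomial (Fin 3) ℝ :=
  Polynomial.aeval (MvPolynomial.X 2)

theorem restr_heightPoly (l : GLine) (q : Polynomial ℝ) : l.restr (heightPoly q) = q := by
  apply Polynomial.funext
  intro z
  rw [GLine.eval_restr, heightPoly, Polynomial.aeval_def, Polynomial.hom_eval₂,
    Polynomial.eval₂_eq_eval_map]
  have : (MvPolynomial.eval (l.pt z)).comp (algebraMap ℝ (MvPolynomial (Fin 3) ℝ)) =
      RingHom.id ℝ := by
    ext r
    simp [MvPolynomial.algebraMap_eq]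
  rw [this]
  simp [GLine.pt]

theorem totalDegree_heightPoly_le (q : Polynomial ℝ) :
    (heightPoly q).totalDegree ≤ q.natDegree := by
  rw [heightPoly, Polynomial.aeval_eq_sum_range]
  refine MvPolynomial.totalDegree_finsetSum_le ?_
  intro i hi
  refine (MvPolynomial.totalDegree_smul_le _ _).trans ?_
  refine (MvPolynomial.totalDegree_pow _ _).trans ?_
  simp only [MvPolynomial.totalDegree_X, mul_one]
  exact Nat.le_of_lt_succ (Finset.mem_range.1 hi)

/-- For each line of a finite set there is a product of linear forms that vanishes on all the
other lines but not on it. -/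
theorem exists_separating_product (L : Finset GLine) (l : GLine) (hl : l ∈ L) :
    ∃ f : MvPolynomial (Fin 3) ℝ, f.totalDegree + 1 ≤ L.card ∧ l.restr f ≠ 0 ∧
      ∀ m ∈ L, m ≠ l → m.restr f = 0 := by
  have : ∀ m : GLine, ∃ f : MvPolynomial (Fin 3) ℝ, f.totalDegree ≤ 1 ∧
      (m ≠ l → m.restr f = 0) ∧ l.restr f ≠ 0 := by
    intro m
    by_cases h : m = l
    · exact ⟨1, by simp, fun h' => absurd h h', by simp⟩
    · obtain ⟨f, h1, h2, h3⟩ := GLine.exists_linear_form h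
      exact ⟨f, h1, fun _ => h2, h3⟩
  choose F hF1 hF2 hF3 using this
  refine ⟨∏ m ∈ L.erase l, F m, ?_, ?_, ?_⟩
  · have h1 : (∏ m ∈ L.erase l, F m).totalDegree ≤ ∑ m ∈ L.erase l, (F m).totalDegree :=
      MvPolynomial.totalDegree_finsetProd (L.erase l) F
    have h2 : ∑ m ∈ L.erase l, (F m).totalDegree ≤ ∑ m ∈ L.erase l, 1 :=
      Finset.sum_le_sum fun m _ => hF1 m
    have h3 := Finset.card_erase_add_one hl
    simp only [Finset.sum_const, smul_eq_mul, mul_one] at h2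
    omega
  · rw [map_prod]
    exact Finset.prod_ne_zero_iff.2 fun m _ => hF3 m
  · intro m hm hne
    rw [map_prod]
    exact Finset.prod_eq_zero (Finset.mem_erase.2 ⟨hne, hm⟩) (hF2 m hne)

theorem mem_polyLE {s : ℕ} {f : MvPolynomial (Fin 3) ℝ} : f ∈ PolyLE s ↔ f.totalDegree ≤ s :=
  MvPolynomial.mem_restrictTotalDegree _ _ _

theorem finrank_degreeLT (k : ℕ) : Module.finrank ℝ (Polynomial.degreeLT ℝ k) = k := by
  rw [(Polynomial.degreeLTEquiv ℝ k).finrank_eq, Module.finrank_fin_fun]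

instance finite_degreeLT (k : ℕ) : Module.Finite ℝ (Polynomial.degreeLT ℝ k) :=
  Module.Finite.equiv (Polynomial.degreeLTEquiv ℝ k).symm

theorem natDegree_le_of_mem_degreeLT {q : Polynomial ℝ} {k : ℕ}
    (h : q ∈ Polynomial.degreeLT ℝ (k + 1)) : q.natDegree ≤ k := by
  rw [Polynomial.mem_degreeLT] at h
  exact Polynomial.natDegree_le_iff_degree_le.2 (Order.le_of_lt_succ h)

/-- Hilbert function inequality behind the line version of Bézout's theorem. -/
theorem line_bezout_hilbert {f g : MvPolynomial (Fin 3) ℝ} (hf : Irreducible f) (hfg : ¬ f ∣ g)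
    (L : Finset GLine) (hL : ∀ l ∈ L, l.restr f = 0 ∧ l.restr g = 0) (s k : ℕ)
    (hk : k + L.card ≤ s + f.totalDegree + g.totalDegree + 1) :
    Module.finrank ℝ (PolyLE (s + g.totalDegree)) + Module.finrank ℝ (PolyLE (s + f.totalDegree))
      + L.card * (k + 1) ≤
    Module.finrank ℝ (PolyLE (s + f.totalDegree + g.totalDegree)) +
      Module.finrank ℝ (PolyLE s) := by
  have hf0 : f ≠ 0 := hf.ne_zero
  have hg0 : g ≠ 0 := by
    rintro rfl
    exact hfg (dvd_zero f)
  set d := f.totalDegree with hd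
  set e := g.totalDegree with he
  have hsep : ∀ l : L, ∃ p : MvPolynomial (Fin 3) ℝ, p.totalDegree + 1 ≤ L.card ∧
      l.1.restr p ≠ 0 ∧ ∀ m ∈ L, m ≠ l.1 → m.restr p = 0 :=
    fun l => exists_separating_product L l.1 l.2
  choose p hp1 hp2 hp3 using hsep
  let Φ : (PolyLE (s + e) × PolyLE (s + d)) × (L → Polynomial.degreeLT ℝ (k + 1)) →ₗ[ℝ]
      MvPolynomial (Fin 3) ℝ :=
    LinearMap.coprod
      (LinearMap.coprod ((LinearMap.mulLeft ℝ f).comp (Submodule.subtype _))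
        ((LinearMap.mulLeft ℝ g).comp (Submodule.subtype _)))
      (∑ l : L, (LinearMap.mulLeft ℝ (p l)).comp
        (heightPoly.toLinearMap.comp ((Submodule.subtype _).comp (LinearMap.proj l))))
  have hΦ : ∀ x, Φ x = f * x.1.1 + g * x.1.2 +
      ∑ l : L, p l * heightPoly (x.2 l : Polynomial ℝ) := by
    intro x
    simp [Φ]
  have hrange : LinearMap.range Φ ≤ PolyLE (s + d + e) := by
    rintro _ ⟨x, rfl⟩
    rw [hΦ, mem_polyLE]
    refine (MvPolynomial.totalDegree_add _ _).trans (max_le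
      ((MvPolynomial.totalDegree_add _ _).trans (max_le ?_ ?_)) ?_)
    · have h1 := mem_polyLE.1 x.1.1.2
      have h2 := MvPolynomial.totalDegree_mul f (x.1.1 : MvPolynomial (Fin 3) ℝ)
      omega
    · have h1 := mem_polyLE.1 x.1.2.2
      have h2 := MvPolynomial.totalDegree_mul g (x.1.2 : MvPolynomial (Fin 3) ℝ)
      omega
    · refine MvPolynomial.totalDegree_finsetSum_le ?_
      intro l _
      have h1 := natDegree_le_of_mem_degreeLT (x.2 l).2
      have h2 := totalDegree_heightPoly_le (x.2 l : Polynomial ℝ)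
      have h3 := MvPolynomial.totalDegree_mul (p l) (heightPoly (x.2 l : Polynomial ℝ))
      have h4 := hp1 l
      omega
  have hker : ∀ x ∈ LinearMap.ker Φ, x.2 = 0 ∧ f * x.1.1 + g * x.1.2 = 0 := by
    intro x hx
    rw [LinearMap.mem_ker, hΦ] at hx
    have hx2 : x.2 = 0 := by
      ext1 l
      have h := congrArg l.1.restr hx
      rw [map_add, map_add, map_mul, map_mul, (hL l.1 l.2).1, (hL l.1 l.2).2, zero_mul, zero_mul,
        zero_add, zero_add, map_zero, map_sum, Finset.sum_eq_single l, map_mul,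
        restr_heightPoly] at h
      · exact Subtype.ext ((mul_eq_zero.1 h).resolve_left (hp2 l))
      · intro m _ hm
        rw [map_mul, hp3 m l.1 l.2 (fun h => hm (Subtype.ext h.symm)), zero_mul]
      · intro h
        exact absurd (Finset.mem_univ _) h
    refine ⟨hx2, ?_⟩
    rw [hx2] at hx
    simpa using hx
  let Ψ : LinearMap.ker Φ →ₗ[ℝ] MvPolynomial (Fin 3) ℝ :=
    (Submodule.subtype _).comp ((LinearMap.snd ℝ _ _).comp
      ((LinearMap.fst ℝ _ _).comp (Submodule.subtype _)))
  have hΨ : ∀ x, Ψ x = x.1.1.2 := fun x => rfl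
  have hΨinj : Function.Injective Ψ := by
    rw [injective_iff_map_eq_zero]
    intro x hx
    rw [hΨ] at hx
    obtain ⟨h1, h2⟩ := hker x.1 x.2
    rw [hx, mul_zero, add_zero] at h2
    have h3 := (mul_eq_zero.1 h2).resolve_left hf0
    exact Subtype.ext (Prod.ext (Prod.ext (Subtype.ext h3) (Subtype.ext hx)) h1)
  have hΨrange : LinearMap.range Ψ ≤ (PolyLE s).map (LinearMap.mulLeft ℝ f) := by
    rintro _ ⟨x, rfl⟩
    rw [hΨ]
    obtain ⟨h1, h2⟩ := hker x.1 x.2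
    have hdvd : f ∣ g * x.1.1.2 := by
      refine ⟨-x.1.1.1, ?_⟩
      linear_combination h2
    obtain ⟨w, hw⟩ := (hf.prime.dvd_or_dvd hdvd).resolve_left hfg
    refine ⟨w, ?_, hw.symm⟩
    rw [SetLike.mem_coe, mem_polyLE]
    by_cases hw0 : w = 0
    · simp [hw0]
    · have h3 := mem_polyLE.1 x.1.1.2.2
      rw [hw, MvPolynomial.totalDegree_mul_of_isDomain hf0 hw0] at h3
      omega
  have e1 : Module.finrank ℝ (LinearMap.ker Φ) ≤ Module.finrank ℝ (PolyLE s) := by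
    rw [← LinearMap.finrank_range_of_inj hΨinj]
    exact (Submodule.finrank_mono hΨrange).trans (Submodule.finrank_map_le _ _)
  have e2 : Module.finrank ℝ (LinearMap.range Φ) ≤ Module.finrank ℝ (PolyLE (s + d + e)) :=
    Submodule.finrank_mono hrange
  have e3 := Φ.finrank_range_add_finrank_ker
  rw [Module.finrank_prod, Module.finrank_prod, Module.finrank_pi_fintype] at e3
  simp only [finrank_degreeLT, Finset.sum_const, Finset.card_univ, Fintype.card_coe,
    smul_eq_mul] at e3
  omega

/-- **Bézout's theorem for lines.** -/
theorem line_bezout {f g : MvPolynomial (Fin 3) ℝ} (hf : Irreducible f) (hfg : ¬ f ∣ g)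
    (L : Finset GLine) (hL : ∀ l ∈ L, l.restr f = 0 ∧ l.restr g = 0) :
    L.card ≤ f.totalDegree * g.totalDegree := by
  by_contra hcon
  push Not at hcon
  set d := f.totalDegree with hd
  set e := g.totalDegree with he
  set N := L.card with hN
  have h := line_bezout_hilbert hf hfg L hL (N ^ 2 + N) (N ^ 2 + d + e) (by omega)
  rw [← hd, ← he, ← hN] at h
  have h0 := six_mul_finrank_polyLE (N ^ 2 + N + e)
  have h1 := six_mul_finrank_polyLE (N ^ 2 + N + d)
  have h2 := six_mul_finrank_polyLE (N ^ 2 + N + d + e)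
  have h3 := six_mul_finrank_polyLE (N ^ 2 + N)
  have h4 : (N ^ 2 + N + e + 1) * (N ^ 2 + N + e + 2) * (N ^ 2 + N + e + 3) +
    (N ^ 2 + N + d + 1) * (N ^ 2 + N + d + 2) * (N ^ 2 + N + d + 3) +
    6 * (N * (N ^ 2 + d + e + 1)) ≤
    (N ^ 2 + N + d + e + 1) * (N ^ 2 + N + d + e + 2) * (N ^ 2 + N + d + e + 3) +
    (N ^ 2 + N + 1) * (N ^ 2 + N + 2) * (N ^ 2 + N + 3) := by
    rw [← h0, ← h1, ← h2, ← h3]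
    omega
  zify at h4 hcon
  have h5 : (6 : ℤ) * (N * (N ^ 2 + d + e + 1)) ≤
      3 * (d * e) * (2 * (N ^ 2 + N) + d + e + 4) := by
    nlinarith
  have h6 : (3 * (d * e) * (2 * (N ^ 2 + N) + d + e + 4) : ℤ) ≤
      3 * (N - 1) * (2 * (N ^ 2 + N) + d + e + 4) := by
    have : (0 : ℤ) ≤ 2 * (N ^ 2 + N) + d + e + 4 := by positivity
    nlinarith
  have h7 : (0 : ℤ) ≤ N * (d + e) := by positivity
  have h8 : (0 : ℤ) ≤ N := by positivity
  nlinarith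

/-- Parameter counting: few lines lie on a surface of low degree. -/
theorem exists_vanishing_on_lines (L : Finset GLine) (D : ℕ)
    (h : 6 * L.card < (D + 2) * (D + 3)) :
    ∃ f : MvPolynomial (Fin 3) ℝ, f ≠ 0 ∧ f.totalDegree ≤ D ∧ ∀ l ∈ L, l.restr f = 0 := by
  let Φ : PolyLE D →ₗ[ℝ] (L → Polynomial.degreeLT ℝ (D + 1)) :=
    LinearMap.pi fun l => LinearMap.codRestrict _
      (l.1.restr.toLinearMap.comp (Submodule.subtype _)) (by
        intro p
        rw [Polynomial.mem_degreeLT]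
        have h1 := l.1.natDegree_restr_le p.1
        have h2 := mem_polyLE.1 p.2
        refine lt_of_le_of_lt Polynomial.degree_le_natDegree ?_
        exact_mod_cast Nat.lt_succ_of_le (h1.trans h2))
  have hlt : Module.finrank ℝ (L → Polynomial.degreeLT ℝ (D + 1)) <
      Module.finrank ℝ (PolyLE D) := by
    rw [Module.finrank_pi_fintype]
    simp only [finrank_degreeLT, Finset.sum_const, Finset.card_univ, Fintype.card_coe,
      smul_eq_mul]
    have := six_mul_finrank_polyLE D
    nlinarith
  obtain ⟨p, hp, hp0⟩ := (Submodule.ne_bot_iff _).1 (LinearMap.ker_ne_bot_of_finrank_lt (f := Φ) hlt)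
  refine ⟨p, fun h => hp0 (Subtype.ext h), mem_polyLE.1 p.2, fun l hl => ?_⟩
  have := congrFun (LinearMap.mem_ker.1 hp) ⟨l, hl⟩
  exact congrArg Subtype.val this

open MvPolynomial in
/-- Chain rule for derivations and polynomial substitution. -/
theorem derivation_aeval {A : Type*} [CommRing A] [Algebra ℝ A] (D : Derivation ℝ A A)
    (g : Fin 3 → A) (p : MvPolynomial (Fin 3) ℝ) :
    D (aeval g p) = ∑ i, aeval g (pderiv i p) * D (g i) := by
  induction p using MvPolynomial.induction_on with
  | C a => simp [MvPolynomial.algHom_C]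
  | add p q hp hq => simp [hp, hq, add_mul, Finset.sum_add_distrib]
  | mul_X p j hp =>
    simp only [map_mul, aeval_X, Derivation.leibniz, hp, pderiv_X, smul_eq_mul, map_add]
    simp only [add_mul, Finset.sum_add_distrib, Pi.single_apply]
    congr 1
    · rw [Finset.sum_eq_single j]
      · simp
      · intro b _ hb
        simp [hb.symm]
      · simp
    · rw [Finset.mul_sum]
      exact Finset.sum_congr rfl fun i _ => by ring

open MvPolynomial in
theorem pderiv_comm (i j : Fin 3) (p : MvPolynomial (Fin 3) ℝ) :
    pderiv i (pderiv j p) = pderiv j (pderiv i p) := by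
  have h : ⁅(pderiv i : Derivation ℝ (MvPolynomial (Fin 3) ℝ) (MvPolynomial (Fin 3) ℝ)),
      (pderiv j : Derivation ℝ (MvPolynomial (Fin 3) ℝ) (MvPolynomial (Fin 3) ℝ))⁆ = 0 := by
    apply MvPolynomial.derivation_ext
    intro k
    simp [Derivation.commutator_apply, pderiv_X, Pi.single_apply, apply_ite]
  have := congrArg (fun D => D p) h
  simpa [Derivation.commutator_apply, sub_eq_zero] using this

open MvPolynomial in
theorem line_lemma {A : Type*} [CommRing A] [Algebra ℝ A]
    (φ : MvPolynomial (Fin 3) ℝ →ₐ[ℝ] A) (W : Derivation ℝ A A) (v : Fin 3 → A) (ρ m κ : A)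
    (I : Ideal A) (hW : ∀ i, W (φ (X i)) = ρ * v i) (hv : ∀ i, m * W (v i) - κ * v i ∈ I)
    (hI : ∀ s ∈ I, W s ∈ I) (hm : ∀ s, m * s ∈ I → s ∈ I) (hρ : ∀ s, ρ * s ∈ I → s ∈ I)
    (f : MvPolynomial (Fin 3) ℝ) (hf : φ f ∈ I) (j : ℕ) :
    (aeval (fun i => Polynomial.C (φ (X i)) + Polynomial.X * Polynomial.C (v i)) f :
      Polynomial A).coeff j ∈ I := by
  set g : Fin 3 → Polynomial A :=
    fun i => Polynomial.C (φ (X i)) + Polynomial.X * Polynomial.C (v i) with hg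
  have hzero : (aeval g f : Polynomial A).coeff 0 = φ f := by
    have : (Polynomial.constantCoeff.comp (aeval g : _ →ₐ[ℝ] Polynomial A).toRingHom) =
        φ.toRingHom := by
      apply MvPolynomial.ringHom_ext
      · intro r
        have h1 : φ (C r) = algebraMap ℝ A r := φ.commutes r
        have h2 : (aeval g (C r) : Polynomial A) = algebraMap ℝ _ r := (aeval g).commutes r
        simp [h1, Polynomial.algebraMap_apply]
      · intro i
        simp [hg]
    exact congrArg (fun ψ => ψ f) this
  obtain ⟨WP, hWP⟩ : ∃ WP : Derivation ℝ (Polynomial A) (Polynomial A),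
      ∀ p i, (WP p).coeff i = W (p.coeff i) :=
    ⟨PolynomialModule.equivPolynomialSelf.compDer W.mapCoeffs, fun _ _ => rfl⟩
  have hWPC : ∀ a, WP (Polynomial.C a) = Polynomial.C (W a) := by
    intro a
    ext i
    rw [hWP, Polynomial.coeff_C, Polynomial.coeff_C]
    split_ifs <;> simp
  have hWPX : WP Polynomial.X = 0 := by
    ext i
    rw [hWP, Polynomial.coeff_X]
    split_ifs <;> simp
  have h1 := derivation_aeval WP g f
  have h2 := derivation_aeval (Polynomial.derivative'.restrictScalars ℝ) g f
  have h1' : ∀ i, WP (g i) = Polynomial.C (ρ * v i) + Polynomial.X * Polynomial.C (W (v i)) := by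
    intro i
    simp [hg, hWPC, hWPX, hW]
  have h2' : ∀ i, Polynomial.derivative (g i) = Polynomial.C (v i) := by
    intro i
    simp [hg]
  have h2 : Polynomial.derivative (aeval g f : Polynomial A) =
      ∑ i, aeval g (pderiv i f) * Polynomial.C (v i) := by
    rw [← Finset.sum_congr rfl fun i _ => congrArg _ (h2' i)]
    exact h2
  simp only [h1'] at h1
  set F : Polynomial A := aeval g f with hF
  have key : Polynomial.C m * WP F - (Polynomial.C (m * ρ) + Polynomial.X * Polynomial.C κ) *
      Polynomial.derivative F ∈ I.map (Polynomial.C : A →+* Polynomial A) := by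
    have : Polynomial.C m * WP F - (Polynomial.C (m * ρ) + Polynomial.X * Polynomial.C κ) *
        Polynomial.derivative F = ∑ i, aeval g (pderiv i f) * Polynomial.X *
          Polynomial.C (m * W (v i) - κ * v i) := by
      rw [h1, h2, Finset.mul_sum, Finset.mul_sum, ← Finset.sum_sub_distrib]
      refine Finset.sum_congr rfl fun i _ => ?_
      simp only [map_mul, map_sub]
      ring
    rw [this]
    exact Ideal.sum_mem _ fun i _ => Ideal.mul_mem_left _ _ (Ideal.mem_map_of_mem _ (hv i))
  rw [Ideal.mem_map_C_iff] at key
  induction j with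
  | zero => rw [hzero]; exact hf
  | succ j ih =>
    have hk := key j
    have hx : (Polynomial.X * Polynomial.C κ * Polynomial.derivative F).coeff j =
        κ * (j * F.coeff j) := by
      cases j with
      | zero => simp [mul_assoc]
      | succ j =>
        rw [mul_assoc, Polynomial.coeff_X_mul, Polynomial.coeff_C_mul, Polynomial.coeff_derivative]
        push_cast
        ring
    rw [add_mul, Polynomial.coeff_sub, Polynomial.coeff_add, hx, Polynomial.coeff_C_mul,
      Polynomial.coeff_C_mul, Polynomial.coeff_derivative, hWP] at hk
    have h3 : m * (ρ * (F.coeff (j + 1) * (j + 1))) ∈ I := by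
      have h4 := I.sub_mem (I.sub_mem (I.mul_mem_left m (hI _ ih)) hk)
        (I.mul_mem_left (κ * j) ih)
      convert h4 using 1
      ring
    have h5 := hρ _ (hm _ h3)
    have h6 := I.mul_mem_left (algebraMap ℝ A ((j + 1 : ℝ)⁻¹)) h5
    convert h6 using 1
    have h7 : algebraMap ℝ A ((j + 1 : ℝ)⁻¹) * (j + 1) = 1 := by
      have : ((j : A) + 1) = algebraMap ℝ A (j + 1) := by simp
      rw [this, ← map_mul, inv_mul_cancel₀ (by positivity), map_one]
    linear_combination (-F.coeff (j + 1)) * h7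

section Forms

open MvPolynomial

variable {A B : Type*} [CommRing A] [Algebra ℝ A] [CommRing B] [Algebra ℝ B]

/-- First differential of `f`, with coefficients pushed forward along `φ`. -/
noncomputable def form1 (φ : MvPolynomial (Fin 3) ℝ →ₐ[ℝ] A) (f : MvPolynomial (Fin 3) ℝ)
    (u : Fin 3 → A) : A :=
  ∑ i, φ (pderiv i f) * u i

/-- Second differential of `f`, with coefficients pushed forward along `φ`. -/
noncomputable def form2 (φ : MvPolynomial (Fin 3) ℝ →ₐ[ℝ] A) (f : MvPolynomial (Fin 3) ℝ)
    (u v : Fin 3 → A) : A :=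
  ∑ i, form1 φ (pderiv i f) v * u i

/-- Third differential of `f`, with coefficients pushed forward along `φ`. -/
noncomputable def form3 (φ : MvPolynomial (Fin 3) ℝ →ₐ[ℝ] A) (f : MvPolynomial (Fin 3) ℝ)
    (u v w : Fin 3 → A) : A :=
  ∑ i, form2 φ (pderiv i f) v w * u i

theorem form1_linear (φ : MvPolynomial (Fin 3) ℝ →ₐ[ℝ] A) (f : MvPolynomial (Fin 3) ℝ) (s t : A)
    (u v : Fin 3 → A) :
    form1 φ f (s • u + t • v) = s * form1 φ f u + t * form1 φ f v := by
  simp only [form1, Fin.sum_univ_three, Pi.add_apply, Pi.smul_apply, smul_eq_mul]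
  ring

theorem form2_comm (φ : MvPolynomial (Fin 3) ℝ →ₐ[ℝ] A) (f : MvPolynomial (Fin 3) ℝ)
    (u v : Fin 3 → A) : form2 φ f u v = form2 φ f v u := by
  simp only [form2, form1, Finset.sum_mul]
  rw [Finset.sum_comm]
  refine Finset.sum_congr rfl fun i _ => Finset.sum_congr rfl fun j _ => ?_
  rw [pderiv_comm]
  ring

theorem form2_linear (φ : MvPolynomial (Fin 3) ℝ →ₐ[ℝ] A) (f : MvPolynomial (Fin 3) ℝ) (s t : A)
    (u v w : Fin 3 → A) :
    form2 φ f (s • u + t • v) w = s * form2 φ f u w + t * form2 φ f v w := by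
  simp only [form2, Fin.sum_univ_three, Pi.add_apply, Pi.smul_apply, smul_eq_mul]
  ring

theorem form2_linear_right (φ : MvPolynomial (Fin 3) ℝ →ₐ[ℝ] A) (f : MvPolynomial (Fin 3) ℝ)
    (s t : A) (u v w : Fin 3 → A) :
    form2 φ f w (s • u + t • v) = s * form2 φ f w u + t * form2 φ f w v := by
  rw [form2_comm, form2_linear, form2_comm φ f u, form2_comm φ f v]

theorem form3_swap_left (φ : MvPolynomial (Fin 3) ℝ →ₐ[ℝ] A) (f : MvPolynomial (Fin 3) ℝ)
    (u v w : Fin 3 → A) : form3 φ f u v w = form3 φ f v u w := by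
  simp only [form3, form2, Finset.sum_mul]
  rw [Finset.sum_comm]
  refine Finset.sum_congr rfl fun i _ => Finset.sum_congr rfl fun j _ => ?_
  rw [pderiv_comm]
  ring

theorem form3_swap_right (φ : MvPolynomial (Fin 3) ℝ →ₐ[ℝ] A) (f : MvPolynomial (Fin 3) ℝ)
    (u v w : Fin 3 → A) : form3 φ f u v w = form3 φ f u w v := by
  simp only [form3]
  exact Finset.sum_congr rfl fun i _ => by rw [form2_comm]

theorem form3_linear (φ : MvPolynomial (Fin 3) ℝ →ₐ[ℝ] A) (f : MvPolynomial (Fin 3) ℝ) (s t : A)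
    (u v w x : Fin 3 → A) :
    form3 φ f (s • u + t • v) w x = s * form3 φ f u w x + t * form3 φ f v w x := by
  simp only [form3, Fin.sum_univ_three, Pi.add_apply, Pi.smul_apply, smul_eq_mul]
  ring

theorem form2_diag (φ : MvPolynomial (Fin 3) ℝ →ₐ[ℝ] A) (f : MvPolynomial (Fin 3) ℝ) (s t : A)
    (u v : Fin 3 → A) :
    form2 φ f (s • u + t • v) (s • u + t • v) =
      s ^ 2 * form2 φ f u u + 2 * s * t * form2 φ f u v + t ^ 2 * form2 φ f v v := by
  rw [form2_linear, form2_linear_right, form2_linear_right, form2_comm φ f v u]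
  ring

theorem form3_diag (φ : MvPolynomial (Fin 3) ℝ →ₐ[ℝ] A) (f : MvPolynomial (Fin 3) ℝ) (s t : A)
    (u v : Fin 3 → A) :
    form3 φ f (s • u + t • v) (s • u + t • v) (s • u + t • v) =
      s ^ 3 * form3 φ f u u u + 3 * s ^ 2 * t * form3 φ f u u v +
        3 * s * t ^ 2 * form3 φ f u v v + t ^ 3 * form3 φ f v v v := by
  have h2 : ∀ a b, form3 φ f a (s • u + t • v) b = s * form3 φ f a u b + t * form3 φ f a v b := by
    intro a b
    rw [form3_swap_left, form3_linear, form3_swap_left φ f u, form3_swap_left φ f v]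
  have h3 : ∀ a b, form3 φ f a b (s • u + t • v) = s * form3 φ f a b u + t * form3 φ f a b v := by
    intro a b
    rw [form3_swap_right, h2, form3_swap_right φ f a u, form3_swap_right φ f a v]
  rw [form3_linear, h2, h2, h3, h3, h3, h3, form3_swap_right φ f u v u, form3_swap_left φ f v u u,
    form3_swap_right φ f u v u, form3_swap_left φ f v u v, form3_swap_right φ f v v u,
    form3_swap_left φ f v u v]
  ring

theorem map_form1 (ψ : A →ₐ[ℝ] B) (φ : MvPolynomial (Fin 3) ℝ →ₐ[ℝ] A)
    (f : MvPolynomial (Fin 3) ℝ) (u : Fin 3 → A) :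
    ψ (form1 φ f u) = form1 (ψ.comp φ) f (fun i => ψ (u i)) := by
  simp [form1]

theorem map_form2 (ψ : A →ₐ[ℝ] B) (φ : MvPolynomial (Fin 3) ℝ →ₐ[ℝ] A)
    (f : MvPolynomial (Fin 3) ℝ) (u v : Fin 3 → A) :
    ψ (form2 φ f u v) = form2 (ψ.comp φ) f (fun i => ψ (u i)) (fun i => ψ (v i)) := by
  simp [form2, map_form1]

theorem map_form3 (ψ : A →ₐ[ℝ] B) (φ : MvPolynomial (Fin 3) ℝ →ₐ[ℝ] A)
    (f : MvPolynomial (Fin 3) ℝ) (u v w : Fin 3 → A) :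
    ψ (form3 φ f u v w) =
      form3 (ψ.comp φ) f (fun i => ψ (u i)) (fun i => ψ (v i)) (fun i => ψ (w i)) := by
  simp [form3, map_form2]

theorem derivation_form1 (φ : MvPolynomial (Fin 3) ℝ →ₐ[ℝ] A) (W : Derivation ℝ A A)
    (v : Fin 3 → A) (ρ : A) (hW : ∀ p, W (φ p) = ρ * form1 φ p v) (f : MvPolynomial (Fin 3) ℝ)
    (u : Fin 3 → A) :
    W (form1 φ f u) = ρ * form2 φ f u v + form1 φ f (fun i => W (u i)) := by
  simp only [form2]
  rw [form1, map_sum, form1, Finset.mul_sum, ← Finset.sum_add_distrib]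
  refine Finset.sum_congr rfl fun i _ => ?_
  rw [Derivation.leibniz, hW, smul_eq_mul, smul_eq_mul]
  ring

theorem derivation_form2 (φ : MvPolynomial (Fin 3) ℝ →ₐ[ℝ] A) (W : Derivation ℝ A A)
    (v : Fin 3 → A) (ρ : A) (hW : ∀ p, W (φ p) = ρ * form1 φ p v) (f : MvPolynomial (Fin 3) ℝ)
    (u : Fin 3 → A) :
    W (form2 φ f u u) = ρ * form3 φ f u u v + 2 * form2 φ f u (fun i => W (u i)) := by
  have h1 : W (form2 φ f u u) = ρ * form3 φ f u u v + form2 φ f u (fun i => W (u i)) +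
      form2 φ f (fun i => W (u i)) u := by
    rw [form2, map_sum, form3, Finset.mul_sum, form2, form2, ← Finset.sum_add_distrib,
      ← Finset.sum_add_distrib]
    refine Finset.sum_congr rfl fun i _ => ?_
    rw [Derivation.leibniz, derivation_form1 φ W v ρ hW, smul_eq_mul, smul_eq_mul]
    ring
  rw [h1, form2_comm φ f (fun i => W (u i)) u]
  ring

end Forms

section Quadratic

open MvPolynomial

/-- The derivation `2 ω ∂ᵢ` of the quadratic extension obtained by adjoining `ω = √Δ`. -/
noncomputable def quadDeriv (Δ : MvPolynomial (Fin 3) ℝ) (i : Fin 3) :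
    Derivation ℝ (QuadraticAlgebra (MvPolynomial (Fin 3) ℝ) Δ 0)
      (QuadraticAlgebra (MvPolynomial (Fin 3) ℝ) Δ 0) :=
  Derivation.mk'
    { toFun := fun z => ⟨2 * Δ * pderiv i z.im + z.im * pderiv i Δ, 2 * pderiv i z.re⟩
      map_add' := fun z w => by
        ext1
        · simp only [QuadraticAlgebra.im_add, QuadraticAlgebra.re_add, map_add]
          ring
        · simp only [QuadraticAlgebra.im_add, QuadraticAlgebra.re_add, map_add]
          ring
      map_smul' := fun r z => by
        ext1
        · simp [smul_add]
        · simp }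
    (fun z w => by
      ext1
      · simp
        ring
      · simp
        ring)

theorem quadDeriv_algebraMap (Δ : MvPolynomial (Fin 3) ℝ) (i : Fin 3)
    (p : MvPolynomial (Fin 3) ℝ) :
    quadDeriv Δ i (algebraMap _ (QuadraticAlgebra (MvPolynomial (Fin 3) ℝ) Δ 0) p) =
      2 * QuadraticAlgebra.omega * algebraMap _ _ (pderiv i p) := by
  ext1
  · simp [quadDeriv, QuadraticAlgebra.im_ofNat]
  · simp [quadDeriv, QuadraticAlgebra.re_ofNat]

theorem quad_mem_span_iff {Δ f : MvPolynomial (Fin 3) ℝ}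
    {z : QuadraticAlgebra (MvPolynomial (Fin 3) ℝ) Δ 0} :
    z ∈ Ideal.span {algebraMap _ (QuadraticAlgebra (MvPolynomial (Fin 3) ℝ) Δ 0) f} ↔
      f ∣ z.re ∧ f ∣ z.im := by
  rw [Ideal.mem_span_singleton]
  constructor
  · rintro ⟨w, rfl⟩
    exact ⟨⟨w.re, by simp⟩, ⟨w.im, by simp⟩⟩
  · rintro ⟨⟨a, ha⟩, ⟨b, hb⟩⟩
    refine ⟨⟨a, b⟩, ?_⟩
    ext1
    · simp [ha]
    · simp [hb]

end Quadratic

theorem triple_expansion {A : Type*} [CommRing A] (n c d y : Fin 3 → A) :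
    (dotProduct n (crossProduct c d)) • y = (dotProduct y n) • crossProduct c d +
      ((dotProduct y d) • crossProduct n c + (-dotProduct y c) • crossProduct n d) := by
  ext i
  fin_cases i <;>
    simp [cross_apply, dotProduct, Fin.sum_univ_three] <;> ring

section Ruling

open MvPolynomial

/-- The tangent field `∇f × c`. -/
noncomputable def tang (f : MvPolynomial (Fin 3) ℝ) (c : Fin 3 → ℝ) :
    Fin 3 → MvPolynomial (Fin 3) ℝ :=
  crossProduct (fun i => pderiv i f) (fun i => C (c i))

/-- The second differential of `f` on the tangent fields attached to `c` and `d`. -/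
noncomputable def hess (f : MvPolynomial (Fin 3) ℝ) (c d : Fin 3 → ℝ) : MvPolynomial (Fin 3) ℝ :=
  form2 (AlgHom.id ℝ _) f (tang f c) (tang f d)

/-- The discriminant of the second differential on the tangent plane. -/
noncomputable def disc (f : MvPolynomial (Fin 3) ℝ) (c d : Fin 3 → ℝ) : MvPolynomial (Fin 3) ℝ :=
  hess f c d ^ 2 - hess f c c * hess f d d

/-- The factor by which `tang f c × tang f d` is a multiple of `∇f`. -/
noncomputable def tripleFactor (f : MvPolynomial (Fin 3) ℝ) (c d : Fin 3 → ℝ) :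
    MvPolynomial (Fin 3) ℝ :=
  dotProduct (fun i => pderiv i f) (crossProduct (fun i => C (c i)) (fun i => C (d i)))

/-- The quadratic extension of the polynomial ring by the square root of the discriminant. -/
noncomputable abbrev DiscRing (f : MvPolynomial (Fin 3) ℝ) (c d : Fin 3 → ℝ) : Type :=
  QuadraticAlgebra (MvPolynomial (Fin 3) ℝ) (disc f c d) 0

/-- The inclusion of polynomials in the quadratic extension. -/
noncomputable def discIncl (f : MvPolynomial (Fin 3) ℝ) (c d : Fin 3 → ℝ) :
    MvPolynomial (Fin 3) ℝ →ₐ[ℝ] DiscRing f c d :=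
  IsScalarTower.toAlgHom ℝ (MvPolynomial (Fin 3) ℝ) (DiscRing f c d)

/-- The asymptotic direction field. -/
noncomputable def asym (f : MvPolynomial (Fin 3) ℝ) (c d : Fin 3 → ℝ) : Fin 3 → DiscRing f c d :=
  (QuadraticAlgebra.omega - discIncl f c d (hess f c d)) • (fun i => discIncl f c d (tang f c i)) +
    (discIncl f c d (hess f c c)) • (fun i => discIncl f c d (tang f d i))

theorem form1_tang (f : MvPolynomial (Fin 3) ℝ) (c : Fin 3 → ℝ) :
    form1 (AlgHom.id ℝ _) f (tang f c) = 0 := by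
  simp [form1, tang, cross_apply, Fin.sum_univ_three]
  ring

theorem omega_sq (f : MvPolynomial (Fin 3) ℝ) (c d : Fin 3 → ℝ) :
    (QuadraticAlgebra.omega : DiscRing f c d) ^ 2 = discIncl f c d (disc f c d) := by
  ext1 <;> simp [pow_two, discIncl]

theorem omega_sq_eq (f : MvPolynomial (Fin 3) ℝ) (c d : Fin 3 → ℝ) :
    (QuadraticAlgebra.omega : DiscRing f c d) ^ 2 = discIncl f c d (hess f c d) ^ 2 -
      discIncl f c d (hess f c c) * discIncl f c d (hess f d d) := by
  rw [omega_sq, ← map_pow, ← map_mul, ← map_sub]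
  rfl

theorem discIncl_hess (f : MvPolynomial (Fin 3) ℝ) (c d a b : Fin 3 → ℝ) :
    form2 (discIncl f c d) f (fun i => discIncl f c d (tang f a i))
      (fun i => discIncl f c d (tang f b i)) = discIncl f c d (hess f a b) := by
  rw [hess, map_form2]
  rfl

theorem form1_asym (f : MvPolynomial (Fin 3) ℝ) (c d : Fin 3 → ℝ) :
    form1 (discIncl f c d) f (asym f c d) = 0 := by
  have h : ∀ a, form1 (discIncl f c d) f (fun i => discIncl f c d (tang f a i)) = 0 := by
    intro a
    have := congrArg (discIncl f c d) (form1_tang f a)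
    rw [map_form1, map_zero] at this
    exact this
  rw [asym, form1_linear, h, h]
  ring

theorem hess_comm (f : MvPolynomial (Fin 3) ℝ) (c d : Fin 3 → ℝ) : hess f c d = hess f d c :=
  form2_comm _ _ _ _

theorem form2_asym (f : MvPolynomial (Fin 3) ℝ) (c d : Fin 3 → ℝ) :
    form2 (discIncl f c d) f (asym f c d) (asym f c d) = 0 := by
  rw [asym, form2_diag, discIncl_hess, discIncl_hess, discIncl_hess]
  have h := omega_sq_eq f c d
  linear_combination (discIncl f c d (hess f c c)) * h

/-- If the third differential vanishes on the asymptotic directions, these are directions of lines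
contained in the surface. -/
theorem asym_line_coeff {f : MvPolynomial (Fin 3) ℝ} (hf : Irreducible f) {c d : Fin 3 → ℝ}
    (hα : ¬ f ∣ hess f c c) (hη : ¬ f ∣ tripleFactor f c d) (hΔ : ¬ f ∣ disc f c d)
    (hE : form3 (discIncl f c d) f (asym f c d) (asym f c d) (asym f c d) ∈
      Ideal.span {discIncl f c d f}) (j : ℕ) :
    (aeval (fun i => Polynomial.C (discIncl f c d (X i)) +
      Polynomial.X * Polynomial.C (asym f c d i)) f : Polynomial (DiscRing f c d)).coeff j ∈
        Ideal.span {discIncl f c d f} := by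
  set ι := discIncl f c d with hι
  set v := asym f c d with hv
  set ω : DiscRing f c d := QuadraticAlgebra.omega with hω
  set I := Ideal.span {ι f} with hI
  have hprime := hf.prime
  let W : Derivation ℝ (DiscRing f c d) (DiscRing f c d) := ∑ i, v i • quadDeriv (disc f c d) i
  have hWapp : ∀ z, W z = ∑ i, v i * quadDeriv (disc f c d) i z := by
    intro z
    simp [W, Fin.sum_univ_three]
  have hW : ∀ p, W (ι p) = (2 * ω) * form1 ι p v := by
    intro p
    rw [hWapp, form1, Finset.mul_sum]
    refine Finset.sum_congr rfl fun i _ => ?_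
    have : quadDeriv (disc f c d) i (ι p) = 2 * ω * ι (pderiv i p) :=
      quadDeriv_algebraMap _ _ _
    rw [this]
    ring
  have hιcancel : ∀ p, ¬ f ∣ p → ∀ s, ι p * s ∈ I → s ∈ I := by
    intro p hp s hs
    have h := quad_mem_span_iff.1 hs
    have h1 : (ι p * s).re = p * s.re := by simp [hι, discIncl]
    have h2 : (ι p * s).im = p * s.im := by simp [hι, discIncl]
    rw [h1, h2] at h
    exact quad_mem_span_iff.2 ⟨(hprime.dvd_or_dvd h.1).resolve_left hp,
      (hprime.dvd_or_dvd h.2).resolve_left hp⟩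
  have hωcancel : ∀ s, ω * s ∈ I → s ∈ I := by
    intro s hs
    apply hιcancel _ hΔ
    have := I.mul_mem_left ω hs
    rwa [← mul_assoc, ← pow_two, omega_sq] at this
  have h2cancel : ∀ s, 2 * s ∈ I → s ∈ I := by
    intro s hs
    have := I.mul_mem_left (algebraMap ℝ _ (1 / 2)) hs
    convert this using 1
    have h : algebraMap ℝ (DiscRing f c d) (1 / 2) * 2 = 1 := by
      have h2 : (2 : DiscRing f c d) = algebraMap ℝ _ 2 := (map_ofNat _ 2).symm
      rw [h2, ← map_mul]
      norm_num
    rw [← mul_assoc, h, one_mul]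
  have hρ : ∀ s, 2 * ω * s ∈ I → s ∈ I := fun s hs =>
    hωcancel _ (h2cancel _ (by rwa [← mul_assoc]))
  have hn : form1 ι f (fun i => W (v i)) = 0 := by
    have h := derivation_form1 ι W v _ hW f v
    rw [form1_asym, form2_asym, map_zero, mul_zero, zero_add] at h
    exact h.symm
  have hH : form2 ι f v (fun i => W (v i)) ∈ I := by
    have h := derivation_form2 ι W v _ hW f v
    rw [form2_asym, map_zero] at h
    apply h2cancel
    have h2 : 2 * form2 ι f v (fun i => W (v i)) = -(2 * ω) * form3 ι f v v v := by
      linear_combination -h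
    rw [h2]
    exact I.mul_mem_left _ hE
  set y := fun i => W (v i) with hy
  set s' := dotProduct y (fun i => ι (C (d i))) with hs'
  set t' := -dotProduct y (fun i => ι (C (c i))) with ht'
  have hexp : ι (tripleFactor f c d) • y =
      s' • (fun i => ι (tang f c i)) + t' • (fun i => ι (tang f d i)) := by
    have h := triple_expansion (fun i => ι (pderiv i f)) (fun i => ι (C (c i)))
      (fun i => ι (C (d i))) y
    have h0 : dotProduct y (fun i => ι (pderiv i f)) = 0 := by
      rw [← hn, form1, dotProduct]
      exact Finset.sum_congr rfl fun i _ => mul_comm _ _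
    have h1 : dotProduct (fun i => ι (pderiv i f))
        (crossProduct (fun i => ι (C (c i))) (fun i => ι (C (d i)))) = ι (tripleFactor f c d) := by
      simp [tripleFactor, dotProduct, cross_apply, Fin.sum_univ_three]
    have h2 : ∀ a : Fin 3 → ℝ, crossProduct (fun i => ι (pderiv i f)) (fun i => ι (C (a i))) =
        fun i => ι (tang f a i) := by
      intro a
      ext1 i
      fin_cases i <;> simp [tang, cross_apply]
    rw [h0, h1, h2, h2, zero_smul, zero_add] at h
    exact h
  have hωsq := omega_sq_eq f c d
  have hdet : ι (hess f c c) * s' - (ω - ι (hess f c d)) * t' ∈ I := by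
    apply hωcancel
    have h1 : form2 ι f v (ι (tripleFactor f c d) • y) =
        ω * (ι (hess f c c) * s' - (ω - ι (hess f c d)) * t') := by
      rw [hexp, form2_linear_right, hv, asym, form2_linear, form2_linear, discIncl_hess,
        discIncl_hess, discIncl_hess, discIncl_hess, hess_comm f d c]
      linear_combination t' * hωsq
    have h2 : form2 ι f v (ι (tripleFactor f c d) • y) = ι (tripleFactor f c d) * form2 ι f v y := by
      have := form2_linear_right ι f (ι (tripleFactor f c d)) 0 y 0 v
      simpa using this
    rw [← h1, h2]
    exact I.mul_mem_left _ hH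
  refine line_lemma ι W v (2 * ω) (ι (hess f c c * tripleFactor f c d)) t' I ?_ ?_ ?_ ?_ hρ f
    (Ideal.mem_span_singleton_self _) j
  · intro i
    rw [hW]
    simp [form1, Pi.single_apply]
  · intro i
    have h := congrFun hexp i
    simp only [Pi.smul_apply, Pi.add_apply, smul_eq_mul] at h
    have hvi : v i = (ω - ι (hess f c d)) * ι (tang f c i) + ι (hess f c c) * ι (tang f d i) := rfl
    have h3 : ι (hess f c c * tripleFactor f c d) * W (v i) - t' * v i =
        ι (tang f c i) * (ι (hess f c c) * s' - (ω - ι (hess f c d)) * t') := by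
      rw [map_mul, hvi]
      have h' : ι (tripleFactor f c d) * W (v i) = s' * ι (tang f c i) + t' * ι (tang f d i) := h
      rw [hvi] at h'
      linear_combination ι (hess f c c) * h'
    rw [h3]
    exact I.mul_mem_left _ hdet
  · intro s hs
    obtain ⟨w, rfl⟩ := Ideal.mem_span_singleton.1 hs
    rw [Derivation.leibniz, hW, form1_asym, mul_zero, smul_zero, add_zero, smul_eq_mul]
    exact I.mul_mem_right _ (Ideal.mem_span_singleton_self _)
  · refine hιcancel _ ?_
    intro h
    exact (hprime.dvd_or_dvd h).elim hα hη

end Ruling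

section Eval

open MvPolynomial

theorem eval_line_eq_zero {A : Type*} [CommRing A] [Algebra ℝ A]
    (φ : MvPolynomial (Fin 3) ℝ →ₐ[ℝ] A) (v : Fin 3 → A) (I : Ideal A)
    (f : MvPolynomial (Fin 3) ℝ)
    (h : ∀ j, (aeval (fun i => Polynomial.C (φ (X i)) + Polynomial.X * Polynomial.C (v i)) f :
      Polynomial A).coeff j ∈ I) (ψ : A →ₐ[ℝ] ℝ) (hψ : ∀ s ∈ I, ψ s = 0) (τ : ℝ) :
    eval (fun i => ψ (φ (X i)) + τ * ψ (v i)) f = 0 := by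
  set g : Fin 3 → Polynomial A :=
    fun i => Polynomial.C (φ (X i)) + Polynomial.X * Polynomial.C (v i) with hg
  have h1 : (Polynomial.eval₂RingHom (ψ : A →+* ℝ) τ).comp
      (aeval g : MvPolynomial (Fin 3) ℝ →ₐ[ℝ] Polynomial A).toRingHom =
        eval (fun i => ψ (φ (X i)) + τ * ψ (v i)) := by
    apply MvPolynomial.ringHom_ext
    · intro r
      simp [Polynomial.algebraMap_apply]
    · intro i
      simp [hg]
      ring
  rw [← h1]
  change Polynomial.eval₂ (ψ : A →+* ℝ) τ (aeval g f) = 0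
  rw [Polynomial.eval₂_eq_sum_range]
  refine Finset.sum_eq_zero fun j _ => ?_
  have h3 : (ψ : A →+* ℝ) ((aeval g f : Polynomial A).coeff j) = 0 := hψ _ (h j)
  rw [h3, zero_mul]

/-- Evaluation of the quadratic extension at a point, given a square root of the discriminant. -/
noncomputable def discEval (f : MvPolynomial (Fin 3) ℝ) (c d : Fin 3 → ℝ) (x : Fin 3 → ℝ) (r : ℝ)
    (hr : r ^ 2 = eval x (disc f c d)) : DiscRing f c d →ₐ[ℝ] ℝ where
  toFun z := eval x z.re + r * eval x z.im
  map_one' := by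
    simp [QuadraticAlgebra.re_one, QuadraticAlgebra.im_one]
  map_mul' z w := by
    simp only [QuadraticAlgebra.re_mul, QuadraticAlgebra.im_mul, map_add, map_mul, map_zero, ← hr]
    ring
  map_zero' := by simp
  map_add' z w := by
    simp only [QuadraticAlgebra.re_add, QuadraticAlgebra.im_add, map_add]
    ring
  commutes' a := by
    have h1 : (algebraMap ℝ (DiscRing f c d) a).re = C a := rfl
    have h2 : (algebraMap ℝ (DiscRing f c d) a).im = 0 := rfl
    simp [h1, h2]

theorem discEval_incl (f : MvPolynomial (Fin 3) ℝ) (c d : Fin 3 → ℝ) (x : Fin 3 → ℝ) (r : ℝ)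
    (hr : r ^ 2 = eval x (disc f c d)) (p : MvPolynomial (Fin 3) ℝ) :
    discEval f c d x r hr (discIncl f c d p) = eval x p := by
  have h1 : (discIncl f c d p).re = p := rfl
  have h2 : (discIncl f c d p).im = 0 := rfl
  change eval x (discIncl f c d p).re + r * eval x (discIncl f c d p).im = _
  rw [h1, h2]
  simp

theorem discEval_omega (f : MvPolynomial (Fin 3) ℝ) (c d : Fin 3 → ℝ) (x : Fin 3 → ℝ) (r : ℝ)
    (hr : r ^ 2 = eval x (disc f c d)) :
    discEval f c d x r hr QuadraticAlgebra.omega = r := by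
  change eval x (QuadraticAlgebra.omega : DiscRing f c d).re +
    r * eval x (QuadraticAlgebra.omega : DiscRing f c d).im = _
  simp

/-- The real asymptotic direction at `x` attached to the square root `r` of the discriminant. -/
noncomputable def asymAt (f : MvPolynomial (Fin 3) ℝ) (c d : Fin 3 → ℝ) (x : Fin 3 → ℝ) (r : ℝ) :
    Fin 3 → ℝ :=
  (r - eval x (hess f c d)) • (fun i => eval x (tang f c i)) +
    eval x (hess f c c) • (fun i => eval x (tang f d i))

theorem discEval_asym (f : MvPolynomial (Fin 3) ℝ) (c d : Fin 3 → ℝ) (x : Fin 3 → ℝ) (r : ℝ)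
    (hr : r ^ 2 = eval x (disc f c d)) (i : Fin 3) :
    discEval f c d x r hr (asym f c d i) = asymAt f c d x r i := by
  simp [asym, asymAt, discEval_incl, discEval_omega]

theorem asym_line {f : MvPolynomial (Fin 3) ℝ} (hf : Irreducible f) {c d : Fin 3 → ℝ}
    (hα : ¬ f ∣ hess f c c) (hη : ¬ f ∣ tripleFactor f c d) (hΔ : ¬ f ∣ disc f c d)
    (hE : form3 (discIncl f c d) f (asym f c d) (asym f c d) (asym f c d) ∈
      Ideal.span {discIncl f c d f}) {x : Fin 3 → ℝ} (hx : eval x f = 0) {r : ℝ}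
    (hr : r ^ 2 = eval x (disc f c d)) (τ : ℝ) :
    eval (x + τ • asymAt f c d x r) f = 0 := by
  have h := eval_line_eq_zero (discIncl f c d) (asym f c d) _ f
    (asym_line_coeff hf hα hη hΔ hE) (discEval f c d x r hr) (by
      intro s hs
      obtain ⟨w, rfl⟩ := Ideal.mem_span_singleton.1 hs
      rw [map_mul, discEval_incl, hx, zero_mul]) τ
  simp only [discEval_incl, discEval_asym, eval_X] at h
  exact h

theorem totalDegree_pderiv_le (i : Fin 3) (f : MvPolynomial (Fin 3) ℝ) :
    (pderiv i f).totalDegree ≤ f.totalDegree - 1 := by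
  conv_lhs => rw [← support_sum_monomial_coeff f, map_sum]
  refine totalDegree_finsetSum_le fun s hs => ?_
  rw [pderiv_monomial]
  by_cases h : s i = 0
  · simp [h]
  · refine (totalDegree_monomial_le _ _).trans ?_
    have h1 := le_totalDegree hs
    have h2 : s = (s - Finsupp.single i 1) + Finsupp.single i 1 := by
      rw [tsub_add_cancel_of_le]
      rw [Finsupp.single_le_iff]
      omega
    have h3 : (s.sum fun _ e => e) = ((s - Finsupp.single i 1).sum fun _ e => e) + 1 := by
      conv_lhs => rw [h2]
      rw [Finsupp.sum_add_index' (fun _ => rfl) (fun _ _ _ => rfl)]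
      simp
    change ((s - Finsupp.single i 1).sum fun _ e => e) ≤ _
    omega

theorem exists_pderiv_not_dvd {f : MvPolynomial (Fin 3) ℝ} (hf : Irreducible f) :
    ∃ i, ¬ f ∣ pderiv i f := by
  by_contra! hcon
  have hlt : ∀ i, pderiv i f = 0 := by
    intro i
    by_contra h
    have h1 := totalDegree_le_of_dvd_of_isDomain (hcon i) h
    have h2 : (pderiv i f).totalDegree < f.totalDegree := by
      have h3 := totalDegree_pderiv_le i f
      have h4 : f.totalDegree ≠ 0 := by
        intro h0
        rw [totalDegree_eq_zero_iff_eq_C] at h0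
        rw [h0, pderiv_C] at h
        exact h rfl
      omega
    omega
  have hconst : f = C (eval 0 f) := by
    apply MvPolynomial.funext
    intro x
    have h := derivation_aeval (Polynomial.derivative'.restrictScalars ℝ)
      (fun i => Polynomial.C (x i) * Polynomial.X) f
    simp only [hlt, map_zero, zero_mul, Finset.sum_const_zero] at h
    have h2 : ∀ t, Polynomial.eval t (aeval (fun i => Polynomial.C (x i) * Polynomial.X) f :
        Polynomial ℝ) = eval (fun i => x i * t) f := by
      intro t
      have : (Polynomial.evalRingHom t).comp (aeval (fun i => Polynomial.C (x i) * Polynomial.X) :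
          MvPolynomial (Fin 3) ℝ →ₐ[ℝ] Polynomial ℝ).toRingHom = eval (fun i => x i * t) := by
        apply MvPolynomial.ringHom_ext
        · intro r
          simp
        · intro i
          simp
      exact congrArg (fun χ => χ f) this
    have h3 := Polynomial.eq_C_of_derivative_eq_zero (R := ℝ) h
    have h4 := h2 1
    have h5 := h2 0
    rw [h3, Polynomial.eval_C] at h4 h5
    simp only [mul_one, mul_zero] at h4 h5
    rw [eval_C, ← h4, h5]
    rfl
  apply hf.not_isUnit
  rw [hconst]
  apply IsUnit.map
  rw [isUnit_iff_ne_zero]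
  intro h
  rw [h, map_zero] at hconst
  exact hf.ne_zero hconst

theorem tang_add (f : MvPolynomial (Fin 3) ℝ) (c d : Fin 3 → ℝ) :
    tang f (c + d) = (1 : MvPolynomial (Fin 3) ℝ) • tang f c +
      (1 : MvPolynomial (Fin 3) ℝ) • tang f d := by
  ext1 i
  fin_cases i <;> simp [tang, cross_apply] <;> ring

theorem flat_tang_line {f : MvPolynomial (Fin 3) ℝ} (hf : Irreducible f)
    (hflat : ∀ c, f ∣ hess f c c) {x : Fin 3 → ℝ} (hx : eval x f = 0) (c : Fin 3 → ℝ) (τ : ℝ) :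
    eval (x + τ • fun i => eval x (tang f c i)) f = 0 := by
  obtain ⟨i₀, hi₀⟩ := exists_pderiv_not_dvd hf
  have hprime := hf.prime
  have hpol : ∀ d, f ∣ form2 (AlgHom.id ℝ _) f (tang f d) (tang f c) := by
    intro d
    have h := hflat (d + c)
    rw [hess, tang_add, form2_diag] at h
    have h1 : f ∣ C 2 * form2 (AlgHom.id ℝ _) f (tang f d) (tang f c) := by
      have := dvd_sub (dvd_sub h (hflat d)) (hflat c)
      convert this using 1
      simp only [hess, map_ofNat]
      ring
    have h2 := h1.mul_left (C (1 / 2))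
    rw [← mul_assoc, ← C_mul] at h2
    simpa using h2
  let W : Derivation ℝ (MvPolynomial (Fin 3) ℝ) (MvPolynomial (Fin 3) ℝ) :=
    ∑ i, tang f c i • pderiv i
  have hW : ∀ p, W p = form1 (AlgHom.id ℝ _) p (tang f c) := by
    intro p
    simp [W, form1, Fin.sum_univ_three, mul_comm]
  have hcross : ∀ i j, f ∣ pderiv i f * W (pderiv j f) - pderiv j f * W (pderiv i f) := by
    have h0 := hpol (Pi.single 0 1)
    have h1 := hpol (Pi.single 1 1)
    have h2 := hpol (Pi.single 2 1)
    simp only [form2, ← hW] at h0 h1 h2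
    simp [tang, cross_apply, Fin.sum_univ_three] at h0 h1 h2
    intro i j
    fin_cases i <;> fin_cases j <;> simp only [Fin.zero_eta, Fin.mk_one, Fin.reduceFinMk, sub_self,
      dvd_zero]
    · convert h2.neg_right using 1; ring
    · convert h1 using 1; ring
    · convert h2 using 1; ring
    · convert h0.neg_right using 1; ring
    · convert h1.neg_right using 1; ring
    · convert h0 using 1; ring
  have hline := line_lemma (AlgHom.id ℝ _) W (tang f c) 1 (pderiv i₀ f) (W (pderiv i₀ f))
    (Ideal.span {f}) ?_ ?_ ?_ ?_ (by simp) f (Ideal.mem_span_singleton_self _)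
  · have h := eval_line_eq_zero _ _ _ f hline (aeval x : _ →ₐ[ℝ] ℝ) (by
      intro s hs
      obtain ⟨w, rfl⟩ := Ideal.mem_span_singleton.1 hs
      rw [map_mul, aeval_eq_eval, hx, zero_mul]) τ
    simpa [coe_aeval_eq_eval, Pi.add_def] using h
  · intro i
    simp [hW, form1, Pi.single_apply]
  · intro k
    rw [Ideal.mem_span_singleton]
    have e : ∀ i j, f ∣ (pderiv i₀ f * W (pderiv i f) - pderiv i f * W (pderiv i₀ f)) * C (c j) :=
      fun i j => (hcross i₀ i).mul_right _
    have hWC : ∀ r : ℝ, W (C r) = 0 := fun r => W.map_algebraMap r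
    fin_cases k
    · convert dvd_sub (e 1 2) (e 2 1) using 1
      simp [tang, cross_apply, hWC]
      ring
    · convert dvd_sub (e 2 0) (e 0 2) using 1
      simp [tang, cross_apply, hWC]
      ring
    · convert dvd_sub (e 0 1) (e 1 0) using 1
      simp [tang, cross_apply, hWC]
      ring
  · intro s hs
    obtain ⟨w, rfl⟩ := Ideal.mem_span_singleton.1 hs
    rw [Derivation.leibniz, hW f, form1_tang, smul_zero, add_zero, smul_eq_mul,
      Ideal.mem_span_singleton]
    exact dvd_mul_right _ _
  · intro s hs
    rw [Ideal.mem_span_singleton] at hs ⊢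
    exact (hprime.dvd_or_dvd hs).resolve_left hi₀

end Eval

section LinesInSurface

open MvPolynomial

/-- The direction vector of a line. -/
def GLine.dir (l : GLine) : Fin 3 → ℝ := ![l.c, l.e, 1]

theorem GLine.form1_restr (l : GLine) (g : MvPolynomial (Fin 3) ℝ) :
    form1 l.restr g (fun i => Polynomial.C (l.dir i)) = Polynomial.derivative (l.restr g) := by
  have h := derivation_aeval (Polynomial.derivative'.restrictScalars ℝ)
    (fun i => l.restr (X i)) g
  have e : aeval (fun i => l.restr (X i)) = l.restr := by
    ext1 i
    simp
  rw [e] at h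
  change Polynomial.derivative (l.restr g) = _ at h
  rw [h, form1]
  refine Finset.sum_congr rfl fun i _ => ?_
  congr 1
  change _ = Polynomial.derivative (l.restr (X i))
  fin_cases i <;> simp [GLine.restr, GLine.dir]

theorem GLine.forms_restr {l : GLine} {f : MvPolynomial (Fin 3) ℝ} (hl : l.restr f = 0) :
    form1 l.restr f (fun i => Polynomial.C (l.dir i)) = 0 ∧
    form2 l.restr f (fun i => Polynomial.C (l.dir i)) (fun i => Polynomial.C (l.dir i)) = 0 ∧
    form3 l.restr f (fun i => Polynomial.C (l.dir i)) (fun i => Polynomial.C (l.dir i))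
      (fun i => Polynomial.C (l.dir i)) = 0 := by
  have h2 : ∀ g, form2 l.restr g (fun i => Polynomial.C (l.dir i))
      (fun i => Polynomial.C (l.dir i)) =
        Polynomial.derivative (Polynomial.derivative (l.restr g)) := by
    intro g
    rw [← l.form1_restr g, form1]
    simp only [form2, GLine.form1_restr]
    simp
  have h3 : ∀ g, form3 l.restr g (fun i => Polynomial.C (l.dir i))
      (fun i => Polynomial.C (l.dir i)) (fun i => Polynomial.C (l.dir i)) =
        Polynomial.derivative (Polynomial.derivative (Polynomial.derivative (l.restr g))) := by
    intro g
    rw [← l.form1_restr g]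
    simp [form3, h2, form1]
  rw [h3, h2, l.form1_restr, hl]
  simp

theorem GLine.forms_eq_zero {l : GLine} {f : MvPolynomial (Fin 3) ℝ} (hl : l.restr f = 0)
    {x : Fin 3 → ℝ} (hx : l.Has x) :
    form1 (aeval x) f l.dir = 0 ∧ form2 (aeval x) f l.dir l.dir = 0 ∧
      form3 (aeval x) f l.dir l.dir l.dir = 0 := by
  have e : (Polynomial.aeval (x 2) : Polynomial ℝ →ₐ[ℝ] ℝ).comp l.restr = aeval x := by
    apply MvPolynomial.algHom_ext
    intro i
    have h := l.eval_restr (X i) (x 2)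
    rw [← hx.eq_pt, eval_X] at h
    simpa [Polynomial.aeval_def, Polynomial.eval₂_eq_eval_map] using h
  obtain ⟨h1, h2, h3⟩ := GLine.forms_restr hl
  have h1' := congrArg (Polynomial.aeval (x 2) : Polynomial ℝ →ₐ[ℝ] ℝ) h1
  have h2' := congrArg (Polynomial.aeval (x 2) : Polynomial ℝ →ₐ[ℝ] ℝ) h2
  have h3' := congrArg (Polynomial.aeval (x 2) : Polynomial ℝ →ₐ[ℝ] ℝ) h3
  rw [map_form1, e] at h1'
  rw [map_form2, e] at h2'
  rw [map_form3, e] at h3'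
  simp only [Polynomial.aeval_C, Algebra.algebraMap_self, RingHom.id_apply, map_zero]
    at h1' h2' h3'
  exact ⟨h1', h2', h3'⟩

theorem GLine.dir_two (l : GLine) : l.dir 2 = 1 := rfl

theorem GLine.eq_of_dir {l m : GLine} {x : Fin 3 → ℝ} (hl : l.Has x) (hm : m.Has x)
    (h : l.dir = m.dir) : l = m := by
  have h0 := congrFun h 0
  have h1 := congrFun h 1
  simp only [GLine.dir, Matrix.cons_val_zero, Matrix.cons_val_one] at h0 h1
  obtain ⟨a1, a2⟩ := hl
  obtain ⟨b1, b2⟩ := hm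
  ext
  · rw [h0] at a1
    linarith
  · rw [h1] at a2
    linarith
  · exact h0
  · exact h1

theorem exists_asymAt {f : MvPolynomial (Fin 3) ℝ} {c d x : Fin 3 → ℝ}
    (hα : eval x (hess f c c) ≠ 0) (hη : eval x (tripleFactor f c d) ≠ 0) {w : Fin 3 → ℝ}
    (hw : w ≠ 0) (h1 : form1 (aeval x) f w = 0) (h2 : form2 (aeval x) f w w = 0) :
    ∃ r t : ℝ, r ^ 2 = eval x (disc f c d) ∧ w = t • asymAt f c d x r := by
  set v₁ : Fin 3 → ℝ := fun i => eval x (tang f c i) with hv₁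
  set v₂ : Fin 3 → ℝ := fun i => eval x (tang f d i) with hv₂
  set η := eval x (tripleFactor f c d) with hηd
  set α := eval x (hess f c c) with hαd
  set β := eval x (hess f c d) with hβd
  have hh : ∀ a b, eval x (hess f a b) = form2 (aeval x) f (fun i => eval x (tang f a i))
      (fun i => eval x (tang f b i)) := by
    intro a b
    have := map_form2 (aeval x : MvPolynomial (Fin 3) ℝ →ₐ[ℝ] ℝ) (AlgHom.id ℝ _) f
      (tang f a) (tang f b)
    simpa [coe_aeval_eq_eval, hess] using this
  obtain ⟨s, t, hst⟩ : ∃ s t : ℝ, w = s • v₁ + t • v₂ := by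
    have h := triple_expansion (fun i => eval x (pderiv i f)) c d w
    have e1 : dotProduct (fun i => eval x (pderiv i f)) (crossProduct c d) = η := by
      simp [hηd, tripleFactor, dotProduct, Fin.sum_univ_three, cross_apply]
    have e2 : dotProduct w (fun i => eval x (pderiv i f)) = 0 := by
      rw [← h1]
      simp only [form1, dotProduct]
      exact Finset.sum_congr rfl fun i _ => mul_comm _ _
    have e3 : ∀ a, crossProduct (fun i => eval x (pderiv i f)) a =
        fun i => eval x (tang f a i) := by
      intro a
      ext i
      fin_cases i <;> simp [tang, cross_apply]
    rw [e1, e2, zero_smul, zero_add, e3, e3] at h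
    refine ⟨η⁻¹ * dotProduct w d, η⁻¹ * (-dotProduct w c), ?_⟩
    rw [mul_smul, mul_smul, ← smul_add, ← h, smul_smul, inv_mul_cancel₀ hη, one_smul]
  have hquad : s ^ 2 * α + 2 * s * t * β + t ^ 2 * eval x (hess f d d) = 0 := by
    rw [hst, form2_diag] at h2
    rw [hαd, hβd, hh, hh, hh]
    exact h2
  have ht : t ≠ 0 := by
    rintro rfl
    have : s ^ 2 * α = 0 := by linarith
    have hs : s = 0 := by
      rcases mul_eq_zero.1 this with h | h
      · exact pow_eq_zero_iff (two_ne_zero) |>.1 h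
      · exact absurd h hα
    apply hw
    rw [hst, hs]
    simp
  refine ⟨α * (s / t) + β, t / α, ?_, ?_⟩
  · have : eval x (disc f c d) = β ^ 2 - α * eval x (hess f d d) := by
      simp [disc, hβd, hαd]
    rw [this]
    field_simp
    linear_combination α * hquad
  · rw [asymAt, hst]
    ext i
    simp only [Pi.add_apply, Pi.smul_apply, smul_eq_mul, ← hβd, ← hαd, ← hv₁, ← hv₂]
    field_simp
    ring

/-- The rational part of the third differential on the asymptotic directions. -/
noncomputable def asymRe (f : MvPolynomial (Fin 3) ℝ) (c d : Fin 3 → ℝ) :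
    MvPolynomial (Fin 3) ℝ :=
  (form3 (discIncl f c d) f (asym f c d) (asym f c d) (asym f c d)).re

/-- The irrational part of the third differential on the asymptotic directions. -/
noncomputable def asymIm (f : MvPolynomial (Fin 3) ℝ) (c d : Fin 3 → ℝ) :
    MvPolynomial (Fin 3) ℝ :=
  (form3 (discIncl f c d) f (asym f c d) (asym f c d) (asym f c d)).im

theorem form3_asymAt {f : MvPolynomial (Fin 3) ℝ} {c d x : Fin 3 → ℝ} {r : ℝ}
    (hr : r ^ 2 = eval x (disc f c d)) :
    form3 (aeval x) f (asymAt f c d x r) (asymAt f c d x r) (asymAt f c d x r) =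
      eval x (asymRe f c d) + r * eval x (asymIm f c d) := by
  have h := map_form3 (discEval f c d x r hr) (discIncl f c d) f (asym f c d) (asym f c d)
    (asym f c d)
  have e : (discEval f c d x r hr).comp (discIncl f c d) = aeval x := by
    apply MvPolynomial.algHom_ext
    intro i
    simp [discEval_incl]
  simp only [discEval_asym, e] at h
  exact h.symm

/-- At a point where two lines contained in the surface meet, the discriminant is nonzero and both
parts of the third differential vanish. -/
theorem double_point {f : MvPolynomial (Fin 3) ℝ} {c d x : Fin 3 → ℝ}
    (hα : eval x (hess f c c) ≠ 0) (hη : eval x (tripleFactor f c d) ≠ 0) {l m : GLine}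
    (hlm : l ≠ m) (hl : l.restr f = 0) (hm : m.restr f = 0) (hlx : l.Has x) (hmx : m.Has x) :
    eval x (disc f c d) ≠ 0 ∧ eval x (asymRe f c d) = 0 ∧ eval x (asymIm f c d) = 0 := by
  have hne : ∀ k : GLine, k.dir ≠ 0 := by
    intro k h
    have := congrFun h 2
    rw [k.dir_two] at this
    simp at this
  obtain ⟨l1, l2, l3⟩ := GLine.forms_eq_zero hl hlx
  obtain ⟨m1, m2, m3⟩ := GLine.forms_eq_zero hm hmx
  obtain ⟨r, t, hr, hrt⟩ := exists_asymAt hα hη (hne l) l1 l2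
  obtain ⟨r', t', hr', hrt'⟩ := exists_asymAt hα hη (hne m) m1 m2
  have hrr : r ≠ r' := by
    rintro rfl
    apply hlm
    apply GLine.eq_of_dir hlx hmx
    have a1 := congrFun hrt 2
    have a2 := congrFun hrt' 2
    simp only [GLine.dir_two, Pi.smul_apply, smul_eq_mul] at a1 a2
    have : asymAt f c d x r 2 ≠ 0 := by
      intro h
      rw [h] at a1
      simp at a1
    have : t = t' := by
      apply mul_right_cancel₀ this
      rw [← a1, ← a2]
    rw [hrt, hrt', this]
  have hneg : r' = -r := by
    have : (r - r') * (r + r') = 0 := by linear_combination hr - hr'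
    rcases mul_eq_zero.1 this with h | h
    · exact absurd (sub_eq_zero.1 h) hrr
    · linarith
  have hr0 : r ≠ 0 := by
    rintro rfl
    apply hrr
    rw [hneg, neg_zero]
  have hz : ∀ (t : ℝ) (u : Fin 3 → ℝ), t ≠ 0 →
      form3 (aeval x) f (t • u) (t • u) (t • u) = 0 → form3 (aeval x) f u u u = 0 := by
    intro t u ht h
    have h' := form3_diag (aeval x : MvPolynomial (Fin 3) ℝ →ₐ[ℝ] ℝ) f t 0 u u
    simp only [zero_smul, add_zero] at h'
    rw [h] at h'
    have : t ^ 3 * form3 (aeval x) f u u u = 0 := by linear_combination -h'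
    exact (mul_eq_zero.1 this).resolve_left (pow_ne_zero _ ht)
  have ht0 : t ≠ 0 := by
    rintro rfl
    rw [zero_smul] at hrt
    exact hne l hrt
  have ht0' : t' ≠ 0 := by
    rintro rfl
    rw [zero_smul] at hrt'
    exact hne m hrt'
  rw [hrt] at l3
  rw [hrt'] at m3
  have b1 := hz _ _ ht0 l3
  have b2 := hz _ _ ht0' m3
  rw [form3_asymAt hr] at b1
  rw [form3_asymAt hr', hneg] at b2
  refine ⟨?_, by linarith, ?_⟩
  · rw [← hr]
    exact pow_ne_zero _ hr0
  · have : r * eval x (asymIm f c d) = 0 := by linarith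
    exact (mul_eq_zero.1 this).resolve_left hr0

end LinesInSurface

section Degrees

open MvPolynomial

theorem totalDegree_add_le' {p q : MvPolynomial (Fin 3) ℝ} {m : ℕ} (hp : p.totalDegree ≤ m)
    (hq : q.totalDegree ≤ m) : (p + q).totalDegree ≤ m :=
  (totalDegree_add _ _).trans (max_le hp hq)

theorem totalDegree_sub_le' {p q : MvPolynomial (Fin 3) ℝ} {m : ℕ} (hp : p.totalDegree ≤ m)
    (hq : q.totalDegree ≤ m) : (p - q).totalDegree ≤ m :=
  (totalDegree_sub _ _).trans (max_le hp hq)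

theorem totalDegree_mul_le' {p q : MvPolynomial (Fin 3) ℝ} {a b m : ℕ} (hp : p.totalDegree ≤ a)
    (hq : q.totalDegree ≤ b) (h : a + b ≤ m) : (p * q).totalDegree ≤ m :=
  (totalDegree_mul _ _).trans ((add_le_add hp hq).trans h)

variable {f : MvPolynomial (Fin 3) ℝ} {d : ℕ}

theorem totalDegree_tang_le (hf : f.totalDegree ≤ d) (c : Fin 3 → ℝ) (i : Fin 3) :
    (tang f c i).totalDegree ≤ d := by
  have hp : ∀ i j, (pderiv i f * C (c j)).totalDegree ≤ d := by
    intro i j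
    refine totalDegree_mul_le' (totalDegree_pderiv_le i f) (totalDegree_C _).le ?_
    omega
  fin_cases i <;> simp only [tang, cross_apply] <;> exact totalDegree_sub_le' (hp _ _) (hp _ _)

theorem totalDegree_form1_le (hf : f.totalDegree ≤ d) {u : Fin 3 → MvPolynomial (Fin 3) ℝ} {a : ℕ}
    (hu : ∀ i, (u i).totalDegree ≤ a) :
    (form1 (AlgHom.id ℝ _) f u).totalDegree ≤ d + a := by
  refine totalDegree_finsetSum_le fun i _ => totalDegree_mul_le' (a := d) ?_ (hu i) le_rfl
  exact (totalDegree_pderiv_le i f).trans (by omega)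

theorem totalDegree_form2_le (hf : f.totalDegree ≤ d) {u v : Fin 3 → MvPolynomial (Fin 3) ℝ}
    {a b : ℕ} (hu : ∀ i, (u i).totalDegree ≤ a) (hv : ∀ i, (v i).totalDegree ≤ b) :
    (form2 (AlgHom.id ℝ _) f u v).totalDegree ≤ d + a + b := by
  refine totalDegree_finsetSum_le fun i _ => totalDegree_mul_le'
    (totalDegree_form1_le (d := d) ?_ hv) (hu i) (by omega)
  exact (totalDegree_pderiv_le i f).trans (by omega)

theorem totalDegree_form3_le (hf : f.totalDegree ≤ d) {u v w : Fin 3 → MvPolynomial (Fin 3) ℝ}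
    {a b c : ℕ} (hu : ∀ i, (u i).totalDegree ≤ a) (hv : ∀ i, (v i).totalDegree ≤ b)
    (hw : ∀ i, (w i).totalDegree ≤ c) :
    (form3 (AlgHom.id ℝ _) f u v w).totalDegree ≤ d + a + b + c := by
  refine totalDegree_finsetSum_le fun i _ => totalDegree_mul_le'
    (totalDegree_form2_le (d := d) ?_ hv hw) (hu i) (by omega)
  exact (totalDegree_pderiv_le i f).trans (by omega)

theorem totalDegree_hess_le (hf : f.totalDegree ≤ d) (a b : Fin 3 → ℝ) :
    (hess f a b).totalDegree ≤ 3 * d :=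
  (totalDegree_form2_le hf (totalDegree_tang_le hf a) (totalDegree_tang_le hf b)).trans (by omega)

theorem totalDegree_disc_le (hf : f.totalDegree ≤ d) (a b : Fin 3 → ℝ) :
    (disc f a b).totalDegree ≤ 6 * d := by
  rw [disc, pow_two]
  exact totalDegree_sub_le'
    (totalDegree_mul_le' (totalDegree_hess_le hf _ _) (totalDegree_hess_le hf _ _) (by omega))
    (totalDegree_mul_le' (totalDegree_hess_le hf _ _) (totalDegree_hess_le hf _ _) (by omega))

theorem totalDegree_tripleFactor_le (f : MvPolynomial (Fin 3) ℝ) (a b : Fin 3 → ℝ) :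
    (tripleFactor f a b).totalDegree ≤ f.totalDegree - 1 := by
  refine totalDegree_finsetSum_le fun i _ => totalDegree_mul_le' (b := 0)
    (totalDegree_pderiv_le i f) ?_ (by omega)
  fin_cases i <;> simp only [cross_apply, ← C_mul, ← C_sub] <;> exact (totalDegree_C _).le

theorem asymRe_im_eq (f : MvPolynomial (Fin 3) ℝ) (a b : Fin 3 → ℝ) :
    asymRe f a b = (-(C 3 * (disc f a b * hess f a b)) - hess f a b * (hess f a b * hess f a b)) *
        form3 (AlgHom.id ℝ _) f (tang f a) (tang f a) (tang f a) +
      C 3 * (hess f a a * ((disc f a b + hess f a b * hess f a b) *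
        form3 (AlgHom.id ℝ _) f (tang f a) (tang f a) (tang f b))) -
      C 3 * (hess f a a * (hess f a a * (hess f a b *
        form3 (AlgHom.id ℝ _) f (tang f a) (tang f b) (tang f b)))) +
      hess f a a * (hess f a a * (hess f a a *
        form3 (AlgHom.id ℝ _) f (tang f b) (tang f b) (tang f b))) ∧
    asymIm f a b = (disc f a b + C 3 * (hess f a b * hess f a b)) *
        form3 (AlgHom.id ℝ _) f (tang f a) (tang f a) (tang f a) -
      C 6 * (hess f a a * (hess f a b *
        form3 (AlgHom.id ℝ _) f (tang f a) (tang f a) (tang f b))) +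
      C 3 * (hess f a a * (hess f a a *
        form3 (AlgHom.id ℝ _) f (tang f a) (tang f b) (tang f b))) := by
  set ι := discIncl f a b with hι
  have hA : ∀ u v w : Fin 3 → MvPolynomial (Fin 3) ℝ,
      form3 ι f (fun i => ι (u i)) (fun i => ι (v i)) (fun i => ι (w i)) =
        ι (form3 (AlgHom.id ℝ _) f u v w) := by
    intro u v w
    rw [map_form3]
    rfl
  have hω := omega_sq f a b
  rw [← hι] at hω
  have key : ∀ E₁ E₂ : MvPolynomial (Fin 3) ℝ,
      form3 ι f (asym f a b) (asym f a b) (asym f a b) = ι E₁ + ι E₂ * QuadraticAlgebra.omega →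
      asymRe f a b = E₁ ∧ asymIm f a b = E₂ := by
    intro E₁ E₂ h
    rw [asymRe, asymIm, ← hι, h]
    constructor <;> simp [hι, discIncl]
  apply key
  rw [asym, ← hι, form3_diag, hA, hA, hA, hA]
  simp only [map_add, map_mul, map_sub, map_neg]
  have h3 : ι (C 3) = 3 := by
    rw [map_ofNat C 3, map_ofNat]
  have h6 : ι (C 6) = 6 := by
    rw [map_ofNat C 6, map_ofNat]
  rw [h3, h6]
  set ω : DiscRing f a b := QuadraticAlgebra.omega
  set β := ι (hess f a b)
  set α := ι (hess f a a)
  set A₀ := ι (form3 (AlgHom.id ℝ _) f (tang f a) (tang f a) (tang f a))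
  set A₁ := ι (form3 (AlgHom.id ℝ _) f (tang f a) (tang f a) (tang f b))
  linear_combination ((ω - 3 * β) * A₀ + 3 * α * A₁) * hω

theorem totalDegree_asym_le (hf : f.totalDegree ≤ d) (a b : Fin 3 → ℝ) :
    (asymRe f a b).totalDegree ≤ 13 * d ∧ (asymIm f a b).totalDegree ≤ 13 * d := by
  have hC : ∀ (r : ℝ) {p : MvPolynomial (Fin 3) ℝ} {m : ℕ}, p.totalDegree ≤ m →
      (C r * p).totalDegree ≤ m := fun r p m hp =>
    totalDegree_mul_le' (a := 0) (totalDegree_C r).le hp (by omega)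
  have hH := totalDegree_hess_le hf
  have hD := totalDegree_disc_le hf a b
  have hA : ∀ u v w : Fin 3 → ℝ,
      (form3 (AlgHom.id ℝ _) f (tang f u) (tang f v) (tang f w)).totalDegree ≤ 4 * d := by
    intro u v w
    refine (totalDegree_form3_le hf (totalDegree_tang_le hf u) (totalDegree_tang_le hf v)
      (totalDegree_tang_le hf w)).trans (by omega)
  have hHH : ∀ u v w x : Fin 3 → ℝ, (hess f u v * hess f w x).totalDegree ≤ 6 * d :=
    fun u v w x => totalDegree_mul_le' (hH _ _) (hH _ _) (by omega)
  obtain ⟨h1, h2⟩ := asymRe_im_eq f a b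
  rw [h1, h2]
  refine ⟨totalDegree_add_le' (totalDegree_sub_le' (totalDegree_add_le' ?_ ?_) ?_) ?_,
    totalDegree_add_le' (totalDegree_sub_le' ?_ ?_) ?_⟩
  · refine totalDegree_mul_le' (a := 9 * d) (totalDegree_sub_le' ?_ ?_) (hA _ _ _) (by omega)
    · rw [totalDegree_neg]
      exact hC _ (totalDegree_mul_le' hD (hH _ _) (by omega))
    · exact totalDegree_mul_le' (hH _ _) (hHH _ _ _ _) (by omega)
  · exact hC _ (totalDegree_mul_le' (hH _ _) (totalDegree_mul_le'
      (totalDegree_add_le' hD (hHH _ _ _ _)) (hA _ _ _) le_rfl) (by omega))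
  · exact hC _ (totalDegree_mul_le' (hH _ _) (totalDegree_mul_le' (hH _ _) (totalDegree_mul_le'
      (hH _ _) (hA _ _ _) le_rfl) le_rfl) (by omega))
  · exact totalDegree_mul_le' (hH _ _) (totalDegree_mul_le' (hH _ _) (totalDegree_mul_le'
      (hH _ _) (hA _ _ _) le_rfl) le_rfl) (by omega)
  · exact totalDegree_mul_le' (totalDegree_add_le' hD (hC _ (hHH _ _ _ _))) (hA _ _ _) (by omega)
  · exact hC _ (totalDegree_mul_le' (hH _ _) (totalDegree_mul_le' (hH _ _) (hA _ _ _) le_rfl)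
      (by omega))
  · exact hC _ (totalDegree_mul_le' (hH _ _) (totalDegree_mul_le' (hH _ _) (hA _ _ _) le_rfl)
      (by omega))

end Degrees

open scoped Topology

section Local

open MvPolynomial

/-- The line through `y` with direction `u`. -/
noncomputable def GLine.through (y u : Fin 3 → ℝ) : GLine :=
  ⟨y 0 - u 0 / u 2 * y 2, y 1 - u 1 / u 2 * y 2, u 0 / u 2, u 1 / u 2⟩

theorem GLine.through_has {y u : Fin 3 → ℝ} (hu : u 2 ≠ 0) (τ : ℝ) :
    (GLine.through y u).Has (y + τ • u) := by
  constructor <;> simp [GLine.through] <;> field_simp <;> ring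

theorem GLine.through_has_base {y u : Fin 3 → ℝ} (hu : u 2 ≠ 0) :
    (GLine.through y u).Has y := by
  simpa using GLine.through_has (y := y) hu 0

theorem GLine.through_restr {y u : Fin 3 → ℝ} (hu : u 2 ≠ 0) {f : MvPolynomial (Fin 3) ℝ}
    (h : ∀ τ : ℝ, eval (y + τ • u) f = 0) : (GLine.through y u).restr f = 0 := by
  rw [GLine.restr_eq_zero_iff]
  intro z
  rw [← h ((z - y 2) / u 2)]
  congr 1
  have h1 := (GLine.through_has (y := y) hu ((z - y 2) / u 2)).eq_pt
  have h2 : (y + ((z - y 2) / u 2) • u) 2 = z := by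
    simp
    field_simp
    ring
  rw [h2] at h1
  rw [← h1]

theorem GLine.dir_through {y u : Fin 3 → ℝ} (hu : u 2 ≠ 0) :
    u = u 2 • (GLine.through y u).dir := by
  ext i
  fin_cases i <;> simp [GLine.through, GLine.dir] <;> field_simp

theorem GLine.has_add {l : GLine} {x : Fin 3 → ℝ} (hx : l.Has x) (τ : ℝ) :
    l.Has (x + τ • l.dir) := by
  obtain ⟨h1, h2⟩ := hx
  constructor
  · simp [GLine.dir, h1]
    ring
  · simp [GLine.dir, h2]
    ring

theorem GLine.eq_add_of_has {l : GLine} {x y : Fin 3 → ℝ} (hx : l.Has x) (hy : l.Has y) :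
    y = x + (y 2 - x 2) • l.dir := by
  obtain ⟨h1, h2⟩ := hx
  obtain ⟨h3, h4⟩ := hy
  ext i
  fin_cases i
  · simp [GLine.dir, h1, h3]
    ring
  · simp [GLine.dir, h2, h4]
    ring
  · simp [GLine.dir]

theorem exists_form1_eq_zero {f : MvPolynomial (Fin 3) ℝ} {p v : Fin 3 → ℝ}
    (h : eval p f = eval (p + v) f) :
    ∃ ξ ∈ Set.Ioo (0 : ℝ) 1, form1 (aeval (p + ξ • v)) f v = 0 := by
  set g : Fin 3 → Polynomial ℝ := fun i => Polynomial.C (p i) + Polynomial.X * Polynomial.C (v i)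
    with hg
  have he : ∀ (q : MvPolynomial (Fin 3) ℝ) (t : ℝ),
      Polynomial.eval t (aeval g q) = eval (p + t • v) q := by
    intro q t
    have : (Polynomial.evalRingHom t).comp (aeval g :
        MvPolynomial (Fin 3) ℝ →ₐ[ℝ] Polynomial ℝ).toRingHom = eval (p + t • v) := by
      apply MvPolynomial.ringHom_ext
      · intro r
        simp
      · intro i
        simp [hg]
        ring
    exact congrArg (fun χ => χ q) this
  obtain ⟨ξ, hξ, h0⟩ := exists_deriv_eq_zero (f := fun t => Polynomial.eval t (aeval g f))
    zero_lt_one (Polynomial.continuous _).continuousOn (by simpa [he] using h)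
  refine ⟨ξ, hξ, ?_⟩
  rw [Polynomial.deriv] at h0
  have hd := derivation_aeval (Polynomial.derivative'.restrictScalars ℝ) g f
  change Polynomial.derivative (aeval g f) = _ at hd
  rw [hd, Polynomial.eval_finsetSum] at h0
  rw [form1, ← h0]
  refine Finset.sum_congr rfl fun i _ => ?_
  rw [Polynomial.eval_mul, he]
  congr 1
  change _ = Polynomial.eval ξ (Polynomial.derivative (g i))
  simp [hg]

theorem continuous_form1 (f : MvPolynomial (Fin 3) ℝ) (v : Fin 3 → ℝ) :
    Continuous fun x : Fin 3 → ℝ => form1 (aeval x) f v := by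
  unfold form1
  refine continuous_finsetSum _ fun i _ => ?_
  exact (MvPolynomial.continuous_eval (pderiv i f)).mul continuous_const

theorem cramer_expansion (A B C X : Fin 3 → ℝ) :
    (dotProduct A (crossProduct B C)) • X = (dotProduct X (crossProduct B C)) • A +
      (dotProduct X (crossProduct C A)) • B + (dotProduct X (crossProduct A B)) • C := by
  ext i
  fin_cases i <;> simp [cross_apply, dotProduct, Fin.sum_univ_three] <;> ring

theorem continuous_dot_cross : Continuous fun p : (Fin 3 → ℝ) × (Fin 3 → ℝ) × (Fin 3 → ℝ) =>
    dotProduct p.1 (crossProduct p.2.1 p.2.2) := by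
  simp only [dotProduct, Fin.sum_univ_three, cross_apply]
  simp
  fun_prop

theorem ContinuousAt.dot_cross {a b c : ℝ → Fin 3 → ℝ} {t : ℝ} (ha : ContinuousAt a t)
    (hb : ContinuousAt b t) (hc : ContinuousAt c t) :
    ContinuousAt (fun θ => dotProduct (a θ) (crossProduct (b θ) (c θ))) t :=
  ContinuousAt.comp (g := fun p : (Fin 3 → ℝ) × (Fin 3 → ℝ) × (Fin 3 → ℝ) =>
    dotProduct p.1 (crossProduct p.2.1 p.2.2)) (f := fun θ => (a θ, b θ, c θ))
    continuous_dot_cross.continuousAt (ha.prodMk (hb.prodMk hc))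

/-- A continuous family of lines in the surface, starting at a line crossing `m` at a smooth
point, keeps crossing `m`. -/
theorem ruling_meets {f : MvPolynomial (Fin 3) ℝ} {y u : ℝ → Fin 3 → ℝ} (hy : ContinuousAt y 0)
    (hu : ContinuousAt u 0) {l m : GLine} (hul : u 0 = l.dir) (hyl : l.Has (y 0))
    (hl : l.restr f = 0) (hm : m.restr f = 0) (hlm : l ≠ m) {x : Fin 3 → ℝ} (hlx : l.Has x)
    (hmx : m.Has x) (hgrad : ∃ i, eval x (pderiv i f) ≠ 0)
    (hsurf : ∀ᶠ θ in 𝓝 (0 : ℝ), ∀ τ : ℝ, eval (y θ + τ • u θ) f = 0) :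
    ∃ τ : ℝ → ℝ, ContinuousAt τ 0 ∧ y 0 + τ 0 • u 0 = x ∧
      ∀ᶠ θ in 𝓝 (0 : ℝ), m.Has (y θ + τ θ • u θ) := by
  set n : Fin 3 → ℝ := fun i => eval x (pderiv i f) with hn
  have hln : dotProduct n l.dir = 0 := (GLine.forms_eq_zero hl hlx).1
  have hmn : dotProduct n m.dir = 0 := (GLine.forms_eq_zero hm hmx).1
  have hnn : 0 < dotProduct n n := by
    obtain ⟨i, hi⟩ := hgrad
    refine Finset.sum_pos' (fun j _ => mul_self_nonneg _) ⟨i, Finset.mem_univ _, ?_⟩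
    exact mul_self_pos.2 hi
  set w := m.dir with hw
  set δ : ℝ → ℝ := fun θ => dotProduct (u θ) (crossProduct w n) with hδ
  have hδ0 : δ 0 ≠ 0 := by
    intro h
    simp only [hδ, hul] at h
    have hlag : dotProduct n n • crossProduct l.dir w =
        dotProduct l.dir (crossProduct w n) • n := by
      ext i
      simp only [dotProduct, Fin.sum_univ_three] at hln hmn
      fin_cases i <;> simp [dotProduct, Fin.sum_univ_three, cross_apply]
      · linear_combination (n 1 * w 2 - n 2 * w 1) * hln - (n 1 * l.dir 2 - n 2 * l.dir 1) * hmn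
      · linear_combination (n 2 * w 0 - n 0 * w 2) * hln - (n 2 * l.dir 0 - n 0 * l.dir 2) * hmn
      · linear_combination (n 0 * w 1 - n 1 * w 0) * hln - (n 0 * l.dir 1 - n 1 * l.dir 0) * hmn
    rw [h, zero_smul] at hlag
    have hc := (smul_eq_zero.1 hlag).resolve_left hnn.ne'
    apply hlm
    apply GLine.eq_of_dir hlx hmx
    have h0 := congrFun hc 0
    have h1 := congrFun hc 1
    simp [cross_apply, GLine.dir_two, hw] at h0 h1
    ext i
    fin_cases i
    · change l.dir 0 = m.dir 0
      linarith
    · change l.dir 1 = m.dir 1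
      linarith
    · rfl
  set Xv : ℝ → Fin 3 → ℝ := fun θ => x - y θ with hX
  have hXc : ContinuousAt Xv 0 := continuousAt_const.sub hy
  have hδc : ContinuousAt δ 0 := hu.dot_cross continuousAt_const continuousAt_const
  set τ : ℝ → ℝ := fun θ => dotProduct (Xv θ) (crossProduct w n) / δ θ with hτ
  set σ : ℝ → ℝ := fun θ => dotProduct (Xv θ) (crossProduct n (u θ)) / δ θ with hσ
  set κ : ℝ → ℝ := fun θ => dotProduct (Xv θ) (crossProduct (u θ) w) / δ θ with hκ
  have hτc : ContinuousAt τ 0 :=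
    (hXc.dot_cross continuousAt_const continuousAt_const).div hδc hδ0
  have hσc : ContinuousAt σ 0 := (hXc.dot_cross continuousAt_const hu).div hδc hδ0
  have hX0 : Xv 0 = (x 2 - y 0 2) • u 0 := by
    have := GLine.eq_add_of_has hyl hlx
    rw [hul, hX]
    simp only
    nth_rewrite 1 [this]
    simp
  have hτ0 : τ 0 = x 2 - y 0 2 := by
    simp only [hτ, hX0, smul_dotProduct, smul_eq_mul]
    field_simp
    rfl
  have hσ0 : σ 0 = 0 := by
    simp only [hσ, hX0, smul_dotProduct, smul_eq_mul]
    have : dotProduct (u 0) (crossProduct n (u 0)) = 0 := dot_cross_self _ _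
    rw [this]
    simp
  have hsolve : ∀ θ, δ θ ≠ 0 → x - σ θ • w = (y θ + τ θ • u θ) + κ θ • n := by
    intro θ hθ
    have h := cramer_expansion (u θ) w n (Xv θ)
    have h' : Xv θ = τ θ • u θ + σ θ • w + κ θ • n := by
      have := congrArg (fun z => (δ θ)⁻¹ • z) h
      rw [smul_smul, inv_mul_cancel₀ hθ, one_smul] at this
      rw [this]
      simp only [smul_add, smul_smul, hτ, hσ, hκ, div_eq_inv_mul]
    rw [sub_eq_iff_eq_add.1 h']
    module
  refine ⟨τ, hτc, ?_, ?_⟩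
  · rw [hτ0, ← hX0]
    simp [hX]
  have hpos : ∀ᶠ p in 𝓝 x, form1 (aeval p) f n ≠ 0 := by
    apply (continuous_form1 f n).continuousAt.eventually_ne
    exact hnn.ne'
  obtain ⟨ε, hε, hball⟩ := Metric.eventually_nhds_iff_ball.1 hpos
  have hp1 : ContinuousAt (fun θ => y θ + τ θ • u θ) 0 := hy.add (hτc.smul hu)
  have hp2 : ContinuousAt (fun θ => x - σ θ • w) 0 :=
    continuousAt_const.sub (hσc.smul continuousAt_const)
  have e1 : y 0 + τ 0 • u 0 = x := by
    rw [hτ0, ← hX0]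
    simp [hX]
  have e2 : x - σ 0 • w = x := by
    rw [hσ0]
    simp
  have hb1 : ∀ᶠ θ in 𝓝 (0 : ℝ), y θ + τ θ • u θ ∈ Metric.ball x ε :=
    hp1.eventually_mem (by rw [e1]; exact Metric.ball_mem_nhds _ hε)
  have hb2 : ∀ᶠ θ in 𝓝 (0 : ℝ), x - σ θ • w ∈ Metric.ball x ε :=
    hp2.eventually_mem (by rw [e2]; exact Metric.ball_mem_nhds _ hε)
  filter_upwards [hb1, hb2, hδc.eventually_ne hδ0, hsurf] with θ t1 t2 t3 t4
  have hmem : m.Has (x - σ θ • w) := by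
    have := GLine.has_add hmx (-σ θ)
    rwa [neg_smul, ← sub_eq_add_neg] at this
  have heq := hsolve θ t3
  have hκ0 : κ θ = 0 := by
    by_contra hne
    have hv : eval (y θ + τ θ • u θ) f = eval ((y θ + τ θ • u θ) + κ θ • n) f := by
      rw [t4, ← heq]
      exact (GLine.eval_eq_zero_of_has hm hmem).symm
    obtain ⟨ξ, hξ, h0⟩ := exists_form1_eq_zero hv
    have hin : (y θ + τ θ • u θ) + ξ • κ θ • n ∈ Metric.ball x ε := by
      rw [heq] at t2
      have := (convex_ball x ε) t1 t2 (a := 1 - ξ) (b := ξ) (by linarith [hξ.2]) hξ.1.le (by ring)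
      convert this using 1
      module
    apply hball _ hin
    have h1 := form1_linear (aeval ((y θ + τ θ • u θ) + ξ • κ θ • n) :
      MvPolynomial (Fin 3) ℝ →ₐ[ℝ] ℝ) f (κ θ) 0 n n
    simp only [zero_smul, add_zero, zero_mul] at h1
    rw [h0] at h1
    exact (mul_eq_zero.1 h1.symm).resolve_left hne
  rw [hκ0, zero_smul, add_zero] at heq
  rw [← heq]
  exact hmem

end Local

section Quadric

open MvPolynomial

theorem continuous_asymAt (f : MvPolynomial (Fin 3) ℝ) (c d : Fin 3 → ℝ) {y : ℝ → Fin 3 → ℝ}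
    {r : ℝ → ℝ} (hy : Continuous y) (hr : Continuous r) :
    Continuous fun θ => asymAt f c d (y θ) (r θ) := by
  have h : ∀ p : MvPolynomial (Fin 3) ℝ, Continuous fun θ => eval (y θ) p :=
    fun p => (MvPolynomial.continuous_eval p).comp hy
  refine ((hr.sub (h _)).smul (continuous_pi fun i => h _)).add
    ((h _).smul (continuous_pi fun i => h _))

/-- A surface doubly ruled near a line with three transversal rulings has degree at most two. -/
theorem totalDegree_le_two_of_crossings {f : MvPolynomial (Fin 3) ℝ} (hf : Irreducible f)
    {c d : Fin 3 → ℝ} (hα : ¬ f ∣ hess f c c) (hη : ¬ f ∣ tripleFactor f c d)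
    (hΔ : ¬ f ∣ disc f c d) (hRe : f ∣ asymRe f c d) (hIm : f ∣ asymIm f c d) {l : GLine}
    (hl : l.restr f = 0) {x : Fin 3 → Fin 3 → ℝ} (hx : Function.Injective x)
    (hlx : ∀ k, l.Has (x k)) {m : Fin 3 → GLine} (hm : ∀ k, (m k).restr f = 0)
    (hmx : ∀ k, (m k).Has (x k)) (hlm : ∀ k, l ≠ m k)
    (hαx : eval (x 0) (hess f c c) ≠ 0) (hηx : ∀ k, eval (x k) (tripleFactor f c d) ≠ 0) :
    f.totalDegree ≤ 2 := by
  have hgrad : ∀ k, ∃ i, eval (x k) (pderiv i f) ≠ 0 := by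
    intro k
    by_contra! hcon
    apply hηx k
    simp [tripleFactor, dotProduct, hcon]
  have hE : form3 (discIncl f c d) f (asym f c d) (asym f c d) (asym f c d) ∈
      Ideal.span {discIncl f c d f} := quad_mem_span_iff.2 ⟨hRe, hIm⟩
  obtain ⟨f1, f2, -⟩ := GLine.forms_eq_zero hl (hlx 0)
  have hdir : l.dir ≠ 0 := by
    intro h
    have := congrFun h 2
    rw [l.dir_two] at this
    simp at this
  obtain ⟨r₀, t, hr₀, ht⟩ := exists_asymAt hαx (hηx 0) hdir f1 f2
  have hΔx := (double_point hαx (hηx 0) (hlm 0) hl (hm 0) (hlx 0) (hmx 0)).1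
  have hr₀0 : r₀ ≠ 0 := by
    rintro rfl
    apply hΔx
    rw [← hr₀]
    norm_num
  set y : ℝ → Fin 3 → ℝ := fun θ => x 0 + θ • (m 0).dir with hyd
  have hy : Continuous y := continuous_const.add (continuous_id.smul continuous_const)
  have hy0 : y 0 = x 0 := by simp [hyd]
  have hyf : ∀ θ, eval (y θ) f = 0 := fun θ =>
    GLine.eval_eq_zero_of_has (hm 0) (GLine.has_add (hmx 0) θ)
  have hΔc : Continuous fun θ => eval (y θ) (disc f c d) :=
    (MvPolynomial.continuous_eval _).comp hy
  set r : ℝ → ℝ := fun θ => r₀ / |r₀| * √(eval (y θ) (disc f c d)) with hrd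
  have hrc : Continuous r := continuous_const.mul (Real.continuous_sqrt.comp hΔc)
  have hr0 : r 0 = r₀ := by
    simp only [hrd, hy0, ← hr₀, Real.sqrt_sq_eq_abs]
    field_simp
  have hΔpos : ∀ᶠ θ in 𝓝 (0 : ℝ), 0 < eval (y θ) (disc f c d) := by
    apply hΔc.continuousAt.eventually (IsOpen.mem_nhds isOpen_Ioi _)
    change 0 < eval (y 0) (disc f c d)
    rw [hy0, ← hr₀]
    positivity
  set u : ℝ → Fin 3 → ℝ := fun θ => t • asymAt f c d (y θ) (r θ) with hud
  have huc : Continuous u := (continuous_asymAt f c d hy hrc).const_smul t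
  have hu0 : u 0 = l.dir := by
    simp only [hud, hr0, hy0]
    exact ht.symm
  have hsurf : ∀ᶠ θ in 𝓝 (0 : ℝ), ∀ τ : ℝ, eval (y θ + τ • u θ) f = 0 := by
    filter_upwards [hΔpos] with θ hθ τ
    rw [hud]
    simp only [smul_smul]
    apply asym_line hf hα hη hΔ hE (hyf θ)
    simp only [hrd, mul_pow, div_pow, sq_abs, Real.sq_sqrt hθ.le]
    field_simp
  have hmeet : ∀ k, ∃ τ : ℝ → ℝ, ContinuousAt τ 0 ∧ y 0 + τ 0 • u 0 = x k ∧
      ∀ᶠ θ in 𝓝 (0 : ℝ), (m k).Has (y θ + τ θ • u θ) := fun k =>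
    ruling_meets hy.continuousAt huc.continuousAt hu0 (by rw [hy0]; exact hlx 0) hl (hm k) (hlm k)
      (hlx k) (hmx k) (hgrad k) hsurf
  choose τ hτc hτ0 hτm using hmeet
  have hdist : ∀ j k, j ≠ k → ∀ᶠ θ in 𝓝 (0 : ℝ), y θ + τ j θ • u θ ≠ y θ + τ k θ • u θ := by
    intro j k hjk
    have h : ∀ i, ContinuousAt (fun θ => y θ + τ i θ • u θ) 0 := fun i =>
      hy.continuousAt.add ((hτc i).smul huc.continuousAt)
    have := ((h j).sub (h k)).eventually_ne (by
      simp only [Pi.sub_apply]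
      rw [hτ0, hτ0, sub_ne_zero]
      exact fun h => hjk (hx h)) (y := 0)
    filter_upwards [this] with θ hθ
    exact sub_ne_zero.1 hθ
  have hu2 : ∀ᶠ θ in 𝓝 (0 : ℝ), u θ 2 ≠ 0 := by
    apply ((continuous_apply 2).comp huc).continuousAt.eventually_ne
    simp [hu0, GLine.dir_two]
  have hpar : ∀ᶠ θ in 𝓝 (0 : ℝ), u θ - u θ 2 • (m 0).dir ≠ 0 := by
    apply (huc.sub (((continuous_apply 2).comp huc).smul continuous_const)).continuousAt.eventually_ne
    change u 0 - u 0 2 • (m 0).dir ≠ 0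
    rw [hu0, GLine.dir_two, one_smul]
    intro h
    exact hlm 0 (GLine.eq_of_dir (hlx 0) (hmx 0) (sub_eq_zero.1 h))
  obtain ⟨q, hq0, hqd, hq⟩ := exists_vanishing_on_lines (Finset.univ.image m) 2 (by
    have : (Finset.univ.image m).card ≤ 3 := Finset.card_image_le
    omega)
  have hqm : ∀ k, (m k).restr q = 0 := fun k => hq _ (Finset.mem_image_of_mem _ (Finset.mem_univ k))
  set S : Set ℝ := {θ | (GLine.through (y θ) (u θ)).restr f = 0 ∧
    (GLine.through (y θ) (u θ)).restr q = 0 ∧ u θ 2 ≠ 0 ∧ u θ - u θ 2 • (m 0).dir ≠ 0} with hS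
  have hSnhds : S ∈ 𝓝 (0 : ℝ) := by
    filter_upwards [hsurf, hu2, hpar, Filter.eventually_all.2 hτm, hdist 0 1 (by decide),
      hdist 0 2 (by decide), hdist 1 2 (by decide)] with θ a1 a2 a3 a4 a5 a6 a7
    refine ⟨GLine.through_restr a2 a1, ?_, a2, a3⟩
    refine GLine.restr_eq_zero_of_card
      (X := {y θ + τ 0 θ • u θ, y θ + τ 1 θ • u θ, y θ + τ 2 θ • u θ}) ?_ ?_
    · intro p hp
      simp only [Finset.mem_insert, Finset.mem_singleton] at hp
      rcases hp with rfl | rfl | rfl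
      · exact ⟨GLine.through_has a2 _, GLine.eval_eq_zero_of_has (hqm 0) (a4 0)⟩
      · exact ⟨GLine.through_has a2 _, GLine.eval_eq_zero_of_has (hqm 1) (a4 1)⟩
      · exact ⟨GLine.through_has a2 _, GLine.eval_eq_zero_of_has (hqm 2) (a4 2)⟩
    · rw [Finset.card_eq_three.2 ⟨_, _, _, a5, a6, a7, rfl⟩]
      omega
  have hSinf : S.Infinite := infinite_of_mem_nhds 0 hSnhds
  obtain ⟨T, hTS, hTcard⟩ := hSinf.exists_subset_card_eq (f.totalDegree * 2 + 1)
  have hinj : Set.InjOn (fun θ => GLine.through (y θ) (u θ)) T := by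
    intro θ hθ θ' hθ' h
    by_contra hne
    obtain ⟨-, -, b1, b2⟩ := hTS hθ
    obtain ⟨-, -, b1', -⟩ := hTS hθ'
    have hyne : y θ ≠ y θ' := by
      intro h
      have := congrFun h 2
      simp [hyd, GLine.dir_two] at this
      exact hne this
    have heq : GLine.through (y θ) (u θ) = m 0 := by
      refine GLine.eq_of_has hyne (GLine.through_has_base b1) ?_ (GLine.has_add (hmx 0) θ)
        (GLine.has_add (hmx 0) θ')
      change GLine.through (y θ) (u θ) = GLine.through (y θ') (u θ') at h
      rw [h]
      exact GLine.through_has_base b1'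
    apply b2
    rw [← heq, sub_eq_zero]
    exact GLine.dir_through b1
  have hdvd : f ∣ q := by
    by_contra hnd
    have h := line_bezout hf hnd (T.image fun θ => GLine.through (y θ) (u θ)) (by
      intro k hk
      obtain ⟨θ, hθ, rfl⟩ := Finset.mem_image.1 hk
      exact ⟨(hTS hθ).1, (hTS hθ).2.1⟩)
    rw [Finset.card_image_of_injOn hinj, hTcard] at h
    have : f.totalDegree * q.totalDegree ≤ f.totalDegree * 2 := Nat.mul_le_mul_left _ hqd
    omega
  exact (totalDegree_le_of_dvd_of_isDomain hdvd hq0).trans hqd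

/-- A flat surface of degree at least two contains few lines. -/
theorem card_lines_of_flat {f : MvPolynomial (Fin 3) ℝ} (hf : Irreducible f)
    (hd : 2 ≤ f.totalDegree) (hflat : ∀ c, f ∣ hess f c c) (L : Finset GLine)
    (hL : ∀ l ∈ L, l.restr f = 0) : L.card ≤ f.totalDegree * f.totalDegree := by
  obtain ⟨i₀, hi₀⟩ := exists_pderiv_not_dvd hf
  by_contra! hcon
  obtain ⟨l, hlL, hl⟩ : ∃ l ∈ L, l.restr (pderiv i₀ f) ≠ 0 := by
    by_contra! h
    have := line_bezout hf hi₀ L fun l hl => ⟨hL l hl, h l hl⟩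
    have h2 := totalDegree_pderiv_le i₀ f
    have h3 : f.totalDegree * (pderiv i₀ f).totalDegree ≤ f.totalDegree * f.totalDegree :=
      Nat.mul_le_mul_left _ (by omega)
    omega
  obtain ⟨z, hz⟩ : ∃ z, eval (l.pt z) (pderiv i₀ f) ≠ 0 := by
    by_contra! h
    exact hl ((l.restr_eq_zero_iff _).2 h)
  set x := l.pt z with hx
  set n : Fin 3 → ℝ := fun i => eval x (pderiv i f) with hn
  have hlf := hL l hlL
  have hnl : dotProduct n l.dir = 0 := (GLine.forms_eq_zero hlf (l.has_pt z)).1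
  have hxf : eval x f = 0 := GLine.eval_eq_zero_of_has hlf (l.has_pt z)
  have hnn : 0 < dotProduct n n := by
    refine Finset.sum_pos' (fun j _ => mul_self_nonneg _) ⟨i₀, Finset.mem_univ _, ?_⟩
    exact mul_self_pos.2 hz
  have htan : ∀ w : Fin 3 → ℝ, dotProduct n w = 0 → ∀ τ : ℝ, eval (x + τ • w) f = 0 := by
    intro w hw τ
    have h := flat_tang_line hf hflat hxf ((dotProduct n n)⁻¹ • crossProduct w n) τ
    have e : (fun i => eval x (tang f ((dotProduct n n)⁻¹ • crossProduct w n) i)) = w := by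
      have e1 : (fun i => eval x (tang f ((dotProduct n n)⁻¹ • crossProduct w n) i)) =
          (dotProduct n n)⁻¹ • crossProduct n (crossProduct w n) := by
        ext i
        fin_cases i <;> simp [tang, cross_apply, hn] <;> ring
      have e2 : crossProduct n (crossProduct w n) = dotProduct n n • w - dotProduct n w • n := by
        ext i
        fin_cases i <;> simp [cross_apply, dotProduct, Fin.sum_univ_three] <;> ring
      rw [e1, e2, hw, zero_smul, sub_zero, smul_smul, inv_mul_cancel₀ hnn.ne', one_smul]
    rwa [e] at h
  have hn01 : n 0 ≠ 0 ∨ n 1 ≠ 0 := by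
    by_contra! h
    simp [dotProduct, Fin.sum_univ_three, GLine.dir, h.1, h.2] at hnl
    simp [dotProduct, Fin.sum_univ_three, h.1, h.2, hnl] at hnn
  set w : ℕ → Fin 3 → ℝ := fun k => l.dir + (k : ℝ) • ![n 1, -n 0, 0] with hw
  have hw2 : ∀ k, w k 2 = 1 := by
    intro k
    simp [hw, GLine.dir]
  have hw2' : ∀ k, w k 2 ≠ 0 := fun k => by rw [hw2]; exact one_ne_zero
  have hwn : ∀ k, dotProduct n (w k) = 0 := by
    intro k
    rw [hw, dotProduct_add, hnl, dotProduct_smul]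
    simp [dotProduct, Fin.sum_univ_three]
    right
    ring
  set g : MvPolynomial (Fin 3) ℝ := ∑ i, C (n i) * (X i - C (x i)) with hg
  have hgd : g.totalDegree ≤ 1 := by
    refine totalDegree_finsetSum_le fun i _ => totalDegree_mul_le' (a := 0) (b := 1)
      (totalDegree_C _).le (totalDegree_sub_le' ?_ ?_) le_rfl
    · rw [totalDegree_X]
    · rw [totalDegree_C]
      omega
  have hgeval : ∀ p, eval p g = dotProduct n (p - x) := by
    intro p
    simp [hg, dotProduct]
  have hg0 : g ≠ 0 := by
    intro h
    have := hgeval (x + n)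
    rw [h, add_sub_cancel_left, map_zero] at this
    exact hnn.ne this
  have hinj : Function.Injective fun k => GLine.through x (w k) := by
    intro k k' h
    have h1 := GLine.dir_through (y := x) (hw2' k)
    have h2 := GLine.dir_through (y := x) (hw2' k')
    simp only at h
    rw [h, hw2, one_smul] at h1
    rw [hw2, one_smul, ← h1] at h2
    have a0 := congrFun h2 0
    have a1 := congrFun h2 1
    simp [hw] at a0 a1
    rcases hn01 with h | h
    · exact (a1.resolve_right h).symm
    · exact (a0.resolve_right h).symm
  have hdvd : f ∣ g := by
    by_contra hnd
    have h := line_bezout hf hnd ((Finset.range (f.totalDegree + 1)).image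
      fun k => GLine.through x (w k)) (by
      intro k hk
      obtain ⟨j, -, rfl⟩ := Finset.mem_image.1 hk
      refine ⟨GLine.through_restr (hw2' j) (htan _ (hwn j)), GLine.through_restr (hw2' j) ?_⟩
      intro τ
      rw [hgeval, add_sub_cancel_left, dotProduct_smul, hwn, smul_zero])
    rw [Finset.card_image_of_injective _ hinj, Finset.card_range] at h
    have : f.totalDegree * g.totalDegree ≤ f.totalDegree * 1 := Nat.mul_le_mul_left _ hgd
    omega
  have := totalDegree_le_of_dvd_of_isDomain hdvd hg0
  omega

theorem exists_tripleFactor_ne_zero {f : MvPolynomial (Fin 3) ℝ} {c : Fin 3 → ℝ}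
    (h : hess f c c ≠ 0) : ∃ e : Fin 3 → ℝ, tripleFactor f c e ≠ 0 := by
  by_contra! hcon
  apply h
  have ht : tang f c = 0 := by
    have h0 := hcon (Pi.single 0 1)
    have h1 := hcon (Pi.single 1 1)
    have h2 := hcon (Pi.single 2 1)
    simp [tripleFactor, dotProduct, Fin.sum_univ_three, cross_apply] at h0 h1 h2
    ext1 i
    fin_cases i <;> simp [tang, cross_apply]
    · linear_combination h0
    · linear_combination h1
    · linear_combination h2
  simp [hess, ht, form2]

/-- On an irreducible surface of degree at least three, few lines are crossed at many points by
other lines of the surface. -/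
theorem card_crossed_lines_le {f : MvPolynomial (Fin 3) ℝ} (hf : Irreducible f)
    (hd : 3 ≤ f.totalDegree) (L : Finset GLine) (hL : ∀ l ∈ L, l.restr f = 0 ∧
      ∃ S : Finset (Fin 3 → ℝ), 20 * f.totalDegree < S.card ∧ ∀ x ∈ S, l.Has x ∧
        ∃ m : GLine, l ≠ m ∧ m.restr f = 0 ∧ m.Has x) :
    L.card ≤ 20 * f.totalDegree ^ 2 := by
  set d := f.totalDegree with hdd
  by_contra! hcon
  by_cases hflat : ∀ c, f ∣ hess f c c
  · have := card_lines_of_flat hf (by omega) hflat L fun l hl => (hL l hl).1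
    nlinarith
  push Not at hflat
  obtain ⟨c, hα⟩ := hflat
  obtain ⟨e, hη0⟩ := exists_tripleFactor_ne_zero (f := f) (c := c) (by
    rintro h
    rw [h] at hα
    exact hα (dvd_zero _))
  have hηd := totalDegree_tripleFactor_le f c e
  have hη : ¬ f ∣ tripleFactor f c e := by
    intro h
    have := totalDegree_le_of_dvd_of_isDomain h hη0
    omega
  have hαd : (hess f c c).totalDegree ≤ 3 * d := totalDegree_hess_le le_rfl c c
  have b1 := line_bezout hf hα (L.filter fun l => l.restr (hess f c c) = 0) (by
    intro l hl
    obtain ⟨h1, h2⟩ := Finset.mem_filter.1 hl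
    exact ⟨(hL l h1).1, h2⟩)
  have b2 := line_bezout hf hη (L.filter fun l => l.restr (tripleFactor f c e) = 0) (by
    intro l hl
    obtain ⟨h1, h2⟩ := Finset.mem_filter.1 hl
    exact ⟨(hL l h1).1, h2⟩)
  rw [← hdd] at b1 b2 hηd
  set L' := L.filter fun l => l.restr (hess f c c) ≠ 0 ∧ l.restr (tripleFactor f c e) ≠ 0 with hL'
  have hcard : 16 * d ^ 2 < L'.card := by
    have hsub : L ⊆ L' ∪ ((L.filter fun l => l.restr (hess f c c) = 0) ∪
        (L.filter fun l => l.restr (tripleFactor f c e) = 0)) := by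
      intro l hl
      by_cases h1 : l.restr (hess f c c) = 0
      · exact Finset.mem_union_right _ (Finset.mem_union_left _ (Finset.mem_filter.2 ⟨hl, h1⟩))
      by_cases h2 : l.restr (tripleFactor f c e) = 0
      · exact Finset.mem_union_right _ (Finset.mem_union_right _ (Finset.mem_filter.2 ⟨hl, h2⟩))
      exact Finset.mem_union_left _ (Finset.mem_filter.2 ⟨hl, h1, h2⟩)
    have h1 := (Finset.card_le_card hsub).trans ((Finset.card_union_le _ _).trans
      (Nat.add_le_add_left (Finset.card_union_le _ _) _))
    have h2 : d * (hess f c c).totalDegree ≤ d * (3 * d) := Nat.mul_le_mul_left _ hαd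
    have h3 : d * (tripleFactor f c e).totalDegree ≤ d * d := Nat.mul_le_mul_left _ (by omega)
    nlinarith
  have hpts : ∀ l ∈ L', ∃ S : Finset (Fin 3 → ℝ), 16 * d < S.card ∧ ∀ x ∈ S, l.Has x ∧
      eval x (hess f c c) ≠ 0 ∧ eval x (tripleFactor f c e) ≠ 0 ∧
        ∃ m : GLine, l ≠ m ∧ m.restr f = 0 ∧ m.Has x := by
    intro l hl
    obtain ⟨hlL, l1, l2⟩ := Finset.mem_filter.1 hl
    obtain ⟨hlf, S, hS, hSx⟩ := hL l hlL
    have c1 := GLine.card_le_of_restr_ne_zero l1 (S.filter fun x => eval x (hess f c c) = 0) (by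
      intro x hx
      obtain ⟨h1, h2⟩ := Finset.mem_filter.1 hx
      exact ⟨(hSx x h1).1, h2⟩)
    have c2 := GLine.card_le_of_restr_ne_zero l2
      (S.filter fun x => eval x (tripleFactor f c e) = 0) (by
      intro x hx
      obtain ⟨h1, h2⟩ := Finset.mem_filter.1 hx
      exact ⟨(hSx x h1).1, h2⟩)
    refine ⟨S.filter fun x => eval x (hess f c c) ≠ 0 ∧ eval x (tripleFactor f c e) ≠ 0, ?_, ?_⟩
    · have hsub : S ⊆ (S.filter fun x => eval x (hess f c c) ≠ 0 ∧
          eval x (tripleFactor f c e) ≠ 0) ∪ ((S.filter fun x => eval x (hess f c c) = 0) ∪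
            (S.filter fun x => eval x (tripleFactor f c e) = 0)) := by
        intro x hx
        by_cases h1 : eval x (hess f c c) = 0
        · exact Finset.mem_union_right _ (Finset.mem_union_left _ (Finset.mem_filter.2 ⟨hx, h1⟩))
        by_cases h2 : eval x (tripleFactor f c e) = 0
        · exact Finset.mem_union_right _ (Finset.mem_union_right _ (Finset.mem_filter.2 ⟨hx, h2⟩))
        exact Finset.mem_union_left _ (Finset.mem_filter.2 ⟨hx, h1, h2⟩)
      have h1 := (Finset.card_le_card hsub).trans ((Finset.card_union_le _ _).trans
        (Nat.add_le_add_left (Finset.card_union_le _ _) _))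
      omega
    · intro x hx
      obtain ⟨h1, h2, h3⟩ := Finset.mem_filter.1 hx
      exact ⟨(hSx x h1).1, h2, h3, (hSx x h1).2⟩
  have hLf : ∀ l ∈ L', l.restr f = 0 := fun l hl => (hL l (Finset.mem_filter.1 hl).1).1
  have hdiv : ∀ g : MvPolynomial (Fin 3) ℝ, g.totalDegree ≤ 13 * d →
      (∀ l ∈ L', l.restr g = 0) → f ∣ g := by
    intro g hg h
    by_contra hnd
    have h1 := line_bezout hf hnd L' fun l hl => ⟨hLf l hl, h l hl⟩
    have h2 : d * g.totalDegree ≤ d * (13 * d) := Nat.mul_le_mul_left _ hg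
    rw [← hdd] at h1
    nlinarith
  obtain ⟨dRe, dIm⟩ := totalDegree_asym_le (f := f) (d := d) le_rfl c e
  have hRe : f ∣ asymRe f c e := by
    refine hdiv _ dRe fun l hl => ?_
    obtain ⟨S, hS, hSx⟩ := hpts l hl
    refine GLine.restr_eq_zero_of_card (X := S) (fun x hx => ?_) (by omega)
    obtain ⟨h1, h2, h3, m, h4, h5, h6⟩ := hSx x hx
    exact ⟨h1, (double_point h2 h3 h4 (hLf l hl) h5 h1 h6).2.1⟩
  have hIm : f ∣ asymIm f c e := by
    refine hdiv _ dIm fun l hl => ?_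
    obtain ⟨S, hS, hSx⟩ := hpts l hl
    refine GLine.restr_eq_zero_of_card (X := S) (fun x hx => ?_) (by omega)
    obtain ⟨h1, h2, h3, m, h4, h5, h6⟩ := hSx x hx
    exact ⟨h1, (double_point h2 h3 h4 (hLf l hl) h5 h1 h6).2.2⟩
  obtain ⟨l, hl⟩ : L'.Nonempty := Finset.card_pos.1 (by omega)
  obtain ⟨S, hS, hSx⟩ := hpts l hl
  obtain ⟨T, hTS, hT⟩ := Finset.exists_subset_card_eq (s := S) (n := 3) (by omega)
  let x : Fin 3 → Fin 3 → ℝ := fun k => (T.equivFin.symm (Fin.cast hT.symm k)).1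
  have hxS : ∀ k, x k ∈ S := fun k => hTS (T.equivFin.symm (Fin.cast hT.symm k)).2
  have hxinj : Function.Injective x := by
    intro j k h
    have := T.equivFin.symm.injective (Subtype.ext h)
    simpa using this
  choose p1 p2 p3 m p4 p5 p6 using fun k => hSx (x k) (hxS k)
  have hΔ : ¬ f ∣ disc f c e := by
    rintro ⟨g, hg⟩
    apply (double_point (p2 0) (p3 0) (p4 0) (hLf l hl) (p5 0) (p1 0) (p6 0)).1
    rw [hg, map_mul, GLine.eval_eq_zero_of_has (hLf l hl) (p1 0), zero_mul]
  have := totalDegree_le_two_of_crossings hf hα hη hΔ hRe hIm (hLf l hl) hxinj p1 p5 p6 p4 (p2 0) p3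
  omega

end Quadric

section Isotropic

open Matrix

theorem trace_mul_self_eq_sum_eigenvalues {N : ℕ} {B : Matrix (Fin N) (Fin N) ℝ}
    (hB : B.IsHermitian) : (B * B).trace = ∑ i, hB.eigenvalues i ^ 2 := by
  conv_lhs => rw [hB.spectral_theorem]
  rw [← map_mul, Unitary.conjStarAlgAut_apply, trace_mul_cycle]
  simp [Matrix.diagonal_mul_diagonal, trace, pow_two]

theorem log_det_ge {N : ℕ} {B : Matrix (Fin N) (Fin N) ℝ} (hB : B.IsHermitian)
    (htr : B.trace = N) {τ : ℝ} (hτ : (B * B).trace = N + τ) (hτ4 : τ ≤ 1 / 4) :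
    0 < B.det ∧ -(2 * τ) ≤ Real.log B.det := by
  have h1 : ∑ i, (hB.eigenvalues i - 1) = 0 := by
    rw [hB.trace_eq_sum_eigenvalues] at htr
    simp only [Finset.sum_sub_distrib]
    simp at htr ⊢
    linarith
  have h2 : ∑ i, (hB.eigenvalues i - 1) ^ 2 = τ := by
    rw [trace_mul_self_eq_sum_eigenvalues hB] at hτ
    have : ∀ i, (hB.eigenvalues i - 1) ^ 2 =
        hB.eigenvalues i ^ 2 - 2 * (hB.eigenvalues i - 1) - 1 := fun i => by ring
    simp only [this, Finset.sum_sub_distrib, ← Finset.mul_sum]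
    rw [← Finset.sum_sub_distrib, h1, hτ]
    simp
  have h3 : ∀ i, 1 / 2 ≤ hB.eigenvalues i := by
    intro i
    have := Finset.single_le_sum (f := fun i => (hB.eigenvalues i - 1) ^ 2)
      (fun i _ => sq_nonneg _) (Finset.mem_univ i)
    rw [h2] at this
    nlinarith
  have hdet : B.det = ∏ i, hB.eigenvalues i := by
    rw [hB.det_eq_prod_eigenvalues]
    simp
  refine ⟨?_, ?_⟩
  · rw [hdet]
    exact Finset.prod_pos fun i _ => by linarith [h3 i]
  · rw [hdet, Real.log_prod fun i _ => by linarith [h3 i]]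
    have h4 : ∀ i, (hB.eigenvalues i - 1) - 2 * (hB.eigenvalues i - 1) ^ 2 ≤
        Real.log (hB.eigenvalues i) := by
      intro i
      have hp : 0 < hB.eigenvalues i := by linarith [h3 i]
      have h5 := Real.one_sub_inv_le_log_of_pos hp
      refine le_trans ?_ h5
      have h6 : (hB.eigenvalues i)⁻¹ ≤ 2 := by
        rw [inv_le_comm₀ hp two_pos]
        linarith [h3 i]
      have h7 : 1 - (hB.eigenvalues i)⁻¹ = (hB.eigenvalues i - 1) -
          (hB.eigenvalues i)⁻¹ * (hB.eigenvalues i - 1) ^ 2 := by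
        field_simp
        ring
      rw [h7]
      gcongr
    have := Finset.sum_le_sum fun i (_ : i ∈ Finset.univ) => h4 i
    rw [Finset.sum_sub_distrib, ← Finset.mul_sum, h1, h2] at this
    linarith

theorem det_sq_le {N : ℕ} (M : Matrix (Fin N) (Fin N) ℝ) :
    M.det ^ 2 ≤ (N.factorial : ℝ) ^ 2 * ∏ j, (M j ⬝ᵥ M j) := by
  have hrow : ∀ i j, |M i j| ≤ √(M i ⬝ᵥ M i) := by
    intro i j
    rw [← Real.sqrt_sq_eq_abs]
    apply Real.sqrt_le_sqrt
    rw [pow_two]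
    exact Finset.single_le_sum (f := fun j => M i j * M i j)
      (fun j _ => mul_self_nonneg _) (Finset.mem_univ j)
  have h : |M.det| ≤ (N.factorial : ℝ) * ∏ i, √(M i ⬝ᵥ M i) := by
    rw [← det_transpose, det_apply]
    refine (Finset.abs_sum_le_sum_abs _ _).trans ?_
    refine (Finset.sum_le_card_nsmul _ _ (∏ i, √(M i ⬝ᵥ M i)) ?_).trans ?_
    · intro σ _
      have : |Equiv.Perm.sign σ • ∏ i, Mᵀ (σ i) i| = ∏ i, |M i (σ i)| := by
        rcases Int.units_eq_one_or (Equiv.Perm.sign σ) with h | h <;>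
          simp [h, Finset.abs_prod, transpose_apply]
      rw [this]
      exact Finset.prod_le_prod (fun _ _ => abs_nonneg _) fun i _ => hrow _ _
    · simp [Fintype.card_perm]
  have hp : ∏ j, (M j ⬝ᵥ M j) = (∏ i, √(M i ⬝ᵥ M i)) ^ 2 := by
    rw [← Finset.prod_pow]
    refine Finset.prod_congr rfl fun i _ => ?_
    rw [Real.sq_sqrt]
    exact Finset.sum_nonneg fun _ _ => mul_self_nonneg _
  rw [hp, ← mul_pow, ← sq_abs]
  exact pow_le_pow_left₀ (abs_nonneg _) h 2

theorem dotProduct_self_pos {N : ℕ} {y : Fin N → ℝ} (hy : y ≠ 0) : 0 < y ⬝ᵥ y :=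
  lt_of_le_of_ne (Finset.sum_nonneg fun _ _ => mul_self_nonneg _)
    fun h => hy (dotProduct_self_eq_zero.1 h.symm)

/-- The logarithmic potential whose approximate minimisers put `v` in nearly isotropic position. -/
noncomputable def isoPotential {m N : ℕ} (v : Fin m → Fin N → ℝ) (A : Matrix (Fin N) (Fin N) ℝ) :
    ℝ :=
  ∑ i, Real.log ((A *ᵥ v i) ⬝ᵥ (A *ᵥ v i)) - (m / N : ℝ) * Real.log (A.det ^ 2)

/-- Any `N` of the vectors are linearly independent. -/
def GenericFamily {m N : ℕ} (v : Fin m → Fin N → ℝ) : Prop :=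
  ∀ e : Fin N → Fin m, Function.Injective e → (Matrix.of fun j => v (e j)).det ≠ 0

theorem GenericFamily.exists_window {m N : ℕ} [NeZero m] (hNm : N ≤ m) (i : Fin m) :
    Function.Injective fun j : Fin N => i + Fin.castLE hNm j :=
  fun _ _ h => Fin.castLE_injective hNm (add_left_cancel h)

theorem GenericFamily.ne_zero {m N : ℕ} (hN : 0 < N) (hNm : N ≤ m) {v : Fin m → Fin N → ℝ}
    (hv : GenericFamily v) (i : Fin m) : v i ≠ 0 := by
  intro h
  have : NeZero m := ⟨by lia⟩
  refine hv _ (GenericFamily.exists_window hNm i) (det_eq_zero_of_row_eq_zero ⟨0, hN⟩ ?_)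
  intro j
  have : Fin.castLE hNm ⟨0, hN⟩ = (0 : Fin m) := by
    ext; simp
  simp [this, h]

theorem GenericFamily.mulVec_ne_zero {m N : ℕ} (hN : 0 < N) (hNm : N ≤ m) {v : Fin m → Fin N → ℝ}
    (hv : GenericFamily v) {A : Matrix (Fin N) (Fin N) ℝ} (hA : A.det ≠ 0) (i : Fin m) :
    A *ᵥ v i ≠ 0 := fun h =>
  hv.ne_zero hN hNm i (eq_zero_of_mulVec_eq_zero hA h)

theorem GenericFamily.bddBelow {m N : ℕ} (hN : 0 < N) (hNm : N ≤ m) {v : Fin m → Fin N → ℝ}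
    (hv : GenericFamily v) : ∃ c : ℝ, ∀ A : Matrix (Fin N) (Fin N) ℝ, A.det ≠ 0 →
      c ≤ isoPotential v A := by
  have : NeZero m := ⟨by lia⟩
  set e : Fin m → Fin N → Fin m := fun i j => i + Fin.castLE hNm j with he
  set w : Fin m → ℝ := fun i => Real.log ((Matrix.of fun j => v (e i j)).det ^ 2) -
    Real.log ((N.factorial : ℝ) ^ 2) with hw
  refine ⟨(∑ i, w i) / N, fun A hA => ?_⟩
  set q : Fin m → ℝ := fun i => (A *ᵥ v i) ⬝ᵥ (A *ᵥ v i) with hq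
  have hqpos : ∀ i, 0 < q i := fun i => dotProduct_self_pos (hv.mulVec_ne_zero hN hNm hA i)
  have key : ∀ i, w i + Real.log (A.det ^ 2) ≤ ∑ j, Real.log (q (e i j)) := by
    intro i
    have hd := hv _ (GenericFamily.exists_window hNm i)
    have h1 := det_sq_le (Matrix.of (fun j => v (e i j)) * Aᵀ)
    have h2 : ∀ j, (Matrix.of (fun j => v (e i j)) * Aᵀ) j = A *ᵥ v (e i j) := by
      intro j
      ext k
      simp [mul_apply, mulVec, dotProduct, mul_comm]
    simp only [h2, det_mul, det_transpose] at h1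
    have hf : ((N.factorial : ℝ) ^ 2) ≠ 0 := by positivity
    have h3 := Real.log_le_log (by positivity) h1
    rw [mul_pow, Real.log_mul (pow_ne_zero _ hd) (by positivity),
      Real.log_mul hf (Finset.prod_ne_zero_iff.2 fun j _ => (hqpos _).ne'),
      Real.log_prod fun j _ => (hqpos _).ne'] at h3
    simp only [hw]
    linarith
  have hsum := Finset.sum_le_sum fun i (_ : i ∈ Finset.univ) => key i
  have hcomm : ∑ i, ∑ j, Real.log (q (e i j)) = N * ∑ i, Real.log (q i) := by
    rw [Finset.sum_comm]
    have : ∀ j : Fin N, ∑ i, Real.log (q (e i j)) = ∑ i, Real.log (q i) := fun j =>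
      Equiv.sum_comp (Equiv.addRight (Fin.castLE hNm j)) fun i => Real.log (q i)
    simp [this]
  rw [hcomm, Finset.sum_add_distrib] at hsum
  simp only [Finset.sum_const, Finset.card_univ, Fintype.card_fin, nsmul_eq_mul] at hsum
  have hN' : (0 : ℝ) < N := by exact_mod_cast hN
  rw [isoPotential, div_le_iff₀ hN', sub_mul]
  have : (m / N : ℝ) * Real.log (A.det ^ 2) * N = m * Real.log (A.det ^ 2) := by
    field_simp
  rw [this]
  linarith

/-- Vectors in general position can be mapped by an invertible matrix to vectors whose
normalisations have Gram matrix of nearly minimal Frobenius norm. -/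
theorem GenericFamily.exists_isotropic {m N : ℕ} (hN : 0 < N) (hNm : N ≤ m)
    {v : Fin m → Fin N → ℝ} (hv : GenericFamily v) :
    ∃ (A : Matrix (Fin N) (Fin N) ℝ) (u : Fin m → Fin N → ℝ), A.det ≠ 0 ∧
      (∀ i, ∃ c : ℝ, 0 < c ∧ u i = c • A *ᵥ v i) ∧ (∀ i, u i ⬝ᵥ u i = 1) ∧
      ∑ i, ∑ k, (u i ⬝ᵥ u k) ^ 2 ≤ 2 * (m : ℝ) ^ 2 / N := by
  obtain ⟨c, hc⟩ := hv.bddBelow hN hNm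
  have hN' : (0 : ℝ) < N := by exact_mod_cast hN
  have hN1 : (1 : ℝ) ≤ N := by exact_mod_cast hN
  have hm' : (0 : ℝ) < m := by exact_mod_cast hN.trans_le hNm
  set Φ : Set ℝ := isoPotential v '' {A | A.det ≠ 0} with hΦ
  have hne : Φ.Nonempty := ⟨_, 1, by simp, rfl⟩
  have hbdd : BddBelow Φ := ⟨c, by rintro _ ⟨A, hA, rfl⟩; exact hc A hA⟩
  have hε : (0 : ℝ) < m / (8 * N) := by positivity
  obtain ⟨_, ⟨A, hA, rfl⟩, hlt⟩ := Real.lt_sInf_add_pos hne hε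
  change A.det ≠ 0 at hA
  have hmin : ∀ A' : Matrix (Fin N) (Fin N) ℝ, A'.det ≠ 0 →
      isoPotential v A ≤ isoPotential v A' + m / (8 * N) := fun A' hA' => by
    linarith [csInf_le hbdd ⟨A', hA', rfl⟩]
  set q : Fin m → ℝ := fun i => (A *ᵥ v i) ⬝ᵥ (A *ᵥ v i) with hq
  have hqpos : ∀ i, 0 < q i := fun i => dotProduct_self_pos (hv.mulVec_ne_zero hN hNm hA i)
  set u : Fin m → Fin N → ℝ := fun i => (√(q i))⁻¹ • A *ᵥ v i with hu
  have hunit : ∀ i, u i ⬝ᵥ u i = 1 := by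
    intro i
    have h1 : √(q i) ≠ 0 := (Real.sqrt_pos.2 (hqpos i)).ne'
    have h2 : √(q i) * √(q i) = q i := Real.mul_self_sqrt (hqpos i).le
    simp only [hu, smul_dotProduct, dotProduct_smul, smul_eq_mul]
    change (√(q i))⁻¹ * ((√(q i))⁻¹ * q i) = 1
    field_simp
    nlinarith
  refine ⟨A, u, hA, fun i => ⟨_, inv_pos.2 (Real.sqrt_pos.2 (hqpos i)), rfl⟩, hunit, ?_⟩
  set U : Matrix (Fin m) (Fin N) ℝ := Matrix.of u with hU
  have hG : ∑ i, ∑ k, (u i ⬝ᵥ u k) ^ 2 = (Uᵀ * U * (Uᵀ * U)).trace := by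
    have h1 : (Uᵀ * U * (Uᵀ * U)).trace = (U * Uᵀ * (U * Uᵀ)).trace := by
      rw [Matrix.mul_assoc, trace_mul_comm]
      simp only [Matrix.mul_assoc]
    rw [h1, trace]
    refine Finset.sum_congr rfl fun i _ => ?_
    simp only [diag_apply, mul_apply (M := U * Uᵀ)]
    refine Finset.sum_congr rfl fun k _ => ?_
    have h2 : ∀ i k, (U * Uᵀ) i k = u i ⬝ᵥ u k := fun i k => rfl
    rw [h2, h2, dotProduct_comm (u k), pow_two]
  set S : Matrix (Fin N) (Fin N) ℝ := Uᵀ * U with hS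
  have hSt : Sᵀ = S := by simp [hS]
  have hStr : S.trace = m := by
    rw [hS, trace_mul_comm, trace]
    have : ∀ i, (U * Uᵀ).diag i = u i ⬝ᵥ u i := fun i => rfl
    simp only [this, hunit]
    simp
  set H : Matrix (Fin N) (Fin N) ℝ := (m / N : ℝ) • 1 - S with hH
  have hHt : Hᵀ = H := by simp [hH, hSt]
  have hHtr : H.trace = 0 := by
    rw [hH, trace_sub, trace_smul, hStr, trace_one, Fintype.card_fin, smul_eq_mul]
    field_simp
    ring
  set T : ℝ := (H * H).trace with hT
  have hTsum : T = ∑ a, ∑ b, H a b ^ 2 := by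
    rw [hT, trace]
    refine Finset.sum_congr rfl fun a _ => ?_
    rw [diag_apply, mul_apply]
    refine Finset.sum_congr rfl fun b _ => ?_
    have hab : H b a = H a b := congrFun (congrFun hHt a) b
    rw [hab, pow_two]
  have hT0 : 0 ≤ T := hTsum ▸ Finset.sum_nonneg fun _ _ => Finset.sum_nonneg fun _ _ => sq_nonneg _
  have hHS : (H * S).trace = -T := by
    have : S = (m / N : ℝ) • 1 - H := by simp [hH]
    rw [this, Matrix.mul_sub, trace_sub, Matrix.mul_smul, Matrix.mul_one, trace_smul, hHtr]
    simp [hT]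
  have hTS : (S * S).trace = T + (m : ℝ) ^ 2 / N := by
    have h1 : (H * S).trace = (m / N : ℝ) * m - (S * S).trace := by
      rw [hH, Matrix.sub_mul, trace_sub, Matrix.smul_mul, Matrix.one_mul, trace_smul, hStr,
        smul_eq_mul]
    rw [hHS] at h1
    have h2 : (m : ℝ) ^ 2 / N = m / N * m := by ring
    linarith
  have hTm : T ≤ (m : ℝ) ^ 2 := by
    have h1 : ∑ i, ∑ k, (u i ⬝ᵥ u k) ^ 2 ≤ (m : ℝ) ^ 2 := by
      have h2 : ∀ i k, (u i ⬝ᵥ u k) ^ 2 ≤ 1 := by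
        intro i k
        have h3 := Finset.sum_mul_sq_le_sq_mul_sq Finset.univ (u i) (u k)
        have h4 : ∀ i, ∑ j, u i j ^ 2 = 1 := fun i => by
          rw [← hunit i, dotProduct]
          exact Finset.sum_congr rfl fun _ _ => pow_two _
        rw [h4, h4] at h3
        rw [mul_one] at h3
        exact h3
      calc ∑ i, ∑ k, (u i ⬝ᵥ u k) ^ 2 ≤ ∑ _i : Fin m, ∑ _k : Fin m, (1 : ℝ) :=
            Finset.sum_le_sum fun i _ => Finset.sum_le_sum fun k _ => h2 i k
        _ = (m : ℝ) ^ 2 := by simp [pow_two]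
    rw [hG, hTS] at h1
    have : 0 ≤ (m : ℝ) ^ 2 / N := by positivity
    linarith
  set t : ℝ := 1 / (4 * m) with ht
  have ht0 : 0 < t := by positivity
  have htm : t * m = 1 / 4 := by rw [ht]; field_simp
  set B : Matrix (Fin N) (Fin N) ℝ := 1 + t • H with hB
  have hBt : B.IsHermitian := by
    rw [IsHermitian, conjTranspose_eq_transpose_of_trivial]
    simp [hB, hHt]
  have hBtr : B.trace = N := by simp [hB, hHtr]
  have hBB : (B * B).trace = N + t ^ 2 * T := by
    have : B * B = 1 + (2 * t) • H + t ^ 2 • (H * H) := by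
      rw [hB, Matrix.add_mul, Matrix.mul_add, Matrix.mul_add]
      simp only [Matrix.one_mul, Matrix.mul_one, Matrix.smul_mul, Matrix.mul_smul, smul_smul]
      rw [two_mul, add_smul, pow_two]
      abel
    rw [this, trace_add, trace_add, trace_smul, trace_smul, hHtr]
    simp [← hT]
  have hτ : t ^ 2 * T ≤ 1 / 4 := by
    calc t ^ 2 * T ≤ t ^ 2 * (m : ℝ) ^ 2 := by gcongr
      _ = (t * m) ^ 2 := by ring
      _ ≤ 1 / 4 := by rw [htm]; norm_num
  obtain ⟨hBdet, hlogdet⟩ := log_det_ge hBt hBtr hBB hτ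
  have hqH : ∀ i, (H *ᵥ u i) ⬝ᵥ (H *ᵥ u i) ≤ T := by
    intro i
    rw [hTsum, dotProduct]
    refine Finset.sum_le_sum fun a _ => ?_
    have h3 := Finset.sum_mul_sq_le_sq_mul_sq Finset.univ (H a) (u i)
    have h4 : ∑ j, u i j ^ 2 = 1 := by
      rw [← hunit i, dotProduct]
      exact Finset.sum_congr rfl fun _ _ => pow_two _
    rw [h4, mul_one] at h3
    rw [← pow_two]
    exact h3
  have hBu : ∀ i, (B *ᵥ u i) ⬝ᵥ (B *ᵥ u i) ≤ 1 + 2 * t * (u i ⬝ᵥ (H *ᵥ u i)) + t ^ 2 * T := by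
    intro i
    have h1 : B *ᵥ u i = u i + t • (H *ᵥ u i) := by
      rw [hB, add_mulVec, one_mulVec, smul_mulVec]
    rw [h1, dotProduct_add, add_dotProduct, add_dotProduct, hunit]
    simp only [smul_dotProduct, dotProduct_smul, smul_eq_mul]
    rw [dotProduct_comm (H *ᵥ u i) (u i)]
    nlinarith [hqH i, sq_nonneg t]
  have hune : ∀ i, u i ≠ 0 := fun i h => by simpa [h] using hunit i
  have hBpos : ∀ i, 0 < (B *ᵥ u i) ⬝ᵥ (B *ᵥ u i) := fun i =>
    dotProduct_self_pos fun h => hune i (eq_zero_of_mulVec_eq_zero hBdet.ne' h)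
  have hF := hmin (B * A) (by rw [det_mul]; exact mul_ne_zero hBdet.ne' hA)
  have hFB : isoPotential v (B * A) = isoPotential v A +
      ∑ i, Real.log ((B *ᵥ u i) ⬝ᵥ (B *ᵥ u i)) - (m / N : ℝ) * (2 * Real.log B.det) := by
    have h1 : ∀ i, Real.log (((B * A) *ᵥ v i) ⬝ᵥ ((B * A) *ᵥ v i)) =
        Real.log (q i) + Real.log ((B *ᵥ u i) ⬝ᵥ (B *ᵥ u i)) := by
      intro i
      rw [← Real.log_mul (hqpos i).ne' (hBpos i).ne']
      congr 1
      have h2 : A *ᵥ v i = √(q i) • u i := by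
        simp only [hu, smul_smul]
        rw [mul_inv_cancel₀ (Real.sqrt_pos.2 (hqpos i)).ne', one_smul]
      rw [← mulVec_mulVec, h2, mulVec_smul]
      simp only [smul_dotProduct, dotProduct_smul, smul_eq_mul]
      rw [← mul_assoc, Real.mul_self_sqrt (hqpos i).le]
    rw [isoPotential, isoPotential]
    simp only [h1, Finset.sum_add_distrib]
    rw [det_mul, mul_pow, Real.log_mul (pow_ne_zero _ hBdet.ne') (pow_ne_zero _ hA),
      Real.log_pow B.det]
    push_cast
    ring
  have hlog : ∑ i, Real.log ((B *ᵥ u i) ⬝ᵥ (B *ᵥ u i)) ≤ -(2 * t * T) + m * (t ^ 2 * T) := by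
    have hsumH : ∑ i, u i ⬝ᵥ (H *ᵥ u i) = -T := by
      rw [← hHS, hS, ← Matrix.mul_assoc, trace_mul_comm, ← Matrix.mul_assoc, Matrix.mul_assoc,
        trace]
      refine Finset.sum_congr rfl fun i _ => ?_
      rw [diag_apply, mul_apply]
      rfl
    calc ∑ i, Real.log ((B *ᵥ u i) ⬝ᵥ (B *ᵥ u i))
        ≤ ∑ i, (2 * t * (u i ⬝ᵥ (H *ᵥ u i)) + t ^ 2 * T) := by
          refine Finset.sum_le_sum fun i _ => ?_
          linarith [Real.log_le_sub_one_of_pos (hBpos i), hBu i]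
      _ = -(2 * t * T) + m * (t ^ 2 * T) := by
          rw [Finset.sum_add_distrib, ← Finset.mul_sum, hsumH]
          simp
  rw [hG, hTS]
  have hmN : (m / N : ℝ) ≤ m := div_le_self hm'.le hN1
  have hdetle : (m / N : ℝ) * (2 * Real.log B.det) ≥ -(m * (4 * (t ^ 2 * T))) := by
    have h1 : (m / N : ℝ) * (2 * Real.log B.det) ≥ (m / N : ℝ) * (2 * -(2 * (t ^ 2 * T))) := by
      gcongr
    have h2 : (m / N : ℝ) * (4 * (t ^ 2 * T)) ≤ m * (4 * (t ^ 2 * T)) := by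
      have : 0 ≤ t ^ 2 * T := by positivity
      gcongr
    linarith
  have hfin : 2 * t * T - 5 * m * (t ^ 2 * T) ≤ m / (8 * N) := by linarith
  have h5 : 5 * m * (t ^ 2 * T) = 5 / 4 * (t * T) := by
    calc 5 * m * (t ^ 2 * T) = 5 * (t * m) * (t * T) := by ring
      _ = 5 / 4 * (t * T) := by rw [htm]; ring
  have h6 : t * T ≤ m / (6 * N) := by
    have : (m / (8 * N) : ℝ) = m / (6 * N) * (3 / 4) := by field_simp; norm_num
    linarith
  have h7 : T ≤ (m : ℝ) ^ 2 / N := by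
    have h8 : T = 4 * m * (t * T) := by
      calc T = 4 * (t * m) * T := by rw [htm]; ring
        _ = 4 * m * (t * T) := by ring
    rw [h8]
    calc 4 * m * (t * T) ≤ 4 * m * (m / (6 * N)) := by gcongr
      _ = 2 / 3 * ((m : ℝ) ^ 2 / N) := by field_simp; norm_num
      _ ≤ (m : ℝ) ^ 2 / N := by
        have : 0 ≤ (m : ℝ) ^ 2 / N := by positivity
        linarith
  have h9 : 2 * (m : ℝ) ^ 2 / N = (m : ℝ) ^ 2 / N + (m : ℝ) ^ 2 / N := by ring
  linarith
end Isotropic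

section GaussianSigns

open MeasureTheory ProbabilityTheory
open scoped NNReal ENNReal

theorem gaussianReal_abs_le (r : ℝ) :
    gaussianReal 0 1 {b : ℝ | |b| ≤ r} ≤ ENNReal.ofReal (2 * r) := by
  have hset : {b : ℝ | |b| ≤ r} = Set.Icc (-r) r := by
    ext b
    simp [abs_le]
  rw [hset, gaussianReal_apply 0 one_ne_zero]
  calc ∫⁻ x in Set.Icc (-r) r, gaussianPDF 0 1 x
      ≤ ∫⁻ _ in Set.Icc (-r) r, 1 := by
        refine lintegral_mono fun x => ?_
        rw [gaussianPDF, ← ENNReal.ofReal_one]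
        refine ENNReal.ofReal_le_ofReal ?_
        rw [gaussianPDFReal]
        have h1 : (√(2 * Real.pi * (1 : ℝ≥0)))⁻¹ ≤ 1 := by
          refine inv_le_one_of_one_le₀ (Real.one_le_sqrt.2 ?_)
          have := Real.pi_gt_three
          push_cast
          linarith
        have h2 : Real.exp (-(x - 0) ^ 2 / (2 * (1 : ℝ≥0))) ≤ 1 := by
          rw [Real.exp_le_one_iff]
          have := sq_nonneg (x - 0)
          push_cast
          linarith
        exact mul_le_one₀ h1 (Real.exp_nonneg _) h2
    _ = ENNReal.ofReal (2 * r) := by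
        rw [setLIntegral_one, Real.volume_Icc]
        congr 1
        ring

theorem gaussian_prod_mul_pos_le :
    ((gaussianReal 0 1).prod (gaussianReal 0 1)) {x : ℝ × ℝ | 0 < x.1 * x.2} ≤ 1 / 2 := by
  set ν := (gaussianReal 0 1).prod (gaussianReal 0 1) with hν
  have hmp : MeasurePreserving (fun x : ℝ × ℝ => (x.1, -x.2)) ν ν := by
    have h2 : MeasurePreserving (fun b : ℝ => -b) (gaussianReal 0 1) (gaussianReal 0 1) :=
      ⟨measurable_neg, by simpa using gaussianReal_map_neg (μ := 0) (v := 1)⟩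
    exact (MeasurePreserving.id _).prod h2
  have hm : MeasurableSet {x : ℝ × ℝ | 0 < x.1 * x.2} :=
    measurableSet_lt measurable_const (by fun_prop)
  have h1 := hmp.measure_preimage hm.nullMeasurableSet
  have hdisj : Disjoint {x : ℝ × ℝ | 0 < x.1 * x.2}
      ((fun x : ℝ × ℝ => (x.1, -x.2)) ⁻¹' {x : ℝ × ℝ | 0 < x.1 * x.2}) := by
    rw [Set.disjoint_left]
    intro x hx hx'
    simp only [Set.mem_preimage, Set.mem_ofPred_eq] at hx hx'
    linarith
  have h2 := measure_union (μ := ν) hdisj (hmp.measurable hm)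
  rw [h1, ← two_mul] at h2
  rw [ENNReal.le_div_iff_mul_le (by simp) (by simp), mul_comm, ← h2]
  exact prob_le_one

theorem exists_gaussian_cone_bound : ∃ K : ℝ≥0, ∀ t : ℝ, 0 ≤ t →
    ((gaussianReal 0 1).prod (gaussianReal 0 1)) {x : ℝ × ℝ | |x.2| ≤ t * |x.1|} ≤
      K * ENNReal.ofReal t := by
  have hfin : ∫⁻ a : ℝ, ENNReal.ofReal (2 * |a|) ∂(gaussianReal 0 1) ≠ ∞ := by
    have h1 : Integrable (fun a : ℝ => 2 * |a|) (gaussianReal 0 1) :=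
      ((memLp_id_gaussianReal (μ := 0) (v := 1) 1).integrable (by simp)).abs.const_mul 2
    exact (lintegral_ofReal_ne_top_iff_integrable h1.aestronglyMeasurable
      (Filter.Eventually.of_forall fun a => by positivity)).2 h1
  refine ⟨(∫⁻ a : ℝ, ENNReal.ofReal (2 * |a|) ∂(gaussianReal 0 1)).toNNReal, fun t ht => ?_⟩
  rw [ENNReal.coe_toNNReal hfin, Measure.prod_apply (measurableSet_le (by fun_prop) (by fun_prop)),
    mul_comm, ← lintegral_const_mul' _ _ ENNReal.ofReal_ne_top]
  refine lintegral_mono fun a => ?_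
  refine (gaussianReal_abs_le (t * |a|)).trans_eq ?_
  rw [← ENNReal.ofReal_mul ht]
  congr 1
  ring

theorem exists_stdGaussian_sign_bound : ∃ K : ℝ≥0, ∀ (N : ℕ) (u v : EuclideanSpace ℝ (Fin N)),
    ‖u‖ = 1 → ‖v‖ = 1 →
    stdGaussian (EuclideanSpace ℝ (Fin N)) {w | 0 < inner ℝ u w * inner ℝ v w} ≤
      1 / 2 + K * ENNReal.ofReal |inner ℝ u v| := by
  obtain ⟨K, hK⟩ := exists_gaussian_cone_bound
  refine ⟨1 + 2 * K, fun N u v hu hv => ?_⟩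
  set ρ : ℝ := inner ℝ u v with hρ
  by_cases hbig : 1 / 2 ≤ |ρ|
  · refine prob_le_one.trans ?_
    have h1 : (1 : ℝ≥0∞) = 1 / 2 + 1 * ENNReal.ofReal (1 / 2) := by
      rw [one_mul, ENNReal.ofReal_div_of_pos two_pos]
      simp [ENNReal.inv_two_add_inv_two]
    conv_lhs => rw [h1]
    gcongr
    push_cast
    exact le_self_add
  push Not at hbig
  have huu : inner ℝ u u = (1 : ℝ) := by rw [real_inner_self_eq_norm_sq, hu]; norm_num
  have hvv : inner ℝ v v = (1 : ℝ) := by rw [real_inner_self_eq_norm_sq, hv]; norm_num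
  have hρ2 : ρ ^ 2 ≤ 1 / 4 := by
    rw [← sq_abs]
    nlinarith [abs_nonneg ρ]
  set s : ℝ := √(1 - ρ ^ 2) with hs
  have hs2 : s ^ 2 = 1 - ρ ^ 2 := Real.sq_sqrt (by linarith)
  have hs0 : 1 / 2 ≤ s := by
    rw [hs]
    apply Real.le_sqrt_of_sq_le
    linarith
  set x : EuclideanSpace ℝ (Fin N) := s⁻¹ • (v - ρ • u) with hx
  have hvx : v = ρ • u + s • x := by
    rw [hx, smul_smul, mul_inv_cancel₀ (by linarith), one_smul]
    abel
  have hux : inner ℝ u x = (0 : ℝ) := by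
    rw [hx, inner_smul_right, inner_sub_right, inner_smul_right, huu, ← hρ]
    ring
  have hxx : ‖x‖ = 1 := by
    have h1 : inner ℝ x x = (1 : ℝ) := by
      have h2 := hvv
      rw [hvx] at h2
      simp only [inner_add_left, inner_add_right, inner_smul_left, inner_smul_right,
        real_inner_comm u x, hux, huu] at h2
      simp only [conj_trivial] at h2
      have h3 : s ^ 2 * inner ℝ x x = s ^ 2 * 1 := by linarith
      exact mul_left_cancel₀ (by positivity) h3
    rw [real_inner_self_eq_norm_sq] at h1
    nlinarith [norm_nonneg x]
  have hne : u ≠ x := by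
    rintro h
    rw [← h, huu] at hux
    norm_num at hux
  have hon : Orthonormal ℝ ((↑) : ({u, x} : Set (EuclideanSpace ℝ (Fin N))) →
      EuclideanSpace ℝ (Fin N)) := by
    rw [orthonormal_subtype_iff_ite]
    rintro a (rfl | rfl) b (rfl | rfl)
    · simpa using huu
    · simpa [hne] using hux
    · rw [real_inner_comm, hux]
      simp [hne.symm]
    · rw [real_inner_self_eq_norm_sq, hxx]
      simp
  obtain ⟨B, b, hB, hb⟩ := hon.exists_orthonormalBasis_extension
  set i : B := ⟨u, hB (by simp)⟩ with hi
  set j : B := ⟨x, hB (by simp)⟩ with hj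
  have hij : i ≠ j := fun h => hne (congrArg Subtype.val h)
  have hbi : b i = u := by rw [hb]
  have hbj : b j = x := by rw [hb]
  rw [stdGaussian_eq_map_pi_orthonormalBasis b, Measure.map_apply (by fun_prop)
    (measurableSet_lt measurable_const (by fun_prop))]
  have hset : (fun y : B → ℝ => ∑ i, y i • b i) ⁻¹' {w | 0 < inner ℝ u w * inner ℝ v w} =
      (fun y : B → ℝ => (y i, y j)) ⁻¹' {z : ℝ × ℝ | 0 < z.1 * (ρ * z.1 + s * z.2)} := by
    ext y
    simp only [Set.mem_preimage, Set.mem_ofPred_eq]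
    have h1 : ∀ k, inner ℝ (b k) (∑ i, y i • b i) = y k := fun k =>
      b.orthonormal.inner_right_fintype y k
    have h2 : inner ℝ u (∑ i, y i • b i) = y i := by rw [← h1 i, hbi]
    have h3 : inner ℝ x (∑ i, y i • b i) = y j := by rw [← h1 j, hbj]
    rw [hvx, inner_add_left, inner_smul_left, inner_smul_left, h2, h3]
    simp
  have hind : IndepFun (fun y : B → ℝ => y i) (fun y => y j)
      (Measure.pi fun _ : B => gaussianReal 0 1) :=
    (iIndepFun_pi (μ := fun _ : B => gaussianReal 0 1) (X := fun _ => id)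
      fun _ => aemeasurable_id).indepFun hij
  have hmap := (indepFun_iff_map_prod_eq_prod_map_map
    (measurable_pi_apply i).aemeasurable (measurable_pi_apply j).aemeasurable).1 hind
  rw [(measurePreserving_eval (fun _ : B => gaussianReal 0 1) i).map_eq,
    (measurePreserving_eval (fun _ : B => gaussianReal 0 1) j).map_eq] at hmap
  rw [hset, ← Measure.map_apply (by fun_prop) (measurableSet_lt measurable_const (by fun_prop)),
    hmap]
  refine (measure_mono (t := {z : ℝ × ℝ | 0 < z.1 * z.2} ∪
    {z : ℝ × ℝ | |z.2| ≤ 2 * |ρ| * |z.1|}) ?_).trans ((measure_union_le _ _).trans ?_)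
  · rintro ⟨p, q⟩ hz
    simp only [Set.mem_union, Set.mem_ofPred_eq] at hz ⊢
    by_contra! hcon
    obtain ⟨h1, h2⟩ := hcon
    have h3 : p * (ρ * p + s * q) = ρ * p ^ 2 + s * (p * q) := by ring
    have h4 : |p * q| = |p| * |q| := abs_mul _ _
    rw [abs_of_nonpos h1] at h4
    have h5 : ρ * p ^ 2 ≤ |ρ| * |p| ^ 2 := by
      rw [sq_abs]
      exact mul_le_mul_of_nonneg_right (le_abs_self _) (sq_nonneg _)
    have h6 : s * (p * q) ≤ 1 / 2 * (p * q) := by nlinarith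
    have h7 : p * q = -(|p| * |q|) := by linarith
    nlinarith [abs_nonneg p, abs_nonneg q, abs_nonneg ρ]
  · refine add_le_add gaussian_prod_mul_pos_le ((hK _ (by positivity)).trans ?_)
    rw [ENNReal.ofReal_mul two_pos.le]
    push_cast
    rw [ENNReal.ofReal_ofNat, ← mul_assoc, mul_comm (K : ℝ≥0∞) 2]
    gcongr
    exact le_add_self

end GaussianSigns

section Halving

open MeasureTheory ProbabilityTheory Matrix
open scoped NNReal ENNReal Topology

theorem stdGaussian_singleton_zero {N : ℕ} (hN : 0 < N) :
    stdGaussian (EuclideanSpace ℝ (Fin N)) {0} = 0 := by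
  have : Nonempty (Fin N) := ⟨⟨0, hN⟩⟩
  have := nullSingletonClass_gaussianReal (μ := 0) (v := 1) one_ne_zero
  rw [← map_pi_eq_stdGaussian, Measure.map_apply (by fun_prop) (measurableSet_singleton _)]
  have h : (WithLp.toLp 2 : (Fin N → ℝ) → EuclideanSpace ℝ (Fin N)) ⁻¹' {0} = {0} := by
    ext x
    simp
  rw [h]
  exact measure_singleton _

/-- The pairs of `E` whose members lie strictly on the same side of the hyperplane `w⊥`. -/
noncomputable def sameSide {M N : ℕ} (v : Fin M → Fin N → ℝ) (E : Finset (Fin M × Fin M))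
    (w : Fin N → ℝ) : Finset (Fin M × Fin M) :=
  E.filter fun p => 0 < (w ⬝ᵥ v p.1) * (w ⬝ᵥ v p.2)

theorem exists_unit_halving : ∃ K : ℝ, 0 ≤ K ∧ ∀ {M N : ℕ}, 0 < N → ∀ (u : Fin M → Fin N → ℝ)
    (E : Finset (Fin M × Fin M)), (∀ i, u i ⬝ᵥ u i = 1) →
    ∃ w : Fin N → ℝ, w ≠ 0 ∧
      ((sameSide u E w).card : ℝ) ≤ E.card / 2 + K * ∑ p ∈ E, |u p.1 ⬝ᵥ u p.2| := by
  obtain ⟨K, hK⟩ := exists_stdGaussian_sign_bound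
  refine ⟨K, K.2, fun {M N} hN u E hu => ?_⟩
  set U : Fin M → EuclideanSpace ℝ (Fin N) := fun i => WithLp.toLp 2 (u i) with hU
  have hinner : ∀ i (w : EuclideanSpace ℝ (Fin N)), inner ℝ (U i) w = w.ofLp ⬝ᵥ u i := by
    intro i w
    simp [hU, EuclideanSpace.inner_eq_star_dotProduct]
  have hnorm : ∀ i, ‖U i‖ = 1 := by
    intro i
    have h1 : inner ℝ (U i) (U i) = (1 : ℝ) := by rw [hinner, hU]; exact hu i
    rw [real_inner_self_eq_norm_sq] at h1
    nlinarith [norm_nonneg (U i)]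
  set μ := stdGaussian (EuclideanSpace ℝ (Fin N)) with hμ
  set S : Fin M × Fin M → Set (EuclideanSpace ℝ (Fin N)) := fun p =>
    {w | 0 < inner ℝ (U p.1) w * inner ℝ (U p.2) w} with hS
  have hSm : ∀ p, MeasurableSet (S p) := fun p => measurableSet_lt measurable_const (by fun_prop)
  obtain ⟨g, hg0, hg⟩ := exists_notMem_null_le_lintegral (μ := μ)
    (f := fun w => ∑ p ∈ E, (S p).indicator (fun _ => (1 : ℝ≥0∞)) w)
    (Finset.aemeasurable_fun_sum _ fun p _ => (measurable_const.indicator (hSm p)).aemeasurable)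
    (stdGaussian_singleton_zero hN)
  refine ⟨g.ofLp, fun h => hg0 (by simpa using h), ?_⟩
  have hcard : ∑ p ∈ E, (S p).indicator (fun _ => (1 : ℝ≥0∞)) g =
      ((sameSide u E g.ofLp).card : ℝ≥0∞) := by
    rw [sameSide, Finset.card_filter]
    push_cast
    refine Finset.sum_congr rfl fun p _ => ?_
    simp only [Set.indicator_apply, hS, Set.mem_ofPred_eq, hinner]
  rw [hcard, lintegral_finsetSum _ fun p _ => measurable_const.indicator (hSm p)] at hg
  have h1 : ((sameSide u E g.ofLp).card : ℝ≥0∞) ≤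
      ENNReal.ofReal (E.card / 2 + K * ∑ p ∈ E, |u p.1 ⬝ᵥ u p.2|) := by
    refine hg.trans ?_
    calc ∑ p ∈ E, ∫⁻ w, (S p).indicator (fun _ => (1 : ℝ≥0∞)) w ∂μ
        ≤ ∑ p ∈ E, ENNReal.ofReal (1 / 2 + K * |u p.1 ⬝ᵥ u p.2|) := by
          refine Finset.sum_le_sum fun p _ => ?_
          rw [lintegral_indicator_const (hSm p), one_mul]
          refine (hK N _ _ (hnorm p.1) (hnorm p.2)).trans_eq ?_
          rw [ENNReal.ofReal_add (by norm_num) (by positivity), ENNReal.ofReal_mul K.coe_nonneg,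
            ENNReal.ofReal_div_of_pos two_pos, ENNReal.ofReal_coe_nnreal]
          rw [hinner, hU, dotProduct_comm]
          simp
      _ = ENNReal.ofReal (E.card / 2 + K * ∑ p ∈ E, |u p.1 ⬝ᵥ u p.2|) := by
          rw [← ENNReal.ofReal_sum_of_nonneg fun p _ => by positivity, Finset.sum_add_distrib,
            ← Finset.mul_sum]
          congr 2
          simp [div_eq_mul_inv]
  rw [← ENNReal.ofReal_natCast] at h1
  exact (ENNReal.ofReal_le_ofReal_iff (by positivity)).1 h1

theorem exists_generic_halving : ∃ K : ℝ, 0 ≤ K ∧ ∀ {M N : ℕ}, 0 < N → N ≤ M →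
    ∀ (v : Fin M → Fin N → ℝ) (E : Finset (Fin M × Fin M)), GenericFamily v →
    ∃ w : Fin N → ℝ, w ≠ 0 ∧
      ((sameSide v E w).card : ℝ) ≤ E.card / 2 + K * (M * √(E.card / N)) := by
  obtain ⟨K, hK0, hK⟩ := exists_unit_halving
  refine ⟨K * √2, by positivity, fun {M N} hN hNM v E hv => ?_⟩
  obtain ⟨A, u, hA, huc, hu, hsum⟩ := hv.exists_isotropic hN hNM
  obtain ⟨w, hw0, hw⟩ := hK hN u E hu
  refine ⟨Aᵀ *ᵥ w, fun h => hw0 (eq_zero_of_mulVec_eq_zero (by rwa [det_transpose]) h), ?_⟩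
  have hsame : sameSide v E (Aᵀ *ᵥ w) ⊆ sameSide u E w := by
    intro p hp
    rw [sameSide, Finset.mem_filter] at hp ⊢
    refine ⟨hp.1, ?_⟩
    obtain ⟨c, hc, h1⟩ := huc p.1
    obtain ⟨d, hd, h2⟩ := huc p.2
    have h3 : ∀ i, (Aᵀ *ᵥ w) ⬝ᵥ v i = w ⬝ᵥ A *ᵥ v i := by
      intro i
      rw [mulVec_transpose, ← dotProduct_mulVec]
    rw [h3, h3] at hp
    rw [h1, h2, dotProduct_smul, dotProduct_smul, smul_eq_mul, smul_eq_mul]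
    have := mul_pos (mul_pos hc hd) hp.2
    linarith
  have h1 : ((sameSide v E (Aᵀ *ᵥ w)).card : ℝ) ≤ (sameSide u E w).card := by
    exact_mod_cast Finset.card_le_card hsame
  refine h1.trans (hw.trans ?_)
  rw [mul_assoc K]
  gcongr
  have h2 : (∑ p ∈ E, |u p.1 ⬝ᵥ u p.2|) ^ 2 ≤ E.card * (2 * (M : ℝ) ^ 2 / N) := by
    refine (sq_sum_le_card_mul_sum_sq).trans ?_
    gcongr
    refine le_trans ?_ hsum
    rw [← Finset.sum_product']
    simp only [sq_abs]
    exact Finset.sum_le_sum_of_subset_of_nonneg (fun p _ => by simp) fun _ _ _ => sq_nonneg _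
  refine (Real.le_sqrt_of_sq_le h2).trans_eq ?_
  have h3 : (E.card : ℝ) * (2 * (M : ℝ) ^ 2 / N) = 2 * ((M : ℝ) ^ 2 * (E.card / N)) := by ring
  rw [h3, Real.sqrt_mul two_pos.le, Real.sqrt_mul (by positivity), Real.sqrt_sq (by positivity)]

theorem exists_generic_perturbation {M N : ℕ} (v : Fin M → Fin N → ℝ) {ε : ℝ} (hε : 0 < ε) :
    ∃ δ : ℝ, 0 < δ ∧ δ < ε ∧
      GenericFamily fun (i : Fin M) (k : Fin N) => v i k + δ * ((i : ℕ) : ℝ) ^ (k : ℕ) := by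
  set bad : Set ℝ := ⋃ e : Fin N → Fin M, {δ | Function.Injective e ∧
    (Matrix.of fun (j k : Fin N) => v (e j) k + δ * ((e j : ℕ) : ℝ) ^ (k : ℕ)).det = 0} with hbad
  have hfin : bad.Finite := by
    refine Set.finite_iUnion fun e => ?_
    by_cases he : Function.Injective e
    · set W : Matrix (Fin N) (Fin N) ℝ := vandermonde fun j => ((e j : ℕ) : ℝ) with hW
      set V : Matrix (Fin N) (Fin N) ℝ := Matrix.of fun j => v (e j) with hV
      set p : Polynomial ℝ := det ((Polynomial.X : Polynomial ℝ) • W.map Polynomial.C +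
        V.map Polynomial.C) with hp
      have hdet : W.det ≠ 0 := by
        rw [hW, det_vandermonde_ne_zero_iff]
        intro a b hab
        exact he (Fin.ext (Nat.cast_injective (R := ℝ) hab))
      have hp0 : p ≠ 0 := by
        intro h
        have := Polynomial.coeff_det_X_add_C_card W V
        rw [← hp, h] at this
        exact hdet (by simpa using this.symm)
      refine (p.roots.toFinset.finite_toSet).subset ?_
      rintro δ ⟨-, hδ⟩
      simp only [Finset.mem_coe, Multiset.mem_toFinset, Polynomial.mem_roots hp0,
        Polynomial.IsRoot.def]
      rw [← hδ, hp, ← Polynomial.coe_evalRingHom, RingHom.map_det]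
      congr 1
      ext j k
      simp [hW, hV, vandermonde_apply, add_comm]
    · refine Set.finite_empty.subset ?_
      rintro δ ⟨h, -⟩
      exact he h
  obtain ⟨δ, ⟨h1, h2⟩, h3⟩ := ((Set.Ioo_infinite hε).sdiff hfin).nonempty
  refine ⟨δ, h1, h2, fun e he h => h3 ?_⟩
  rw [hbad, Set.mem_iUnion]
  exact ⟨e, he, h⟩

/-- Every finite family of vectors in `ℝ^N` with a set `E` of pairs admits a hyperplane
through the origin separating or touching roughly half of the pairs. -/
theorem exists_halving : ∃ K : ℝ, 0 ≤ K ∧ ∀ {M N : ℕ}, 0 < N →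
    ∀ (v : Fin M → Fin N → ℝ) (E : Finset (Fin M × Fin M)),
    ∃ w : Fin N → ℝ, w ≠ 0 ∧
      ((sameSide v E w).card : ℝ) ≤ E.card / 2 + K * (M * √(E.card / N)) := by
  obtain ⟨K, hK0, hK⟩ := exists_generic_halving
  refine ⟨K, hK0, fun {M N} hN v E => ?_⟩
  rcases lt_or_ge M N with hMN | hNM
  · have hker := LinearMap.ker_ne_bot_of_finrank_lt (f := (Matrix.of v).mulVecLin) (by simpa)
    obtain ⟨w, hw, hw0⟩ := (Submodule.ne_bot_iff _).1 hker
    refine ⟨w, hw0, ?_⟩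
    have h1 : ∀ i, w ⬝ᵥ v i = 0 := by
      intro i
      rw [dotProduct_comm]
      exact congrFun (LinearMap.mem_ker.1 hw) i
    have h2 : sameSide v E w = ∅ := by
      rw [sameSide, Finset.filter_eq_empty_iff]
      simp [h1]
    rw [h2]
    simp only [Finset.card_empty, Nat.cast_zero]
    positivity
  choose δ hδ0 hδ hgen using fun n : ℕ => exists_generic_perturbation v
    (ε := 1 / ((n : ℝ) + 1)) (by positivity)
  set V : ℕ → Fin M → Fin N → ℝ := fun n i k => v i k + δ n * ((i : ℕ) : ℝ) ^ (k : ℕ) with hV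
  have hw : ∀ n, ∃ w : Fin N → ℝ, w ∈ Metric.sphere (0 : Fin N → ℝ) 1 ∧
      ((sameSide (V n) E w).card : ℝ) ≤ E.card / 2 + K * (M * √(E.card / N)) := by
    intro n
    obtain ⟨w, hw0, hw⟩ := hK hN hNM (V n) E (hgen n)
    have hpos : 0 < ‖w‖⁻¹ := inv_pos.2 (norm_pos_iff.2 hw0)
    refine ⟨‖w‖⁻¹ • w, ?_, ?_⟩
    · rw [mem_sphere_zero_iff_norm, norm_smul, norm_inv, norm_norm,
        inv_mul_cancel₀ (norm_pos_iff.2 hw0).ne']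
    · refine le_trans ?_ hw
      have hsub : sameSide (V n) E (‖w‖⁻¹ • w) ⊆ sameSide (V n) E w := by
        intro p hp
        rw [sameSide, Finset.mem_filter] at hp ⊢
        refine ⟨hp.1, ?_⟩
        have h := hp.2
        rw [smul_dotProduct, smul_dotProduct, smul_eq_mul, smul_eq_mul] at h
        have h2 : 0 < (‖w‖⁻¹ * ‖w‖⁻¹) * ((w ⬝ᵥ V n p.1) * (w ⬝ᵥ V n p.2)) := by linarith
        exact pos_of_mul_pos_right h2 (by positivity)
      exact_mod_cast Finset.card_le_card hsub
  choose w hws hwc using hw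
  obtain ⟨z, hz, φ, hφ, hlim⟩ := (isCompact_sphere (0 : Fin N → ℝ) 1).tendsto_subseq hws
  refine ⟨z, fun h => by simp [h] at hz, ?_⟩
  have hδlim : Filter.Tendsto δ Filter.atTop (𝓝 0) :=
    squeeze_zero (fun n => (hδ0 n).le) (fun n => (hδ n).le) tendsto_one_div_add_atTop_nhds_zero_nat
  have hVlim : ∀ i, Filter.Tendsto (fun n => V (φ n) i) Filter.atTop (𝓝 (v i)) := by
    intro i
    rw [tendsto_pi_nhds]
    intro k
    have := (hδlim.comp hφ.tendsto_atTop).mul_const (((i : ℕ) : ℝ) ^ (k : ℕ))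
    simpa using this.const_add (v i k)
  have hdot : ∀ i, Filter.Tendsto (fun n => w (φ n) ⬝ᵥ V (φ n) i) Filter.atTop
      (𝓝 (z ⬝ᵥ v i)) := by
    intro i
    refine tendsto_finsetSum _ fun k _ => ?_
    exact ((tendsto_pi_nhds.1 hlim) k).mul ((tendsto_pi_nhds.1 (hVlim i)) k)
  have hev : ∀ᶠ n in Filter.atTop, sameSide v E z ⊆ sameSide (V (φ n)) E (w (φ n)) := by
    have h1 : ∀ p ∈ sameSide v E z, ∀ᶠ n in Filter.atTop,
        p ∈ sameSide (V (φ n)) E (w (φ n)) := by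
      intro p hp
      rw [sameSide, Finset.mem_filter] at hp
      filter_upwards [((hdot p.1).mul (hdot p.2)).eventually (lt_mem_nhds hp.2)] with n hn
      rw [sameSide, Finset.mem_filter]
      exact ⟨hp.1, hn⟩
    exact (Finset.eventually_all _).2 h1
  obtain ⟨n, hn⟩ := hev.exists
  refine le_trans ?_ (hwc (φ n))
  exact_mod_cast Finset.card_le_card hn

end Halving

section Partition

open MvPolynomial Matrix

/-- All the polynomials of `gs` have the same strict sign at the two points of the pair. -/
def SameCell (gs : List (MvPolynomial (Fin 3) ℝ)) (p : (Fin 3 → ℝ) × (Fin 3 → ℝ)) : Prop :=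
  ∀ g ∈ gs, 0 < eval p.1 g * eval p.2 g

theorem exists_poly_halving : ∃ K : ℝ, 0 ≤ K ∧ ∀ (X : Finset (Fin 3 → ℝ))
    (E : Finset ((Fin 3 → ℝ) × (Fin 3 → ℝ))), E ⊆ X ×ˢ X → ∀ (s : ℕ) (σ : ℝ), 0 < σ →
    σ ^ 2 ≤ s + 1 → ∃ g : MvPolynomial (Fin 3) ℝ, g ≠ 0 ∧ g.totalDegree ≤ s ∧
      √((E.filter fun p => 0 < eval p.1 g * eval p.2 g).card : ℝ) ≤
        √(1 / 2) * √(E.card : ℝ) + K * X.card / σ ^ 3 := by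
  obtain ⟨K, hK0, hK⟩ := exists_halving
  refine ⟨K * √6, by positivity, fun X E hE s σ hσ hσs => ?_⟩
  set N := Module.finrank ℝ (PolyLE s) with hN
  have hdim := six_mul_finrank_polyLE s
  rw [← hN] at hdim
  have hN0 : 0 < N := by
    by_contra h
    have : N = 0 := by lia
    rw [this] at hdim
    simp at hdim
  have : Module.Finite ℝ (PolyLE s) := Module.finite_of_finrank_pos hN0
  set b := Module.finBasis ℝ (PolyLE s) with hb
  set φ := X.equivFin with hφ
  set v : Fin X.card → Fin N → ℝ := fun i k => eval (φ.symm i : Fin 3 → ℝ) (b k : MvPolynomial _ ℝ)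
    with hv
  set E' : Finset (Fin X.card × Fin X.card) := Finset.univ.filter fun p =>
    ((φ.symm p.1 : Fin 3 → ℝ), (φ.symm p.2 : Fin 3 → ℝ)) ∈ E with hE'
  have hinj : Function.Injective fun p : Fin X.card × Fin X.card =>
      ((φ.symm p.1 : Fin 3 → ℝ), (φ.symm p.2 : Fin 3 → ℝ)) := by
    rintro ⟨a, b⟩ ⟨c, d⟩ h
    simp only [Prod.mk.injEq] at h
    have h1 := φ.symm.injective (Subtype.ext h.1)
    have h2 := φ.symm.injective (Subtype.ext h.2)
    rw [h1, h2]
  have hcard : ∀ F ⊆ E, (Finset.univ.filter fun p : Fin X.card × Fin X.card =>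
      ((φ.symm p.1 : Fin 3 → ℝ), (φ.symm p.2 : Fin 3 → ℝ)) ∈ F).card = F.card := by
    intro F hF
    rw [← Finset.card_image_of_injective _ hinj]
    congr 1
    ext ⟨x, y⟩
    simp only [Finset.mem_image, Finset.mem_filter, Finset.mem_univ, true_and, Prod.exists,
      Prod.mk.injEq]
    constructor
    · rintro ⟨a, b, h, rfl, rfl⟩
      exact h
    · intro h
      have hx := Finset.mem_product.1 (hE (hF h))
      exact ⟨φ ⟨x, hx.1⟩, φ ⟨y, hx.2⟩, by simpa using h, by simp, by simp⟩
  obtain ⟨w, hw0, hw⟩ := hK hN0 v E'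
  set g : PolyLE s := ∑ k, w k • b k with hg
  have hg0 : g ≠ 0 := by
    intro h
    refine hw0 (funext fun k => ?_)
    exact Fintype.linearIndependent_iff.1 b.linearIndependent w h k
  have heval : ∀ i, w ⬝ᵥ v i = eval (φ.symm i : Fin 3 → ℝ) (g : MvPolynomial (Fin 3) ℝ) := by
    intro i
    rw [hg, Submodule.coe_sum, map_sum]
    refine Finset.sum_congr rfl fun k _ => ?_
    simp [hv, smul_eval]
  refine ⟨g, fun h => hg0 (Subtype.ext h), mem_polyLE.1 g.2, ?_⟩
  set E₁ := E.filter fun p => 0 < eval p.1 (g : MvPolynomial (Fin 3) ℝ) *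
    eval p.2 (g : MvPolynomial (Fin 3) ℝ) with hE₁
  have hside : (sameSide v E' w).card = E₁.card := by
    rw [← hcard E₁ (Finset.filter_subset _ _), sameSide, hE', Finset.filter_filter]
    congr 1
    ext p
    simp [heval, hE₁]
  rw [hside, hcard E subset_rfl] at hw
  set e := √(E.card : ℝ) with he
  have he2 : e ^ 2 = E.card := Real.sq_sqrt (by positivity)
  have he0 : 0 ≤ e := Real.sqrt_nonneg _
  have hNσ : √((E.card : ℝ) / N) ≤ √6 * e / σ ^ 3 := by
    have h1 : σ ^ 6 ≤ 6 * N := by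
      have h2 : ((6 * N : ℕ) : ℝ) = ((s + 1) * (s + 2) * (s + 3) : ℕ) := by rw [hdim]
      push_cast at h2
      rw [h2]
      calc σ ^ 6 = (σ ^ 2) ^ 3 := by ring
        _ ≤ ((s : ℝ) + 1) ^ 3 := by gcongr
        _ = ((s : ℝ) + 1) * (s + 1) * (s + 1) := by ring
        _ ≤ ((s : ℝ) + 1) * (s + 2) * (s + 3) := by gcongr <;> norm_num
    rw [Real.sqrt_le_left (by positivity), div_pow, mul_pow, Real.sq_sqrt (by norm_num), he2,
      div_le_div_iff₀ (by exact_mod_cast hN0) (by positivity)]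
    calc (E.card : ℝ) * (σ ^ 3) ^ 2 = (E.card : ℝ) * σ ^ 6 := by ring
      _ ≤ (E.card : ℝ) * (6 * N) := by gcongr
      _ = 6 * (E.card : ℝ) * N := by ring
  set a := K * √6 * X.card / σ ^ 3 with ha
  have ha0 : 0 ≤ a := by positivity
  have hE1 : (E₁.card : ℝ) ≤ e ^ 2 / 2 + a * e := by
    calc (E₁.card : ℝ) ≤ E.card / 2 + K * (X.card * √(E.card / N)) := hw
      _ ≤ e ^ 2 / 2 + K * (X.card * (√6 * e / σ ^ 3)) := by rw [he2]; gcongr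
      _ = e ^ 2 / 2 + a * e := by rw [ha]; ring
  set r := √(1 / 2 : ℝ) with hr
  have hr2 : r ^ 2 = 1 / 2 := Real.sq_sqrt (by norm_num)
  have hr1 : 1 / 2 ≤ r := Real.le_sqrt_of_sq_le (by norm_num)
  rw [Real.sqrt_le_left (by positivity)]
  have hae : 0 ≤ a * e := by positivity
  have hexp : (r * e + a) ^ 2 = r ^ 2 * e ^ 2 + 2 * r * (a * e) + a ^ 2 := by ring
  rw [hexp, hr2]
  nlinarith [sq_nonneg a]

theorem exists_partition_step {K : ℝ} (hK0 : 0 ≤ K) {X : Finset (Fin 3 → ℝ)}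
    (hK : ∀ E : Finset ((Fin 3 → ℝ) × (Fin 3 → ℝ)), E ⊆ X ×ˢ X → ∀ (s : ℕ) (σ : ℝ), 0 < σ →
      σ ^ 2 ≤ s + 1 → ∃ g : MvPolynomial (Fin 3) ℝ, g ≠ 0 ∧ g.totalDegree ≤ s ∧
      √((E.filter fun p => 0 < eval p.1 g * eval p.2 g).card : ℝ) ≤
        √(1 / 2) * √(E.card : ℝ) + K * X.card / σ ^ 3)
    (gs : List (MvPolynomial (Fin 3) ℝ)) (hgs : ∀ g ∈ gs, g ≠ 0)
    {s : ℕ} {σ : ℝ} (hσ : 0 < σ) (hσs : σ ^ 2 ≤ s + 1) (j : ℕ) :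
    ∃ gs' : List (MvPolynomial (Fin 3) ℝ), (∀ g ∈ gs', g ≠ 0) ∧
      (gs'.map totalDegree).sum ≤ (gs.map totalDegree).sum + j * s ∧
      √(((X ×ˢ X).filter (SameCell gs')).card : ℝ) ≤
        √(1 / 2) ^ j * √(((X ×ˢ X).filter (SameCell gs)).card : ℝ) + j * (K * X.card / σ ^ 3) := by
  induction j with
  | zero => exact ⟨gs, hgs, by simp, by simp⟩
  | succ j ih =>
    obtain ⟨gs', h1, h2, h3⟩ := ih
    obtain ⟨g, hg0, hgs, hg⟩ := hK ((X ×ˢ X).filter (SameCell gs')) (Finset.filter_subset _ _) s σ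
      hσ hσs
    refine ⟨g :: gs', ?_, ?_, ?_⟩
    · simpa [hg0] using h1
    · simp only [List.map_cons, List.sum_cons]
      lia
    · have h4 : (X ×ˢ X).filter (SameCell (g :: gs')) = ((X ×ˢ X).filter (SameCell gs')).filter
          fun p => 0 < eval p.1 g * eval p.2 g := by
        ext p
        simp only [Finset.mem_filter, SameCell, List.mem_cons, forall_eq_or_imp]
        tauto
      rw [h4]
      refine hg.trans ?_
      set a := K * X.card / σ ^ 3 with ha
      have ha0 : 0 ≤ a := by positivity
      have hr0 : 0 ≤ √(1 / 2 : ℝ) := Real.sqrt_nonneg _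
      have hr1 : √(1 / 2 : ℝ) ≤ 1 := Real.sqrt_le_one.2 (by norm_num)
      have h5 := mul_le_mul_of_nonneg_left h3 hr0
      have h6 : √(1 / 2 : ℝ) * (j * a) ≤ 1 * (j * a) := by gcongr
      push_cast
      rw [pow_succ]
      linarith

theorem exists_dyadic_partition : ∃ K : ℝ, 0 ≤ K ∧ ∀ (X : Finset (Fin 3 → ℝ)) (k : ℕ) (β : ℝ),
    0 < β → ∃ gs : List (MvPolynomial (Fin 3) ℝ), (∀ g ∈ gs, g ≠ 0) ∧
      (((gs.map totalDegree).sum : ℕ) : ℝ) ≤ 8 * 4 ^ k * β ^ 2 ∧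
      √(((X ×ˢ X).filter (SameCell gs)).card : ℝ) ≤
        X.card / 8 ^ k * (1 + K / β ^ 3) := by
  obtain ⟨c, hc0, hc⟩ := exists_poly_halving
  refine ⟨21 * c, by positivity, fun X k => ?_⟩
  induction k with
  | zero =>
    intro β hβ
    refine ⟨[], by simp, by simp; positivity, ?_⟩
    have h1 : (X ×ˢ X).filter (SameCell []) = X ×ˢ X := by simp [SameCell]
    rw [h1, Finset.card_product]
    push_cast
    rw [Real.sqrt_mul_self (by positivity)]
    have : 0 ≤ (X.card : ℝ) * (21 * c / β ^ 3) := by positivity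
    linarith
  | succ k ih =>
    intro β hβ
    obtain ⟨gs, h1, h2, h3⟩ := ih (3 / 2 * β) (by positivity)
    set σ : ℝ := 2 ^ k * (3 / 2 * β) with hσ
    have hσ0 : 0 < σ := by positivity
    have hσ2 : σ ^ 2 = 4 ^ k * (9 / 4 * β ^ 2) := by
      rw [hσ, mul_pow, ← pow_mul, mul_comm k, pow_mul]
      ring
    have hσ3 : σ ^ 3 = 8 ^ k * (27 / 8 * β ^ 3) := by
      rw [hσ, mul_pow, ← pow_mul, mul_comm k, pow_mul]
      ring
    obtain ⟨gs', h4, h5, h6⟩ := exists_partition_step hc0 (hc X) gs h1 hσ0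
      (Nat.lt_floor_add_one (σ ^ 2)).le 6
    refine ⟨gs', h4, ?_, h6.trans ?_⟩
    · have h7 : ((⌊σ ^ 2⌋₊ : ℕ) : ℝ) ≤ σ ^ 2 := Nat.floor_le (by positivity)
      have h8 : (((gs'.map totalDegree).sum : ℕ) : ℝ) ≤
          (((gs.map totalDegree).sum : ℕ) : ℝ) + 6 * ⌊σ ^ 2⌋₊ := by exact_mod_cast h5
      rw [hσ2] at h7
      have h9 : (0 : ℝ) ≤ 4 ^ k * β ^ 2 := by positivity
      rw [pow_succ]
      rw [hσ2] at h8
      nlinarith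
    · have hr6 : √(1 / 2 : ℝ) ^ 6 = 1 / 8 := by
        calc √(1 / 2 : ℝ) ^ 6 = (√(1 / 2 : ℝ) ^ 2) ^ 3 := by ring
          _ = 1 / 8 := by rw [Real.sq_sqrt (by norm_num)]; norm_num
      rw [hr6, hσ3]
      have h7 := mul_le_mul_of_nonneg_left h3 (by norm_num : (0 : ℝ) ≤ 1 / 8)
      refine (add_le_add_left h7 _).trans ?_
      set M : ℝ := (X.card : ℝ) / 8 ^ k with hM
      have hM0 : 0 ≤ M := by positivity
      set B : ℝ := c / β ^ 3 with hB
      have hB0 : 0 ≤ B := by positivity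
      have e1 : 21 * c / (3 / 2 * β) ^ 3 = 56 / 9 * B := by
        rw [hB]; field_simp; ring
      have e2 : c * X.card / (8 ^ k * (27 / 8 * β ^ 3)) = 8 / 27 * (M * B) := by
        rw [hB, hM]; field_simp
      have e3 : (X.card : ℝ) / 8 ^ (k + 1) = M / 8 := by
        rw [hM, pow_succ]; field_simp
      have e4 : 21 * c / β ^ 3 = 21 * B := by rw [hB]; ring
      rw [e1, e2, e3, e4]
      have : 0 ≤ M * B := by positivity
      push_cast
      nlinarith

/-- **Polynomial partitioning**, in the form of a bound for the number of pairs of points in the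
same cell. -/
theorem exists_partition : ∃ K : ℝ, 0 ≤ K ∧ ∀ (X : Finset (Fin 3 → ℝ)) (D : ℕ), 1 ≤ D →
    ∃ gs : List (MvPolynomial (Fin 3) ℝ), (∀ g ∈ gs, g ≠ 0) ∧ (gs.map totalDegree).sum ≤ 8 * D ∧
      (((X ×ˢ X).filter (SameCell gs)).card : ℝ) ≤ K * X.card ^ 2 / D ^ 3 := by
  obtain ⟨K, hK0, hK⟩ := exists_dyadic_partition
  refine ⟨64 * (1 + K) ^ 2, by positivity, fun X D hD => ?_⟩
  obtain ⟨gs, h1, h2, h3⟩ := hK X (Nat.log 4 D) 1 one_pos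
  have hlo : 4 ^ Nat.log 4 D ≤ D := Nat.pow_log_le_self 4 (by lia)
  have hhi : D < 4 ^ (Nat.log 4 D + 1) := Nat.lt_pow_succ_log_self (by norm_num) D
  refine ⟨gs, h1, ?_, ?_⟩
  · have : (((gs.map totalDegree).sum : ℕ) : ℝ) ≤ ((8 * 4 ^ Nat.log 4 D : ℕ) : ℝ) := by
      push_cast
      simpa using h2
    have h4 : (gs.map totalDegree).sum ≤ 8 * 4 ^ Nat.log 4 D := by exact_mod_cast this
    lia
  · rw [Real.sqrt_le_left (by positivity)] at h3
    refine h3.trans ?_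
    set k := Nat.log 4 D
    have hD3 : (D : ℝ) ^ 3 ≤ 64 * (8 ^ k) ^ 2 := by
      have h5 : (D : ℝ) ≤ 4 ^ (k + 1) := by exact_mod_cast hhi.le
      calc (D : ℝ) ^ 3 ≤ (4 ^ (k + 1)) ^ 3 := by gcongr
        _ = 64 * (8 ^ k) ^ 2 := by
          rw [← pow_mul, ← pow_mul, show (8 : ℝ) = 2 ^ 3 by norm_num,
            show (4 : ℝ) = 2 ^ 2 by norm_num, show (64 : ℝ) = 2 ^ 6 by norm_num, ← pow_mul,
            ← pow_mul, ← pow_add]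
          congr 1
          ring
    have hD0 : (0 : ℝ) < D := by exact_mod_cast hD
    rw [one_pow, div_one, mul_pow, div_pow, le_div_iff₀ (by positivity)]
    calc (X.card : ℝ) ^ 2 / (8 ^ k) ^ 2 * (1 + K) ^ 2 * D ^ 3
        ≤ (X.card : ℝ) ^ 2 / (8 ^ k) ^ 2 * (1 + K) ^ 2 * (64 * (8 ^ k) ^ 2) := by gcongr
      _ = 64 * (1 + K) ^ 2 * X.card ^ 2 := by field_simp

theorem sameCell_symm {gs : List (MvPolynomial (Fin 3) ℝ)} {x y : Fin 3 → ℝ}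
    (h : SameCell gs (x, y)) : SameCell gs (y, x) := fun g hg => by
  have := h g hg
  simp only at this ⊢
  linarith

theorem card_le_add_card_offDiag_fibers {α : Type*} (Y : Finset α) {d : ℕ} (r : α → ℕ)
    (hr : ∀ x ∈ Y, r x < d) : Y.card ≤ d + (Y.offDiag.filter fun p => r p.1 = r p.2).card := by
  have h1 : Y.card = ∑ k ∈ Finset.range d, (Y.filter fun x => r x = k).card :=
    Finset.card_eq_sum_card_fiberwise fun x hx => by simpa using hr x hx
  have h2 : (Y.offDiag.filter fun p => r p.1 = r p.2).card =
      ∑ k ∈ Finset.range d, ((Y.filter fun x => r x = k).offDiag).card := by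
    rw [Finset.card_eq_sum_card_fiberwise (f := fun p => r p.1) (t := Finset.range d)]
    · refine Finset.sum_congr rfl fun k _ => ?_
      congr 1
      ext p
      simp only [Finset.mem_filter, Finset.mem_offDiag]
      constructor
      · rintro ⟨⟨⟨h1, h2, h3⟩, h4⟩, h5⟩
        exact ⟨⟨h1, h5⟩, ⟨h2, h4 ▸ h5⟩, h3⟩
      · rintro ⟨⟨h1, h5⟩, ⟨h2, h6⟩, h3⟩
        exact ⟨⟨⟨h1, h2, h3⟩, h5.trans h6.symm⟩, h5⟩
    · intro p hp
      simp only [Finset.coe_filter, Set.mem_ofPred_eq, Finset.mem_offDiag] at hp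
      simpa using hr _ hp.1.1
  rw [h1, h2]
  have h3 : ∀ k ∈ Finset.range d, (Y.filter fun x => r x = k).card ≤
      1 + ((Y.filter fun x => r x = k).offDiag).card := by
    intro k _
    rw [Finset.offDiag_card]
    set c := (Y.filter fun x => r x = k).card
    rcases Nat.lt_or_ge c 2 with h | h
    · lia
    · have : 2 * c ≤ c * c := Nat.mul_le_mul_right c h
      lia
  refine (Finset.sum_le_sum h3).trans ?_
  rw [Finset.sum_add_distrib]
  simp

theorem sameCell_of_lt {gs : List (MvPolynomial (Fin 3) ℝ)} {l : GLine}
    {x y : Fin 3 → ℝ} (hx : l.Has x) (hy : l.Has y) (hxy : x 2 < y 2)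
    (hroot : ∀ z, x 2 ≤ z → z ≤ y 2 → (l.restr gs.prod).eval z ≠ 0) : SameCell gs (x, y) := by
  intro g hg
  by_contra! hneg
  have h1 : ∀ z, (l.restr g).eval z = eval (l.pt z) g := fun z => l.eval_restr g z
  have hdvd : ∀ z, (l.restr g).eval z = 0 → (l.restr gs.prod).eval z = 0 := by
    intro z hz
    obtain ⟨q, hq⟩ := List.dvd_prod hg
    rw [hq, map_mul, Polynomial.eval_mul, hz, zero_mul]
  have hcont : ContinuousOn (fun z => (l.restr g).eval z) (Set.uIcc (x 2) (y 2)) :=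
    (l.restr g).continuous.continuousOn
  have h0 : (0 : ℝ) ∈ Set.uIcc ((l.restr g).eval (x 2)) ((l.restr g).eval (y 2)) := by
    rw [h1, h1, ← hx.eq_pt, ← hy.eq_pt, Set.mem_uIcc]
    simp only at hneg
    by_contra! hcon
    rcases lt_trichotomy (eval x g) 0 with h | h | h
    · have := hcon.1 h.le
      nlinarith
    · rw [h] at hcon
      by_cases h2 : 0 ≤ eval y g
      · exact absurd (hcon.1 le_rfl) (not_lt.2 h2)
      · exact absurd (hcon.2 (by linarith)) (lt_irrefl _)
    · by_cases h2 : eval y g ≤ 0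
      · have := hcon.2 h2
        linarith
      · nlinarith
  obtain ⟨z, hz, hz0⟩ := intermediate_value_uIcc hcont h0
  rw [Set.uIcc_of_le hxy.le] at hz
  exact hroot z hz.1 hz.2 (hdvd z hz0)

/-- A line not contained in the zero set of a partitioning polynomial visits few cells. -/
theorem card_le_of_restr_prod_ne_zero {gs : List (MvPolynomial (Fin 3) ℝ)} {l : GLine}
    (hl : l.restr gs.prod ≠ 0) (Y : Finset (Fin 3 → ℝ)) (hY : ∀ x ∈ Y, l.Has x)
    (hY0 : ∀ x ∈ Y, eval x gs.prod ≠ 0) :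
    Y.card ≤ gs.prod.totalDegree + 1 + (Y.offDiag.filter (SameCell gs)).card := by
  set R := (l.restr gs.prod).roots.toFinset with hR
  set r : (Fin 3 → ℝ) → ℕ := fun x => (R.filter fun z => z < x 2).card with hr
  have hlt : ∀ x ∈ Y, r x < gs.prod.totalDegree + 1 := by
    intro x _
    refine Nat.lt_succ_of_le ((Finset.card_le_card (Finset.filter_subset _ _)).trans ?_)
    exact ((Multiset.toFinset_card_le _).trans (Polynomial.card_roots' _)).trans
      (l.natDegree_restr_le _)
  refine (card_le_add_card_offDiag_fibers Y r hlt).trans ?_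
  refine Nat.add_le_add_left (Finset.card_le_card ?_) _
  have key : ∀ x ∈ Y, ∀ y ∈ Y, x 2 < y 2 → r x = r y → SameCell gs (x, y) := by
    intro x hx y hy hxy hrxy
    refine sameCell_of_lt (hY x hx) (hY y hy) hxy fun z hz1 hz2 hz => ?_
    have hzy : z ≠ y 2 := by
      rintro rfl
      rw [l.eval_restr, ← (hY y hy).eq_pt] at hz
      exact hY0 y hy hz
    have hsub : R.filter (fun z => z < x 2) ⊂ R.filter (fun z => z < y 2) := by
      rw [Finset.ssubset_iff_of_subset]
      · refine ⟨z, ?_, ?_⟩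
        · rw [Finset.mem_filter, hR, Multiset.mem_toFinset, Polynomial.mem_roots hl]
          exact ⟨hz, lt_of_le_of_ne hz2 hzy⟩
        · simp [hz1]
      · intro t ht
        rw [Finset.mem_filter] at ht ⊢
        exact ⟨ht.1, ht.2.trans hxy⟩
    exact (Finset.card_lt_card hsub).ne hrxy
  rintro ⟨x, y⟩ hp
  rw [Finset.mem_filter] at hp ⊢
  refine ⟨hp.1, ?_⟩
  obtain ⟨hp, hrxy⟩ := hp
  rw [Finset.mem_offDiag] at hp
  simp only at hp hrxy
  rcases lt_trichotomy (x 2) (y 2) with h | h | h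
  · exact key x hp.1 y hp.2.1 h hrxy
  · exact absurd (by rw [(hY x hp.1).eq_pt, (hY y hp.2.1).eq_pt, h]) hp.2.2
  · exact sameCell_symm (key y hp.2.1 x hp.1 h hrxy.symm)

end Partition

section Structure

open MvPolynomial

/-- The points of `X` on the line `l`. -/
noncomputable def GLine.ptsOn (l : GLine) (X : Finset (Fin 3 → ℝ)) : Finset (Fin 3 → ℝ) :=
  X.filter l.Has

/-- The lines of `L` through the point `x`. -/
noncomputable def linesAt (L : Finset GLine) (x : Fin 3 → ℝ) : Finset GLine :=
  L.filter fun l => l.Has x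

theorem GLine.mem_ptsOn {l : GLine} {X : Finset (Fin 3 → ℝ)} {x : Fin 3 → ℝ} :
    x ∈ l.ptsOn X ↔ x ∈ X ∧ l.Has x := Finset.mem_filter

theorem mem_linesAt {L : Finset GLine} {x : Fin 3 → ℝ} {l : GLine} :
    l ∈ linesAt L x ↔ l ∈ L ∧ l.Has x := Finset.mem_filter

theorem GLine.ptsOn_mono (l : GLine) {X Y : Finset (Fin 3 → ℝ)} (h : X ⊆ Y) :
    l.ptsOn X ⊆ l.ptsOn Y := Finset.filter_subset_filter _ h

theorem linesAt_mono {L M : Finset GLine} (h : L ⊆ M) (x : Fin 3 → ℝ) :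
    linesAt L x ⊆ linesAt M x := Finset.filter_subset_filter _ h

theorem sum_card_ptsOn (L : Finset GLine) (X : Finset (Fin 3 → ℝ)) :
    ∑ l ∈ L, (l.ptsOn X).card = ∑ x ∈ X, (linesAt L x).card :=
  Finset.sum_card_bipartiteAbove_eq_sum_card_bipartiteBelow (fun (l : GLine) x => l.Has x)

/-- The other lines of `M` through distinct points of a line are distinct. -/
theorem sum_card_linesAt_erase_le (l : GLine) (M : Finset GLine) (Y : Finset (Fin 3 → ℝ))
    (hY : ∀ x ∈ Y, l.Has x) : ∑ x ∈ Y, ((linesAt M x).erase l).card ≤ M.card := by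
  rw [← Finset.card_biUnion]
  · refine Finset.card_le_card fun m hm => ?_
    rw [Finset.mem_biUnion] at hm
    obtain ⟨x, -, hm⟩ := hm
    exact (mem_linesAt.1 (Finset.mem_of_mem_erase hm)).1
  · intro x hx y hy hxy
    change Disjoint _ _
    rw [Finset.disjoint_left]
    intro m hm hm'
    rw [Finset.mem_erase, mem_linesAt] at hm hm'
    exact hm.1 (GLine.eq_of_has hxy hm.2.2 hm'.2.2 (hY x hx) (hY y hy))

/-- The first of `f 0, …, f (J - 1)` vanishing on the line, or `J` if there is none. -/
noncomputable def lineIdx (f : ℕ → MvPolynomial (Fin 3) ℝ) (J : ℕ) (l : GLine) : ℕ :=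
  Nat.find (p := fun j => j = J ∨ l.restr (f j) = 0) ⟨J, Or.inl rfl⟩

/-- The first of `f 0, …, f (J - 1)` vanishing at the point, or `J` if there is none. -/
noncomputable def ptIdx (f : ℕ → MvPolynomial (Fin 3) ℝ) (J : ℕ) (x : Fin 3 → ℝ) : ℕ :=
  Nat.find (p := fun j => j = J ∨ eval x (f j) = 0) ⟨J, Or.inl rfl⟩

variable {f : ℕ → MvPolynomial (Fin 3) ℝ} {J : ℕ}

theorem restr_lineIdx {l : GLine} (h : lineIdx f J l < J) : l.restr (f (lineIdx f J l)) = 0 :=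
  (Nat.find_spec (p := fun j => j = J ∨ l.restr (f j) = 0) ⟨J, Or.inl rfl⟩).resolve_left h.ne

theorem restr_ne_zero_of_lt_lineIdx {l : GLine} {j : ℕ} (h : j < lineIdx f J l) :
    l.restr (f j) ≠ 0 := fun h0 =>
  Nat.find_min (p := fun j => j = J ∨ l.restr (f j) = 0) ⟨J, Or.inl rfl⟩ h (Or.inr h0)

theorem lineIdx_le (l : GLine) : lineIdx f J l ≤ J := Nat.find_min' _ (Or.inl rfl)

theorem eval_ptIdx {x : Fin 3 → ℝ} (h : ptIdx f J x < J) : eval x (f (ptIdx f J x)) = 0 :=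
  (Nat.find_spec (p := fun j => j = J ∨ eval x (f j) = 0) ⟨J, Or.inl rfl⟩).resolve_left h.ne

theorem ptIdx_le_lineIdx {l : GLine} {x : Fin 3 → ℝ} (h : l.Has x) :
    ptIdx f J x ≤ lineIdx f J l := by
  refine Nat.find_min' _ ?_
  rcases (lineIdx_le (f := f) (J := J) l).lt_or_eq with h1 | h1
  · exact Or.inr (GLine.eval_eq_zero_of_has (restr_lineIdx h1) h)
  · exact Or.inl h1

theorem ptIdx_lt {x : Fin 3 → ℝ} {j : ℕ} (hj : j < J) (h : eval x (f j) = 0) :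
    ptIdx f J x < J :=
  (Nat.find_min' _ (Or.inr h)).trans_lt hj

theorem lineIdx_lt {l : GLine} {j : ℕ} (hj : j < J) (h : l.restr (f j) = 0) :
    lineIdx f J l < J :=
  (Nat.find_min' _ (Or.inr h)).trans_lt hj

/-- Few points of a line lie on surfaces preceding the one of the line. -/
theorem card_nonaligned_le {D : ℕ}
    (hD : ∑ j ∈ Finset.range J, (f j).totalDegree ≤ D)
    (l : GLine) (Y : Finset (Fin 3 → ℝ))
    (hY : ∀ x ∈ Y, l.Has x ∧ ptIdx f J x < lineIdx f J l) : Y.card ≤ D := by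
  set h := ∏ j ∈ Finset.range (lineIdx f J l), f j with hh
  have hdeg : h.totalDegree ≤ D := by
    refine (totalDegree_finsetProd _ _).trans (le_trans ?_ hD)
    exact Finset.sum_le_sum_of_subset (Finset.range_mono (lineIdx_le l))
  refine (GLine.card_le_of_restr_ne_zero (l := l) (f := h) ?_ Y fun x hx => ⟨(hY x hx).1, ?_⟩).trans
    hdeg
  · rw [hh, map_prod, Finset.prod_ne_zero_iff]
    exact fun j hj => restr_ne_zero_of_lt_lineIdx (Finset.mem_range.1 hj)
  · rw [hh, map_prod]
    exact Finset.prod_eq_zero (Finset.mem_range.2 (hY x hx).2)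
      (eval_ptIdx ((hY x hx).2.trans_le (lineIdx_le l)))

/-- The lines of `L` through `x` lying in the first surface through `x`. -/
noncomputable def alignedAt (f : ℕ → MvPolynomial (Fin 3) ℝ) (J : ℕ) (L : Finset GLine)
    (x : Fin 3 → ℝ) : Finset GLine :=
  (linesAt L x).filter fun l => lineIdx f J l = ptIdx f J x

/-- All but few lines have few crossings inside their surface, when its degree is at least 3. -/
theorem exists_bad_lines (hf : ∀ j < J, Irreducible (f j)) {D : ℕ}
    (hD : ∑ j ∈ Finset.range J, (f j).totalDegree ≤ D) (L : Finset GLine)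
    (X : Finset (Fin 3 → ℝ)) :
    ∃ bad ⊆ L, bad.card ≤ 20 * D ^ 2 ∧ ∀ l ∈ L, l ∉ bad → lineIdx f J l < J →
      3 ≤ (f (lineIdx f J l)).totalDegree →
      ((l.ptsOn X).filter fun x => lineIdx f J l = ptIdx f J x ∧
        2 ≤ (alignedAt f J L x).card).card ≤ 20 * D := by
  set bad := L.filter fun l => lineIdx f J l < J ∧ 3 ≤ (f (lineIdx f J l)).totalDegree ∧
    20 * (f (lineIdx f J l)).totalDegree < ((l.ptsOn X).filter fun x =>
      lineIdx f J l = ptIdx f J x ∧ 2 ≤ (alignedAt f J L x).card).card with hbad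
  have hle : ∀ j ∈ Finset.range J, (f j).totalDegree ≤ D := fun j hj =>
    (Finset.single_le_sum (f := fun j => (f j).totalDegree) (fun _ _ => Nat.zero_le _) hj).trans hD
  refine ⟨bad, Finset.filter_subset _ _, ?_, ?_⟩
  · have hfib : ∀ j ∈ Finset.range J, (bad.filter fun l => lineIdx f J l = j).card ≤
        20 * D * (f j).totalDegree := by
      intro j hj
      have hj' := Finset.mem_range.1 hj
      by_cases hd : 3 ≤ (f j).totalDegree
      · have := card_crossed_lines_le (hf j hj') hd (bad.filter fun l => lineIdx f J l = j) ?_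
        · refine this.trans ?_
          have := Nat.mul_le_mul_right (f j).totalDegree (hle j hj)
          nlinarith
        · intro l hl
          rw [Finset.mem_filter, hbad, Finset.mem_filter] at hl
          obtain ⟨⟨hlL, h1, h2, h3⟩, rfl⟩ := hl
          refine ⟨restr_lineIdx h1, _, h3, fun x hx => ?_⟩
          rw [Finset.mem_filter, GLine.mem_ptsOn] at hx
          obtain ⟨⟨hxX, hlx⟩, hidx, h4⟩ := hx
          refine ⟨hlx, ?_⟩
          obtain ⟨m, hm, hml⟩ := Finset.exists_mem_ne h4 l
          rw [alignedAt, Finset.mem_filter, mem_linesAt] at hm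
          refine ⟨m, hml.symm, ?_, hm.1.2⟩
          have h5 : lineIdx f J m = lineIdx f J l := hm.2.trans hidx.symm
          rw [← h5]
          exact restr_lineIdx (h5 ▸ h1)
      · have : (bad.filter fun l => lineIdx f J l = j) = ∅ := by
          rw [Finset.filter_eq_empty_iff]
          rintro l hl rfl
          rw [hbad, Finset.mem_filter] at hl
          exact hd hl.2.2.1
        rw [this]
        simp
    rw [Finset.card_eq_sum_card_fiberwise (f := lineIdx f J) (t := Finset.range J)]
    · refine (Finset.sum_le_sum hfib).trans ?_
      rw [← Finset.mul_sum]
      calc 20 * D * ∑ j ∈ Finset.range J, (f j).totalDegree ≤ 20 * D * D := by gcongr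
        _ = 20 * D ^ 2 := by ring
    · intro l hl
      rw [hbad, Finset.coe_filter] at hl
      simpa using hl.2.1
  · intro l hl hlb h1 h2
    have h3 : ¬ 20 * (f (lineIdx f J l)).totalDegree < ((l.ptsOn X).filter fun x =>
      lineIdx f J l = ptIdx f J x ∧ 2 ≤ (alignedAt f J L x).card).card := fun h3 =>
      hlb (Finset.mem_filter.2 ⟨hl, h1, h2, h3⟩)
    push Not at h3
    refine h3.trans ?_
    have := hle _ (Finset.mem_range.2 h1)
    gcongr

/-- The number of points of a good line at which at least `p` lines are aligned. -/
theorem card_rich_aligned_le (hf : ∀ j < J, Irreducible (f j)) {D q : ℕ}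
    {L : Finset GLine} {X : Finset (Fin 3 → ℝ)}
    (hq : ∀ F : MvPolynomial (Fin 3) ℝ, Irreducible F → F.totalDegree ≤ 2 →
      (L.filter fun l => l.restr F = 0).card ≤ q) {l : GLine}
    (hl : lineIdx f J l < J)
    (hgood : 3 ≤ (f (lineIdx f J l)).totalDegree →
      ((l.ptsOn X).filter fun x => lineIdx f J l = ptIdx f J x ∧
        2 ≤ (alignedAt f J L x).card).card ≤ 20 * D) {p : ℕ} (hp : 2 ≤ p) :
    p * ((l.ptsOn X).filter fun x => lineIdx f J l = ptIdx f J x ∧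
        p ≤ (alignedAt f J L x).card).card ≤ 20 * D * p + 2 * q := by
  set Y := (l.ptsOn X).filter fun x => lineIdx f J l = ptIdx f J x ∧
        p ≤ (alignedAt f J L x).card with hY
  by_cases hd : 3 ≤ (f (lineIdx f J l)).totalDegree
  · have h1 : Y.card ≤ 20 * D := by
      refine (Finset.card_le_card fun x hx => ?_).trans (hgood hd)
      rw [hY, Finset.mem_filter] at hx
      rw [Finset.mem_filter]
      exact ⟨hx.1, hx.2.1, hp.trans hx.2.2⟩
    calc p * Y.card ≤ p * (20 * D) := by gcongr
      _ ≤ 20 * D * p + 2 * q := by nlinarith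
  · set M := L.filter fun m => m.restr (f (lineIdx f J l)) = 0 with hM
    have h1 : M.card ≤ q := hq _ (hf _ hl) (by lia)
    have h2 := sum_card_linesAt_erase_le l M Y fun x hx =>
      (GLine.mem_ptsOn.1 (Finset.mem_filter.1 hx).1).2
    have h3 : ∀ x ∈ Y, p ≤ 2 * ((linesAt M x).erase l).card := by
      intro x hx
      rw [hY, Finset.mem_filter] at hx
      have h4 : (alignedAt f J L x).erase l ⊆ (linesAt M x).erase l := by
        refine Finset.erase_subset_erase _ fun m hm => ?_
        rw [alignedAt, Finset.mem_filter, mem_linesAt] at hm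
        have h5 : lineIdx f J m = lineIdx f J l := hm.2.trans hx.2.1.symm
        rw [mem_linesAt, hM, Finset.mem_filter, ← h5]
        exact ⟨⟨hm.1.1, restr_lineIdx (h5 ▸ hl)⟩, hm.1.2⟩
      have h6 := Finset.card_le_card h4
      have h7 := Finset.pred_card_le_card_erase (s := alignedAt f J L x) (a := l)
      have := hx.2.2
      lia
    have h8 : Y.card * p ≤ ∑ x ∈ Y, 2 * ((linesAt M x).erase l).card := by
      rw [← smul_eq_mul]
      exact Finset.card_nsmul_le_sum _ _ _ h3
    rw [← Finset.mul_sum] at h8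
    lia

/-- A nonzero polynomial has the same zeros as a finite sequence of irreducible polynomials. -/
theorem exists_irreducible_sequence {g : MvPolynomial (Fin 3) ℝ} (hg : g ≠ 0) :
    ∃ (f : ℕ → MvPolynomial (Fin 3) ℝ) (J : ℕ), (∀ j < J, Irreducible (f j)) ∧
      ∑ j ∈ Finset.range J, (f j).totalDegree ≤ g.totalDegree ∧
      (∀ x, ptIdx f J x < J ↔ eval x g = 0) ∧ ∀ l : GLine, lineIdx f J l < J ↔ l.restr g = 0 := by
  set fs := (UniqueFactorizationMonoid.factors g).toList with hfs
  have hassoc : Associated fs.prod g := by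
    rw [hfs, Multiset.prod_toList]
    exact UniqueFactorizationMonoid.factors_prod hg
  have hirr : ∀ p ∈ fs, Irreducible p := fun p hp =>
    UniqueFactorizationMonoid.irreducible_of_factor p (Multiset.mem_toList.1 hp)
  set f : ℕ → MvPolynomial (Fin 3) ℝ := fun j => fs.getD j 0 with hf
  have hget : ∀ j (hj : j < fs.length), f j = fs[j] := fun j hj => by
    simp [hf, hj]
  have hprod : fs.prod = ∏ j ∈ Finset.range fs.length, f j := by
    rw [← Fin.prod_univ_getElem, Finset.prod_range]
    exact Finset.prod_congr rfl fun i _ => (hget i i.2).symm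
  have hirrf : ∀ j < fs.length, Irreducible (f j) := fun j hj => by
    rw [hget j hj]
    exact hirr _ (List.getElem_mem hj)
  obtain ⟨u, hu⟩ := hassoc
  have hgu : g = (∏ j ∈ Finset.range fs.length, f j) * u := by rw [← hprod, hu]
  refine ⟨f, fs.length, hirrf, ?_, fun x => ⟨fun h => ?_, fun h => ?_⟩,
    fun l => ⟨fun h => ?_, fun h => ?_⟩⟩
  · have h0 : ∏ j ∈ Finset.range fs.length, f j ≠ 0 :=
      Finset.prod_ne_zero_iff.2 fun j hj => (hirrf j (Finset.mem_range.1 hj)).ne_zero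
    have h1 : ∀ J ≤ fs.length, ∑ j ∈ Finset.range J, (f j).totalDegree =
        (∏ j ∈ Finset.range J, f j).totalDegree := by
      intro J
      induction J with
      | zero => simp
      | succ J ih =>
        intro hJ
        rw [Finset.sum_range_succ, Finset.prod_range_succ, ih (by lia),
          totalDegree_mul_of_isDomain]
        · exact Finset.prod_ne_zero_iff.2 fun j hj =>
            (hirrf j (by have := Finset.mem_range.1 hj; lia)).ne_zero
        · exact (hirrf J (by lia)).ne_zero
    rw [h1 _ le_rfl, hgu, totalDegree_mul_of_isDomain h0 u.ne_zero]
    exact Nat.le_add_right _ _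
  · rw [hgu, map_mul, map_prod, Finset.prod_eq_zero (Finset.mem_range.2 h) (eval_ptIdx h), zero_mul]
  · rw [hgu, map_mul, map_prod] at h
    have hu0 : eval x (u : MvPolynomial (Fin 3) ℝ) ≠ 0 := (u.isUnit.map (eval x)).ne_zero
    have h1 := (mul_eq_zero.1 h).resolve_right hu0
    obtain ⟨j, hj, h2⟩ := Finset.prod_eq_zero_iff.1 h1
    exact ptIdx_lt (Finset.mem_range.1 hj) h2
  · rw [hgu, map_mul, map_prod, Finset.prod_eq_zero (Finset.mem_range.2 h) (restr_lineIdx h),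
      zero_mul]
  · rw [hgu, map_mul, map_prod] at h
    have hu0 : l.restr (u : MvPolynomial (Fin 3) ℝ) ≠ 0 := (u.isUnit.map l.restr).ne_zero
    have h1 := (mul_eq_zero.1 h).resolve_right hu0
    obtain ⟨j, hj, h2⟩ := Finset.prod_eq_zero_iff.1 h1
    exact lineIdx_lt (Finset.mem_range.1 hj) h2

end Structure

section Partitioning

open MvPolynomial

/-- Incidences off the partitioning surface. -/
theorem sum_card_off_zeros_le {gs : List (MvPolynomial (Fin 3) ℝ)} {D : ℕ}
    (hD : gs.prod.totalDegree ≤ D) (L : Finset GLine) (X : Finset (Fin 3 → ℝ)) :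
    ∑ l ∈ L, ((l.ptsOn X).filter fun x => eval x gs.prod ≠ 0).card ≤
      L.card * (D + 1) + ((X ×ˢ X).filter (SameCell gs)).card := by
  set Y : GLine → Finset (Fin 3 → ℝ) := fun l =>
    (l.ptsOn X).filter fun x => eval x gs.prod ≠ 0 with hY
  have hYl : ∀ l x, x ∈ Y l → l.Has x := fun l x hx =>
    (GLine.mem_ptsOn.1 (Finset.mem_filter.1 hx).1).2
  have hYX : ∀ l x, x ∈ Y l → x ∈ X := fun l x hx =>
    (GLine.mem_ptsOn.1 (Finset.mem_filter.1 hx).1).1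
  have h1 : ∀ l ∈ L, (Y l).card ≤ D + 1 + ((Y l).offDiag.filter (SameCell gs)).card := by
    intro l _
    by_cases hl : l.restr gs.prod = 0
    · have : Y l = ∅ := Finset.filter_eq_empty_iff.2 fun x hx h =>
        h (GLine.eval_eq_zero_of_has hl (GLine.mem_ptsOn.1 hx).2)
      rw [this]
      simp
    · refine (card_le_of_restr_prod_ne_zero hl (Y l) (hYl l) fun x hx =>
        (Finset.mem_filter.1 hx).2).trans ?_
      gcongr
  refine (Finset.sum_le_sum h1).trans ?_
  rw [Finset.sum_add_distrib, Finset.sum_const, smul_eq_mul, ← Finset.card_biUnion]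
  · gcongr
    intro p hp
    rw [Finset.mem_biUnion] at hp
    obtain ⟨l, -, hp⟩ := hp
    rw [Finset.mem_filter, Finset.mem_offDiag] at hp
    rw [Finset.mem_filter, Finset.mem_product]
    exact ⟨⟨hYX l _ hp.1.1, hYX l _ hp.1.2.1⟩, hp.2⟩
  · intro l _ m _ hlm
    change Disjoint _ _
    rw [Finset.disjoint_left]
    intro p hp hp'
    rw [Finset.mem_filter, Finset.mem_offDiag] at hp hp'
    exact hlm (GLine.eq_of_has hp.1.2.2 (hYl l _ hp.1.1) (hYl l _ hp.1.2.1) (hYl m _ hp'.1.1)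
      (hYl m _ hp'.1.2.1))

theorem sum_card_ptsOn_filter (L : Finset GLine) (X : Finset (Fin 3 → ℝ))
    (R : GLine → (Fin 3 → ℝ) → Prop) [∀ l x, Decidable (R l x)] :
    ∑ l ∈ L, ((l.ptsOn X).filter (R l)).card =
      ∑ x ∈ X, ((linesAt L x).filter fun l => R l x).card := by
  have := Finset.sum_card_bipartiteAbove_eq_sum_card_bipartiteBelow (s := L) (t := X)
    (fun (l : GLine) x => l.Has x ∧ R l x)
  simpa only [Finset.bipartiteAbove, Finset.bipartiteBelow, GLine.ptsOn, linesAt,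
    Finset.filter_filter] using! this

variable {f : ℕ → MvPolynomial (Fin 3) ℝ} {J : ℕ}

/-- Incidences at points with a single aligned line. -/
theorem sum_card_single_aligned_le (L : Finset GLine) (X : Finset (Fin 3 → ℝ)) :
    ∑ l ∈ L, ((l.ptsOn X).filter fun x => lineIdx f J l = ptIdx f J x ∧
      (alignedAt f J L x).card < 2).card ≤ X.card := by
  rw [sum_card_ptsOn_filter L X fun l x => lineIdx f J l = ptIdx f J x ∧
      (alignedAt f J L x).card < 2, Finset.card_eq_sum_ones]
  refine Finset.sum_le_sum fun x _ => ?_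
  by_cases h : (alignedAt f J L x).card < 2
  · simp only [h, and_true]
    rw [alignedAt] at h
    lia
  · simp [h]

/-- Incidences with aligned lines lying in planes and quadrics. -/
theorem sum_card_low_aligned_sq_le (hf : ∀ j < J, Irreducible (f j)) {q : ℕ}
    {L : Finset GLine}
    (hq : ∀ F : MvPolynomial (Fin 3) ℝ, Irreducible F → F.totalDegree ≤ 2 →
      (L.filter fun l => l.restr F = 0).card ≤ q) (X : Finset (Fin 3 → ℝ)) :
    (∑ l ∈ L, ((l.ptsOn X).filter fun x => lineIdx f J l = ptIdx f J x ∧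
        lineIdx f J l < J ∧ (f (lineIdx f J l)).totalDegree ≤ 2).card) ^ 2 ≤
      X.card * (∑ l ∈ L, ((l.ptsOn X).filter fun x => lineIdx f J l = ptIdx f J x ∧
        lineIdx f J l < J ∧ (f (lineIdx f J l)).totalDegree ≤ 2).card + L.card * q) := by
  set R : GLine → (Fin 3 → ℝ) → Prop := fun l x => lineIdx f J l = ptIdx f J x ∧
        lineIdx f J l < J ∧ (f (lineIdx f J l)).totalDegree ≤ 2 with hR
  set low : (Fin 3 → ℝ) → Finset GLine := fun x => (linesAt L x).filter fun l => R l x with hlow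
  have hsum := sum_card_ptsOn_filter L X R
  have hcs : (∑ l ∈ L, ((l.ptsOn X).filter (R l)).card) ^ 2 ≤
      X.card * ∑ x ∈ X, (low x).card ^ 2 := by
    rw [hsum]
    exact sq_sum_le_card_mul_sum_sq
  refine hcs.trans (Nat.mul_le_mul_left _ ?_)
  have hdouble : ∑ x ∈ X, (low x).card ^ 2 =
      ∑ l ∈ L, ∑ x ∈ (l.ptsOn X).filter (R l), (low x).card := by
    have h1 : ∀ x ∈ X, (low x).card ^ 2 = ∑ l ∈ low x, (low x).card := fun x _ => by
      rw [Finset.sum_const, smul_eq_mul, sq]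
    rw [Finset.sum_congr rfl h1]
    refine Finset.sum_comm' fun x l => ?_
    simp only [hlow, Finset.mem_filter, mem_linesAt, GLine.mem_ptsOn]
    tauto
  rw [hdouble]
  calc ∑ l ∈ L, ∑ x ∈ (l.ptsOn X).filter (R l), (low x).card
      ≤ ∑ l ∈ L, (((l.ptsOn X).filter (R l)).card + q) := by
        refine Finset.sum_le_sum fun l _ => ?_
        rcases ((l.ptsOn X).filter (R l)).eq_empty_or_nonempty with h0 | ⟨y, hy⟩
        · simp [h0]
        have hyR : R l y := (Finset.mem_filter.1 hy).2
        set M := L.filter fun m => m.restr (f (lineIdx f J l)) = 0 with hM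
        have hMq : M.card ≤ q := hq _ (hf _ hyR.2.1) hyR.2.2
        have h2 := sum_card_linesAt_erase_le l M ((l.ptsOn X).filter (R l)) fun x hx =>
          (GLine.mem_ptsOn.1 (Finset.mem_filter.1 hx).1).2
        have h3 : ∀ x ∈ (l.ptsOn X).filter (R l),
            (low x).card ≤ 1 + ((linesAt M x).erase l).card := by
          intro x hx
          have hxR : R l x := (Finset.mem_filter.1 hx).2
          have h4 : low x ⊆ linesAt M x := by
            intro m hm
            rw [hlow, Finset.mem_filter, mem_linesAt] at hm
            have h5 : lineIdx f J m = lineIdx f J l := hm.2.1.trans hxR.1.symm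
            rw [mem_linesAt, hM, Finset.mem_filter, ← h5]
            exact ⟨⟨hm.1.1, restr_lineIdx hm.2.2.1⟩, hm.1.2⟩
          have h6 := Finset.card_le_card h4
          have h7 := Finset.pred_card_le_card_erase (s := linesAt M x) (a := l)
          lia
        refine (Finset.sum_le_sum h3).trans ?_
        rw [Finset.sum_add_distrib, Finset.sum_const, smul_eq_mul, mul_one]
        lia
    _ = ∑ l ∈ L, ((l.ptsOn X).filter (R l)).card + L.card * q := by
        rw [Finset.sum_add_distrib, Finset.sum_const, smul_eq_mul]

/-- An incidence bound valid outside of a small family of lines. -/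
theorem exists_incidence_bound : ∃ K : ℝ, 1 ≤ K ∧ ∀ (L : Finset GLine) (q : ℕ)
    (X : Finset (Fin 3 → ℝ)) (D : ℕ), 1 ≤ D →
    (∀ F : MvPolynomial (Fin 3) ℝ, Irreducible F → F.totalDegree ≤ 2 →
      (L.filter fun l => l.restr F = 0).card ≤ q) →
    ∃ bad ⊆ L, (bad.card : ℝ) ≤ K * D ^ 2 ∧
      (∑ l ∈ L \ bad, ((l.ptsOn X).card : ℝ)) ≤
        K * (X.card + L.card * D + X.card ^ 2 / D ^ 3) + √(X.card * L.card * q) := by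
  obtain ⟨K, hK0, hK⟩ := exists_partition
  refine ⟨K + 1280, by linarith, fun L q X D hD1 hq => ?_⟩
  obtain ⟨gs, hgs0, hgsD, hcell⟩ := hK X D hD1
  have hg0 : gs.prod ≠ 0 := List.prod_ne_zero fun h => hgs0 0 h rfl
  have hgD : gs.prod.totalDegree ≤ 8 * D := (totalDegree_list_prod gs).trans hgsD
  obtain ⟨f, J, hf, hsum, hpt, hln⟩ := exists_irreducible_sequence hg0
  have hfD := hsum.trans hgD
  obtain ⟨bad, hbL, hbc, hgood⟩ := exists_bad_lines hf hfD L X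
  set low : GLine → ℕ := fun l => ((l.ptsOn X).filter fun x => lineIdx f J l = ptIdx f J x ∧
        lineIdx f J l < J ∧ (f (lineIdx f J l)).totalDegree ≤ 2).card with hlow
  set single : GLine → ℕ := fun l => ((l.ptsOn X).filter fun x => lineIdx f J l = ptIdx f J x ∧
      (alignedAt f J L x).card < 2).card with hsingle
  set off : GLine → ℕ := fun l => ((l.ptsOn X).filter fun x => eval x gs.prod ≠ 0).card with hoff
  have hline : ∀ l ∈ L \ bad, (l.ptsOn X).card ≤ off l + single l + low l + 168 * D := by
    intro l hl
    rw [Finset.mem_sdiff] at hl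
    set non := (l.ptsOn X).filter fun x => ptIdx f J x < lineIdx f J l with hnon
    have hnonc : non.card ≤ 8 * D := card_nonaligned_le hfD l non fun x hx => by
      rw [hnon, Finset.mem_filter, GLine.mem_ptsOn] at hx
      exact ⟨hx.1.2, hx.2⟩
    set high := (l.ptsOn X).filter fun x => (lineIdx f J l < J ∧
      3 ≤ (f (lineIdx f J l)).totalDegree) ∧ lineIdx f J l = ptIdx f J x ∧
      2 ≤ (alignedAt f J L x).card with hhigh
    have hhighc : high.card ≤ 160 * D := by
      by_cases h : lineIdx f J l < J ∧ 3 ≤ (f (lineIdx f J l)).totalDegree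
      · have := hgood l hl.1 hl.2 h.1 h.2
        simp only [hhigh, h, true_and, and_self]
        lia
      · simp [hhigh, h]
    have hcover : l.ptsOn X ⊆ ((l.ptsOn X).filter fun x => eval x gs.prod ≠ 0) ∪
        ((l.ptsOn X).filter fun x => lineIdx f J l = ptIdx f J x ∧
          (alignedAt f J L x).card < 2) ∪
        ((l.ptsOn X).filter fun x => lineIdx f J l = ptIdx f J x ∧
          lineIdx f J l < J ∧ (f (lineIdx f J l)).totalDegree ≤ 2) ∪ non ∪ high := by
      intro x hx
      have h1 := hpt x
      have h2 := ptIdx_le_lineIdx (f := f) (J := J) (GLine.mem_ptsOn.1 hx).2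
      simp only [Finset.mem_union, hnon, hhigh, Finset.mem_filter, hx, true_and]
      by_cases h3 : eval x gs.prod = 0
      · have h4 := h1.2 h3
        rcases h2.lt_or_eq with h5 | h5
        · tauto
        · have h6 : lineIdx f J l < J := h5 ▸ h4
          rcases lt_or_ge (alignedAt f J L x).card 2 with h7 | h7 <;>
          rcases lt_or_ge (f (lineIdx f J l)).totalDegree 3 with h8 | h8
          · exact Or.inl (Or.inl (Or.inl (Or.inr ⟨h5.symm, h7⟩)))
          · exact Or.inl (Or.inl (Or.inl (Or.inr ⟨h5.symm, h7⟩)))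
          · exact Or.inl (Or.inl (Or.inr ⟨h5.symm, h6, by lia⟩))
          · exact Or.inr ⟨⟨h6, h8⟩, h5.symm, h7⟩
      · exact Or.inl (Or.inl (Or.inl (Or.inl h3)))
    have h1 := Finset.card_le_card hcover
    have h2 := Finset.card_union_le (((l.ptsOn X).filter fun x => eval x gs.prod ≠ 0) ∪
        ((l.ptsOn X).filter fun x => lineIdx f J l = ptIdx f J x ∧
          (alignedAt f J L x).card < 2) ∪
        ((l.ptsOn X).filter fun x => lineIdx f J l = ptIdx f J x ∧
          lineIdx f J l < J ∧ (f (lineIdx f J l)).totalDegree ≤ 2) ∪ non) high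
    have h3 := Finset.card_union_le (((l.ptsOn X).filter fun x => eval x gs.prod ≠ 0) ∪
        ((l.ptsOn X).filter fun x => lineIdx f J l = ptIdx f J x ∧
          (alignedAt f J L x).card < 2) ∪
        ((l.ptsOn X).filter fun x => lineIdx f J l = ptIdx f J x ∧
          lineIdx f J l < J ∧ (f (lineIdx f J l)).totalDegree ≤ 2)) non
    have h4 := Finset.card_union_le (((l.ptsOn X).filter fun x => eval x gs.prod ≠ 0) ∪
        ((l.ptsOn X).filter fun x => lineIdx f J l = ptIdx f J x ∧
          (alignedAt f J L x).card < 2))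
        ((l.ptsOn X).filter fun x => lineIdx f J l = ptIdx f J x ∧
          lineIdx f J l < J ∧ (f (lineIdx f J l)).totalDegree ≤ 2)
    have h5 := Finset.card_union_le ((l.ptsOn X).filter fun x => eval x gs.prod ≠ 0)
        ((l.ptsOn X).filter fun x => lineIdx f J l = ptIdx f J x ∧
          (alignedAt f J L x).card < 2)
    simp only [hoff, hsingle, hlow]
    lia
  refine ⟨bad, hbL, ?_, ?_⟩
  · have h1 : (bad.card : ℝ) ≤ 20 * (8 * D) ^ 2 := by exact_mod_cast hbc
    nlinarith [sq_nonneg (D : ℝ)]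
  have htot : ∑ l ∈ L \ bad, (l.ptsOn X).card ≤
      ∑ l ∈ L, off l + ∑ l ∈ L, single l + ∑ l ∈ L, low l + L.card * (168 * D) := by
    refine (Finset.sum_le_sum hline).trans ((Finset.sum_le_sum_of_subset
      Finset.sdiff_subset).trans_eq ?_)
    simp only [Finset.sum_add_distrib, Finset.sum_const, smul_eq_mul]
  have hoffb : ∑ l ∈ L, off l ≤ L.card * (8 * D + 1) + ((X ×ˢ X).filter (SameCell gs)).card :=
    sum_card_off_zeros_le hgD L X
  have hsingleb : ∑ l ∈ L, single l ≤ X.card := sum_card_single_aligned_le L X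
  have hlowb : (∑ l ∈ L, low l) ^ 2 ≤ X.card * (∑ l ∈ L, low l + L.card * q) :=
    sum_card_low_aligned_sq_le hf hq X
  set T := ∑ l ∈ L, low l with hT
  have hlowb' : (T : ℝ) ^ 2 ≤ X.card * (T + L.card * q) := by exact_mod_cast hlowb
  have hTb : (T : ℝ) ≤ X.card + √(X.card * L.card * q) := by
    by_contra! h
    have h1 := Real.sqrt_nonneg ((X.card : ℝ) * L.card * q)
    have h2 := Real.sq_sqrt (show 0 ≤ (X.card : ℝ) * L.card * q by positivity)
    have h3 : (0 : ℝ) ≤ X.card := Nat.cast_nonneg _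
    nlinarith
  have hR : ((∑ l ∈ L \ bad, (l.ptsOn X).card : ℕ) : ℝ) ≤
      L.card * (8 * D + 1) + ((X ×ˢ X).filter (SameCell gs)).card + X.card + T +
        L.card * (168 * D) := by
    exact_mod_cast htot.trans (by lia)
  push_cast at hR
  refine hR.trans ?_
  have hD1' : (1 : ℝ) ≤ D := by exact_mod_cast hD1
  have h4 : (0 : ℝ) ≤ X.card := Nat.cast_nonneg _
  have h5 : (L.card : ℝ) ≤ L.card * D := le_mul_of_one_le_right (Nat.cast_nonneg _) hD1'
  have h6 : (0 : ℝ) ≤ L.card * D := by positivity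
  have h7 : (0 : ℝ) ≤ (X.card : ℝ) ^ 2 / D ^ 3 := by positivity
  have h8 : K * X.card ^ 2 / D ^ 3 = K * ((X.card : ℝ) ^ 2 / D ^ 3) := by ring
  rw [h8] at hcell
  nlinarith [mul_nonneg hK0 h4, mul_nonneg hK0 h6]

end Partitioning

section Greedy

open MvPolynomial

/-- The points at which all polynomials of degree at most `D` vanishing on the lines of `B`
vanish. -/
def InHull (D : ℕ) (B : Finset GLine) (x : Fin 3 → ℝ) : Prop :=
  ∀ g : MvPolynomial (Fin 3) ℝ, g.totalDegree ≤ D → (∀ l ∈ B, l.restr g = 0) → eval x g = 0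

theorem InHull.mono {D : ℕ} {B C : Finset GLine} (h : B ⊆ C) {x : Fin 3 → ℝ}
    (hx : InHull D B x) : InHull D C x := fun g hg hgC => hx g hg fun l hl => hgC l (h hl)

theorem inHull_of_has {D : ℕ} {B : Finset GLine} {b : GLine} (hb : b ∈ B) {x : Fin 3 → ℝ}
    (hx : b.Has x) : InHull D B x := fun _ _ hg => GLine.eval_eq_zero_of_has (hg b hb) hx

/-- If every line of `A` carries many points rich in lines of `L`, then most of `A` lies in a
surface of low degree. -/
theorem exists_low_degree_surface (L A : Finset GLine) (T : GLine → Finset (Fin 3 → ℝ))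
    {t k D : ℕ} (hk : 2 ≤ k) (ht : 1 ≤ t) (hDt : 2 * D ≤ t)
    (hT : ∀ l ∈ A, t ≤ (T l).card ∧ ∀ x ∈ T l, l.Has x ∧ k ≤ (linesAt L x).card)
    (hL : 96 * L.card ≤ (D + 2) * (t * k)) :
    ∃ f : MvPolynomial (Fin 3) ℝ, f ≠ 0 ∧ f.totalDegree ≤ D ∧
      4 * (A.filter fun l => l.restr f ≠ 0).card ≤ A.card := by
  rcases A.eq_empty_or_nonempty with rfl | hA
  · exact ⟨1, one_ne_zero, by simp, by simp⟩
  have htk : 0 < t * k := by positivity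
  set φ : Finset GLine → ℕ := fun B =>
    ∑ l ∈ A, min (D + 1) ((T l).filter (InHull D B)).card with hφ
  obtain ⟨B, hB, hmax⟩ := Finset.exists_max_image
    (L.powerset.filter fun B => A.card * (t * k) * B.card ≤ 16 * L.card * φ B) Finset.card
    ⟨∅, by simp⟩
  rw [Finset.mem_filter, Finset.mem_powerset] at hB
  have hφle : φ B ≤ A.card * (D + 1) := by
    rw [← smul_eq_mul, ← Finset.sum_const]
    exact Finset.sum_le_sum fun l _ => min_le_left _ _
  have hBcard : 6 * B.card < (D + 2) * (D + 3) := by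
    have h1 : A.card * (t * k) * B.card ≤ A.card * (16 * L.card * (D + 1)) :=
      hB.2.trans ((Nat.mul_le_mul_left _ hφle).trans_eq (by ring))
    have h2 : t * k * B.card ≤ 16 * L.card * (D + 1) :=
      Nat.le_of_mul_le_mul_left (by rwa [mul_assoc] at h1) hA.card_pos
    have h3 : t * k * (6 * B.card) ≤ t * k * ((D + 2) * (D + 1)) := by
      have := Nat.mul_le_mul_right (D + 1) hL
      linarith
    have h4 := Nat.le_of_mul_le_mul_left h3 htk
    nlinarith
  obtain ⟨f, hf0, hfD, hfB⟩ := exists_vanishing_on_lines B D hBcard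
  refine ⟨f, hf0, hfD, ?_⟩
  by_contra! hcon
  set A' := A.filter fun l => l.restr f ≠ 0 with hA'
  set G : GLine → ℕ := fun b => (A'.filter fun l => ∃ x ∈ T l, ¬ InHull D B x ∧ b.Has x).card
    with hG
  have hfew : ∀ l ∈ A', ((T l).filter (InHull D B)).card ≤ D := by
    intro l hl
    rw [hA', Finset.mem_filter] at hl
    refine (GLine.card_le_of_restr_ne_zero hl.2 _ fun x hx => ?_).trans hfD
    rw [Finset.mem_filter] at hx
    exact ⟨((hT l hl.1).2 x hx.1).1, hx.2 f hfD hfB⟩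
  have hgain : ∀ b, φ B + G b ≤ φ (insert b B) := by
    intro b
    have h1 : G b = ∑ l ∈ A, if l ∈ A' ∧ ∃ x ∈ T l, ¬ InHull D B x ∧ b.Has x then 1 else 0 := by
      rw [← Finset.sum_filter, ← Finset.card_eq_sum_ones]
      refine congrArg Finset.card (Finset.ext fun l => ?_)
      simp only [Finset.mem_filter, hA']
      tauto
    rw [h1, hφ, ← Finset.sum_add_distrib]
    refine Finset.sum_le_sum fun l _ => ?_
    have hsub : (T l).filter (InHull D B) ⊆ (T l).filter (InHull D (insert b B)) :=
      Finset.monotone_filter_right _ fun x _ hx => hx.mono (Finset.subset_insert _ _)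
    split_ifs with h
    · obtain ⟨hl, x, hx, hxB, hbx⟩ := h
      have h2 : ((T l).filter (InHull D B)).card < ((T l).filter (InHull D (insert b B))).card := by
        refine Finset.card_lt_card ((Finset.ssubset_iff_of_subset hsub).2 ⟨x, ?_, ?_⟩)
        · exact Finset.mem_filter.2 ⟨hx, inHull_of_has (Finset.mem_insert_self _ _) hbx⟩
        · exact fun h => hxB (Finset.mem_filter.1 h).2
      have h3 := hfew l hl
      lia
    · have := Finset.card_le_card hsub
      lia
  have hstep : ∀ b ∈ L, 16 * L.card * G b ≤ A.card * (t * k) := by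
    intro b hb
    by_contra! h
    have hbB : b ∉ B := by
      intro hbB
      have h1 := hgain b
      rw [Finset.insert_eq_of_mem hbB] at h1
      have h2 : G b = 0 := by lia
      rw [h2] at h
      lia
    have hins := hmax (insert b B) (Finset.mem_filter.2 ⟨Finset.mem_powerset.2
      (Finset.insert_subset hb hB.1), ?_⟩)
    · rw [Finset.card_insert_of_notMem hbB] at hins
      lia
    · rw [Finset.card_insert_of_notMem hbB]
      have := Nat.mul_le_mul_left (16 * L.card) (hgain b)
      have := hB.2
      linarith
  have hlow : ∀ l ∈ A', t * k ≤ 4 * (L.filter fun b => ∃ x ∈ T l, ¬ InHull D B x ∧ b.Has x).card := by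
    intro l hl
    have hlA := (Finset.mem_filter.1 hl).1
    set M := L.filter fun b => ∃ x ∈ T l, ¬ InHull D B x ∧ b.Has x with hM
    set Y := (T l).filter fun x => ¬ InHull D B x with hY
    have h1 := sum_card_linesAt_erase_le l M Y fun x hx =>
      ((hT l hlA).2 x (Finset.mem_filter.1 hx).1).1
    have h2 : ∀ x ∈ Y, k - 1 ≤ ((linesAt M x).erase l).card := by
      intro x hx
      rw [hY, Finset.mem_filter] at hx
      have h3 : linesAt L x ⊆ linesAt M x := by
        intro b hb
        rw [mem_linesAt] at hb
        rw [mem_linesAt, hM, Finset.mem_filter]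
        exact ⟨⟨hb.1, x, hx.1, hx.2, hb.2⟩, hb.2⟩
      have h4 := Finset.card_le_card h3
      have h5 := Finset.pred_card_le_card_erase (s := linesAt M x) (a := l)
      have h6 := ((hT l hlA).2 x hx.1).2
      lia
    have h3 := Finset.card_nsmul_le_sum _ _ _ h2
    rw [smul_eq_mul] at h3
    have h4 := Finset.card_filter_add_card_filter_not (s := T l) (InHull D B)
    have h5 := hfew l hl
    have h6 := (hT l hlA).1
    have h7 : t ≤ 2 * Y.card := by lia
    have h8 : k ≤ 2 * (k - 1) := by lia
    have h9 := Nat.mul_le_mul h7 h8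
    nlinarith
  have hswap : ∑ b ∈ L, G b =
      ∑ l ∈ A', (L.filter fun b => ∃ x ∈ T l, ¬ InHull D B x ∧ b.Has x).card := by
    simp only [hG, Finset.card_filter]
    exact Finset.sum_comm
  have hsum1 : A'.card * (t * k) ≤ 4 * ∑ b ∈ L, G b := by
    rw [hswap, Finset.mul_sum, ← smul_eq_mul]
    exact Finset.card_nsmul_le_sum _ _ _ hlow
  have hsum2 : L.card * (16 * ∑ b ∈ L, G b) ≤ L.card * (A.card * (t * k)) := by
    have := Finset.sum_le_card_nsmul _ _ _ hstep
    rw [← Finset.mul_sum, smul_eq_mul] at this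
    linarith
  have hlt : A.card * (t * k) < 16 * ∑ b ∈ L, G b := by
    have := Nat.mul_lt_mul_of_pos_right hcon htk
    linarith
  have hLpos : 0 < L.card := Nat.pos_of_ne_zero fun h => by
    rw [Finset.card_eq_zero.1 h, Finset.sum_empty] at hlt
    exact Nat.not_lt_zero _ hlt
  exact absurd (Nat.le_of_mul_le_mul_left hsum2 hLpos) (not_le.2 hlt)

end Greedy

section Algebraic

open MvPolynomial

/-- The structure of lines and points on a surface: the relation `R` holds when the line and the
point belong to the same component. -/
theorem exists_aligned_relation {L : Finset GLine} {q : ℕ}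
    (hq : ∀ F : MvPolynomial (Fin 3) ℝ, Irreducible F → F.totalDegree ≤ 2 →
      (L.filter fun l => l.restr F = 0).card ≤ q)
    {X : Finset (Fin 3 → ℝ)} {k : ℕ} (hk : 2 ≤ k) (hX : ∀ x ∈ X, k ≤ (linesAt L x).card)
    {f : MvPolynomial (Fin 3) ℝ} (hf0 : f ≠ 0) {D : ℕ} (hfD : f.totalDegree ≤ D) :
    ∃ Y ⊆ X, k * Y.card ≤ 2 * (L.card * D) ∧ ∃ bad ⊆ L, bad.card ≤ 20 * D ^ 2 ∧
      ∃ R : GLine → (Fin 3 → ℝ) → Prop, ∀ l ∈ L \ bad, l.restr f = 0 →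
        k * (l.ptsOn (X \ Y)).card ≤ 21 * D * k + 4 * q ∧
        ((l.ptsOn X).filter fun x => ¬ R l x).card ≤ D ∧
        ∀ p, 2 ≤ p → p * ((l.ptsOn X).filter fun x => R l x ∧
          p ≤ ((linesAt L x).filter fun m => R m x).card).card ≤ 20 * D * p + 2 * q := by
  obtain ⟨g, J, hg, hsum, hpt, hln⟩ := exists_irreducible_sequence hf0
  have hgD := hsum.trans hfD
  obtain ⟨bad, hbL, hbc, hgood⟩ := exists_bad_lines hg hgD L X
  set R : GLine → (Fin 3 → ℝ) → Prop := fun l x => lineIdx g J l = ptIdx g J x with hR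
  have hnon : ∀ l : GLine, ((l.ptsOn X).filter fun x => ¬ R l x).card ≤ D := by
    refine fun l => card_nonaligned_le hgD l _ fun x hx => ?_
    rw [Finset.mem_filter, GLine.mem_ptsOn] at hx
    exact ⟨hx.1.2, (ptIdx_le_lineIdx hx.1.2).lt_of_ne fun h => hx.2 h.symm⟩
  have hrich : ∀ l ∈ L \ bad, l.restr f = 0 → ∀ p, 2 ≤ p →
      p * ((l.ptsOn X).filter fun x => R l x ∧
        p ≤ ((linesAt L x).filter fun m => R m x).card).card ≤ 20 * D * p + 2 * q := by
    intro l hl hlf p hp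
    rw [Finset.mem_sdiff] at hl
    have hl' := (hln l).2 hlf
    exact card_rich_aligned_le hg hq hl' (hgood l hl.1 hl.2 hl') hp
  set Y := X.filter fun x =>
    (linesAt L x).card ≤ 2 * ((linesAt L x).filter fun l => ¬ R l x).card with hY
  refine ⟨Y, Finset.filter_subset _ _, ?_, bad, hbL, hbc, R, fun l hl hlf =>
    ⟨?_, by convert hnon l, by convert hrich l hl hlf⟩⟩
  · have h1 : ∀ x ∈ Y, k ≤ 2 * ((linesAt L x).filter fun l => ¬ R l x).card := fun x hx => by
      rw [hY, Finset.mem_filter] at hx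
      exact (hX x hx.1).trans hx.2
    have h2 := Finset.card_nsmul_le_sum _ _ _ h1
    have h3 : ∑ x ∈ Y, ((linesAt L x).filter fun l => ¬ R l x).card ≤ L.card * D := by
      refine (Finset.sum_le_sum_of_subset (Finset.filter_subset _ _)).trans ?_
      rw [← sum_card_ptsOn_filter L X fun l x => ¬ R l x, ← smul_eq_mul]
      exact Finset.sum_le_card_nsmul _ _ _ fun l _ => hnon l
    rw [← Finset.mul_sum, smul_eq_mul] at h2
    lia
  · set p := k / 2 + 1 with hp
    have h1 := hrich l hl hlf p (by lia)
    set S := (l.ptsOn X).filter fun x => R l x ∧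
        p ≤ ((linesAt L x).filter fun m => R m x).card with hS
    have hcover : l.ptsOn (X \ Y) ⊆ ((l.ptsOn X).filter fun x => ¬ R l x) ∪ S := by
      intro x hx
      rw [GLine.mem_ptsOn, Finset.mem_sdiff] at hx
      have hxl : x ∈ l.ptsOn X := GLine.mem_ptsOn.2 ⟨hx.1.1, hx.2⟩
      rw [Finset.mem_union, hS, Finset.mem_filter, Finset.mem_filter]
      by_cases h : R l x
      · refine Or.inr ⟨hxl, h, ?_⟩
        have h2 : ¬ (linesAt L x).card ≤ 2 * ((linesAt L x).filter fun l => ¬ R l x).card :=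
          fun h2 => hx.1.2 (Finset.mem_filter.2 ⟨hx.1.1, h2⟩)
        have h3 := Finset.card_filter_add_card_filter_not (s := linesAt L x) fun m => R m x
        have h4 := hX x hx.1.1
        lia
      · exact Or.inl ⟨hxl, h⟩
    have h2 := (Finset.card_le_card hcover).trans (Finset.card_union_le _ _)
    have h3 := hnon l
    have h4 : k * S.card ≤ 20 * D * k + 4 * q := by
      have h5 : k ≤ 2 * p := by lia
      rcases le_total S.card (20 * D) with h6 | h6
      · nlinarith
      · obtain ⟨s, hs⟩ := Nat.exists_eq_add_of_le h6
        rw [hs] at h1 ⊢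
        nlinarith
    nlinarith

/-- Double counting of the incidences between the points of `Y` and the lines of `B`. -/
theorem mul_le_of_aligned_relation {L B : Finset GLine} (hBL : B ⊆ L) (hB : B.Nonempty)
    {X Y : Finset (Fin 3 → ℝ)} (hYX : Y ⊆ X) {t p D q : ℕ} {R : GLine → (Fin 3 → ℝ) → Prop}
    (ht : ∀ l ∈ B, t ≤ 2 * (l.ptsOn Y).card)
    (hnon : ∀ l ∈ B, ((l.ptsOn X).filter fun x => ¬ R l x).card ≤ D)
    (hrich : ∀ l ∈ B, p * ((l.ptsOn X).filter fun x => R l x ∧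
        p ≤ ((linesAt L x).filter fun m => R m x).card).card ≤ 20 * D * p + 2 * q)
    (hp : 8 * (p * Y.card) ≤ B.card * t) : p * (3 * t) ≤ 168 * D * p + 16 * q := by
  set S : GLine → (Fin 3 → ℝ) → Prop := fun l x => R l x ∧
        p ≤ ((linesAt L x).filter fun m => R m x).card with hS
  have h1 : ∑ l ∈ B, (l.ptsOn Y).card ≤ B.card * D +
      ∑ l ∈ B, ((l.ptsOn X).filter (S l)).card +
      ∑ l ∈ B, ((l.ptsOn Y).filter fun x => R l x ∧ ¬ S l x).card := by
    rw [← smul_eq_mul, ← Finset.sum_const, ← Finset.sum_add_distrib, ← Finset.sum_add_distrib]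
    refine Finset.sum_le_sum fun l hl => ?_
    have hcover : l.ptsOn Y ⊆ ((l.ptsOn X).filter fun x => ¬ R l x) ∪ (l.ptsOn X).filter (S l) ∪
        (l.ptsOn Y).filter fun x => R l x ∧ ¬ S l x := by
      intro x hx
      have := l.ptsOn_mono hYX hx
      simp only [Finset.mem_union, Finset.mem_filter]
      tauto
    have h2 := (Finset.card_le_card hcover).trans (Finset.card_union_le _ _)
    have h3 := Finset.card_union_le ((l.ptsOn X).filter fun x => ¬ R l x)
      ((l.ptsOn X).filter (S l))
    have h4 := hnon l hl
    lia
  have h2 : ∑ l ∈ B, ((l.ptsOn Y).filter fun x => R l x ∧ ¬ S l x).card ≤ Y.card * p := by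
    rw [sum_card_ptsOn_filter B Y fun l x => R l x ∧ ¬ S l x, ← smul_eq_mul]
    refine Finset.sum_le_card_nsmul _ _ _ fun x _ => ?_
    by_cases h : p ≤ ((linesAt L x).filter fun m => R m x).card
    · rw [Finset.filter_false_of_mem]
      · exact Nat.zero_le _
      · exact fun l _ hl => hl.2 ⟨hl.1, h⟩
    · refine (Finset.card_le_card fun l hl => ?_).trans (not_le.1 h).le
      rw [Finset.mem_filter] at hl ⊢
      exact ⟨linesAt_mono hBL x hl.1, hl.2.1⟩
  have h3 : B.card * t ≤ 2 * ∑ l ∈ B, (l.ptsOn Y).card := by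
    rw [Finset.mul_sum, ← smul_eq_mul]
    exact Finset.card_nsmul_le_sum _ _ _ ht
  have h4 : p * ∑ l ∈ B, ((l.ptsOn X).filter (S l)).card ≤ B.card * (20 * D * p + 2 * q) := by
    rw [Finset.mul_sum, ← smul_eq_mul]
    exact Finset.sum_le_card_nsmul _ _ _ hrich
  have h5 : B.card * (p * (3 * t)) ≤ B.card * (168 * D * p + 16 * q) := by
    have h6 := Nat.mul_le_mul_left p h3
    have h7 := Nat.mul_le_mul_left p h1
    have h8 := Nat.mul_le_mul_left p h2
    have h9 := Nat.mul_le_mul_left p hp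
    nlinarith
  exact Nat.le_of_mul_le_mul_left h5 hB.card_pos

end Algebraic

section AlgebraicBound

open MvPolynomial

/-- A family of at most `n ^ 2` lines with few lines in planes, in quadrics and through points. -/
structure LineSystem (n : ℕ) (L : Finset GLine) : Prop where
  card_le : L.card ≤ n ^ 2
  quadric : ∀ F : MvPolynomial (Fin 3) ℝ, Irreducible F → F.totalDegree ≤ 2 →
    (L.filter fun l => l.restr F = 0).card ≤ 7 * n
  rich : ∀ x, (linesAt L x).card ≤ n

theorem exists_degree {N m : ℕ} (hm : 0 < m) (hmN : m ≤ 2 * N) :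
    ∃ D, 96 * N ≤ D * m ∧ D * m ≤ 98 * N := by
  refine ⟨96 * N / m + 1, ?_, ?_⟩
  · have := Nat.div_add_mod (96 * N) m
    have := Nat.mod_lt (96 * N) hm
    nlinarith
  · have := Nat.div_mul_le_self (96 * N) m
    nlinarith

set_option maxHeartbeats 1000000 in
/-- The bound on the number of lines with many rich points, when most of these lines lie in a
surface of low degree. -/
theorem algebraic_bound {C : ℝ} (hC : 1 ≤ C) {n : ℕ} {L : Finset GLine} (hL : LineSystem n L)
    {k t : ℕ} (hk : 2 ≤ k) (ht : 1 ≤ t) {X : Finset (Fin 3 → ℝ)}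
    (hX : ∀ x ∈ X, k ≤ (linesAt L x).card) {A : Finset GLine} (hAL : A ⊆ L)
    (hA : ∀ l ∈ A, t ≤ (l.ptsOn X).card) (hA1 : (A.card * k : ℝ) ≤ C * n ^ 2)
    (hA2 : (A.card * k ^ 2 : ℝ) ≤ C * n ^ 2 ∨ (X.card * k ^ 2 : ℝ) ≤ C * n ^ 3) :
    (A.card * t ^ 2 * k ^ 2 : ℝ) ≤ 10 ^ 6 * C * n ^ 4 := by
  by_contra! hcon
  have hk' : (2 : ℝ) ≤ k := by exact_mod_cast hk
  have ht' : (1 : ℝ) ≤ t := by exact_mod_cast ht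
  have hAne : A.Nonempty := by
    rw [Finset.nonempty_iff_ne_empty]
    rintro rfl
    have : (0 : ℝ) ≤ 10 ^ 6 * C * n ^ 4 := by positivity
    simp at hcon
    linarith
  have ha : (1 : ℝ) ≤ A.card := by exact_mod_cast hAne.card_pos
  have hn : 0 < n := by
    have h1 := (Finset.card_le_card hAL).trans hL.card_le
    have h2 := hAne.card_pos
    exact Nat.pos_of_ne_zero fun h => by subst h; lia
  have hn' : (1 : ℝ) ≤ n := by exact_mod_cast hn
  have hn2 : (0 : ℝ) < (n : ℝ) ^ 2 := by positivity
  have htk : t * k ≤ 2 * n ^ 2 := by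
    obtain ⟨l, hl⟩ := hAne
    have h1 := sum_card_linesAt_erase_le l L (l.ptsOn X) fun x hx => (GLine.mem_ptsOn.1 hx).2
    have h2 : ∀ x ∈ l.ptsOn X, k - 1 ≤ ((linesAt L x).erase l).card := fun x hx => by
      have h5 := Finset.pred_card_le_card_erase (s := linesAt L x) (a := l)
      have h6 := hX x (GLine.mem_ptsOn.1 hx).1
      lia
    have h3 := Finset.card_nsmul_le_sum _ _ _ h2
    have h4 := Nat.mul_le_mul_right (k - 1) (hA l hl)
    have h5 := hL.card_le
    have h6 : t * k ≤ t * (2 * (k - 1)) := Nat.mul_le_mul_left t (by lia)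
    rw [smul_eq_mul] at h3
    lia
  obtain ⟨D, hD1, hD2⟩ := exists_degree (by positivity : 0 < t * k) htk
  have hD2' : (D * (t * k) : ℝ) ≤ 98 * n ^ 2 := by exact_mod_cast hD2
  have hkey : (10 ^ 6 : ℝ) * n ^ 2 < t ^ 2 * k := by
    have h1 : (A.card * k : ℝ) * (t ^ 2 * k) ≤ C * n ^ 2 * (t ^ 2 * k) := by gcongr
    have h2 : (C * n ^ 2 : ℝ) * (10 ^ 6 * n ^ 2) < C * n ^ 2 * (t ^ 2 * k) := by
      refine lt_of_lt_of_le ?_ h1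
      linarith
    exact lt_of_mul_lt_mul_left h2 (by positivity)
  have hDt' : (168 * D : ℝ) ≤ t := by
    have h1 : (168 * D : ℝ) * (t * k) ≤ t * (t * k) := by nlinarith
    exact le_of_mul_le_mul_right h1 (by positivity)
  have hDt : 168 * D ≤ t := by exact_mod_cast hDt'
  have hDa : 80 * D ^ 2 ≤ A.card := by
    have h1 : (80 * D ^ 2 : ℝ) * (t ^ 2 * k ^ 2) ≤ A.card * (t ^ 2 * k ^ 2) := by
      have h2 : (D * (t * k) : ℝ) ^ 2 ≤ (98 * n ^ 2) ^ 2 := by gcongr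
      have h3 : (n : ℝ) ^ 4 ≤ C * n ^ 4 := le_mul_of_one_le_left (by positivity) hC
      nlinarith
    exact_mod_cast le_of_mul_le_mul_right h1 (by positivity)
  have hnk : (112 * n : ℝ) ≤ t * k := by
    have h1 : (t : ℝ) ^ 2 * k ≤ (t * k) ^ 2 := by
      rw [mul_pow]
      gcongr
      nlinarith
    refine le_of_sq_le_sq ?_ (by positivity)
    nlinarith
  have hnk' : 112 * n ≤ t * k := by exact_mod_cast hnk
  obtain ⟨f, hf0, hfD, hfA⟩ := exists_low_degree_surface L A (fun l => l.ptsOn X) (D := D) hk ht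
    (by lia) (fun l hl => ⟨hA l hl, fun x hx => ⟨(GLine.mem_ptsOn.1 hx).2,
      hX x (GLine.mem_ptsOn.1 hx).1⟩⟩) (by have := hL.card_le; nlinarith)
  obtain ⟨Y, hYX, hYc, bad, hbL, hbc, R, hR⟩ :=
    exists_aligned_relation hL.quadric hk hX hf0 hfD
  set B := (A.filter fun l => l.restr f = 0) \ bad with hB
  have hBmem : ∀ l ∈ B, l ∈ A ∧ l ∈ L \ bad ∧ l.restr f = 0 := by
    intro l hl
    rw [hB, Finset.mem_sdiff, Finset.mem_filter] at hl
    exact ⟨hl.1.1, Finset.mem_sdiff.2 ⟨hAL hl.1.1, hl.2⟩, hl.1.2⟩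
  have hBc : A.card ≤ 2 * B.card := by
    have h1 := Finset.card_filter_add_card_filter_not (s := A) fun l => l.restr f = 0
    have h2 := Finset.le_card_sdiff bad (A.filter fun l => l.restr f = 0)
    rw [← hB] at h2
    change 4 * (A.filter fun l => ¬ l.restr f = 0).card ≤ A.card at hfA
    lia
  have hBne : B.Nonempty := by
    have := hAne.card_pos
    exact Finset.card_pos.1 (by lia)
  have hBt : ∀ l ∈ B, t ≤ 2 * (l.ptsOn Y).card := by
    intro l hl
    obtain ⟨h1, h2, h3⟩ := hBmem l hl
    have h4 := (hR l h2 h3).1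
    have h5 : l.ptsOn X ⊆ l.ptsOn Y ∪ l.ptsOn (X \ Y) := by
      intro x hx
      rw [GLine.mem_ptsOn] at hx
      rw [Finset.mem_union, GLine.mem_ptsOn, GLine.mem_ptsOn, Finset.mem_sdiff]
      tauto
    have h6 := (Finset.card_le_card h5).trans (Finset.card_union_le _ _)
    have h7 := hA l h1
    have h8 : k * (2 * (l.ptsOn (X \ Y)).card) ≤ k * t := by nlinarith
    have h9 := Nat.le_of_mul_le_mul_left h8 (by lia)
    lia
  have hYpos : 0 < Y.card := by
    obtain ⟨l, hl⟩ := hBne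
    have h1 := hBt l hl
    have h2 : (l.ptsOn Y).card ≤ Y.card := Finset.card_filter_le _ _
    lia
  have hYk : (t * k ^ 2 * Y.card : ℝ) ≤ 196 * n ^ 4 := by
    have h1 : (k * Y.card : ℝ) ≤ 2 * (n ^ 2 * D) := by
      have h2 := hL.card_le
      exact_mod_cast hYc.trans (by gcongr)
    calc (t * k ^ 2 * Y.card : ℝ) = t * k * (k * Y.card) := by ring
      _ ≤ t * k * (2 * (n ^ 2 * D)) := by gcongr
      _ = 2 * n ^ 2 * (D * (t * k)) := by ring
      _ ≤ 2 * n ^ 2 * (98 * n ^ 2) := by gcongr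
      _ = 196 * n ^ 4 := by ring
  have hYa : (32 * Y.card : ℝ) ≤ A.card * t := by
    have h1 : (32 * Y.card : ℝ) * (t * k ^ 2) ≤ A.card * t * (t * k ^ 2) := by
      have h3 : (n : ℝ) ^ 4 ≤ C * n ^ 4 := le_mul_of_one_le_left (by positivity) hC
      nlinarith
    exact le_of_mul_le_mul_right h1 (by positivity)
  have hYa' : 32 * Y.card ≤ A.card * t := by exact_mod_cast hYa
  set p := B.card * t / (8 * Y.card) with hp
  have hBA : A.card * t ≤ 2 * (B.card * t) := by
    have := Nat.mul_le_mul_right t hBc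
    lia
  have hp2 : 2 ≤ p := by
    rw [hp, Nat.le_div_iff_mul_le (by lia)]
    lia
  have hple : 8 * (p * Y.card) ≤ B.card * t := by
    have := Nat.div_mul_le_self (B.card * t) (8 * Y.card)
    rw [← hp] at this
    linarith
  have hpge : A.card * t ≤ 32 * (p * Y.card) := by
    have h1 := Nat.lt_div_mul_add (a := B.card * t) (b := 8 * Y.card) (by lia)
    rw [← hp] at h1
    have h2 := Nat.mul_le_mul_right (8 * Y.card) (show 1 ≤ p by lia)
    linarith
  have hfin := mul_le_of_aligned_relation (p := p) (fun l hl => hAL (hBmem l hl).1) hBne hYX hBt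
    (fun l hl => (hR l (hBmem l hl).2.1 (hBmem l hl).2.2).2.1)
    (fun l hl => (hR l (hBmem l hl).2.1 (hBmem l hl).2.2).2.2 p hp2) hple
  have hpt : p * t ≤ 56 * n := by
    have := Nat.mul_le_mul_right p hDt
    linarith
  have hpt' : (p * t : ℝ) ≤ 56 * n := by exact_mod_cast hpt
  rcases hA2 with h | h
  · have h1 : (A.card * k ^ 2 : ℝ) * t ^ 2 ≤ C * n ^ 2 * t ^ 2 := by gcongr
    have h2 : (C * n ^ 2 : ℝ) * (10 ^ 6 * n ^ 2) < C * n ^ 2 * t ^ 2 := by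
      refine lt_of_lt_of_le ?_ h1
      linarith
    have h3 := lt_of_mul_lt_mul_left h2 (by positivity)
    have h4 : (2 : ℝ) ≤ p := by exact_mod_cast hp2
    have h5 : (2 * t : ℝ) ≤ 56 * n := by nlinarith
    nlinarith
  · have h1 : (A.card * t : ℝ) ≤ 32 * (p * X.card) := by
      have := Finset.card_le_card hYX
      exact_mod_cast hpge.trans (by gcongr)
    have h2 : (A.card * t ^ 2 * k ^ 2 : ℝ) ≤ 32 * (56 * n) * (C * n ^ 3) := by
      calc (A.card * t ^ 2 * k ^ 2 : ℝ) = A.card * t * (t * k ^ 2) := by ring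
        _ ≤ 32 * (p * X.card) * (t * k ^ 2) := by gcongr
        _ = 32 * (p * t) * (X.card * k ^ 2) := by ring
        _ ≤ 32 * (56 * n) * (C * n ^ 3) := by gcongr
    have h3 : (0 : ℝ) < C * n ^ 4 := by positivity
    nlinarith

end AlgebraicBound

section RichPoints

open MvPolynomial

/-- Summation of a quantity whose level sets decay quadratically. -/
theorem sum_le_of_card_level_le {α : Type*} (S : Finset α) (c : α → ℕ) {W : ℝ}
    (hW : ∀ τ : ℕ, 1 ≤ τ → ((S.filter fun l => τ ≤ c l).card : ℝ) * τ ^ 2 ≤ W) {m : ℕ}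
    (hm : 1 ≤ m) : (∑ l ∈ S, (c l : ℝ)) ≤ m * S.card + W / m := by
  set N := m + ∑ l ∈ S, c l with hN
  have hW0 : 0 ≤ W := le_trans (by positivity) (hW 1 le_rfl)
  have h1 : ∀ l ∈ S, c l ≤ m + ((Finset.Ioc m N).filter fun τ => τ ≤ c l).card := by
    intro l hl
    have h2 : c l ≤ N :=
      (Finset.single_le_sum (f := c) (fun _ _ => Nat.zero_le _) hl).trans (Nat.le_add_left _ _)
    have h3 : Finset.Ioc m (c l) ⊆ (Finset.Ioc m N).filter fun τ => τ ≤ c l := by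
      intro τ hτ
      rw [Finset.mem_Ioc] at hτ
      rw [Finset.mem_filter, Finset.mem_Ioc]
      exact ⟨⟨hτ.1, hτ.2.trans h2⟩, hτ.2⟩
    have h4 := Finset.card_le_card h3
    rw [Nat.card_Ioc] at h4
    lia
  have h2 : ∑ l ∈ S, c l ≤ S.card * m + ∑ τ ∈ Finset.Ioc m N, (S.filter fun l => τ ≤ c l).card := by
    refine (Finset.sum_le_sum h1).trans ?_
    rw [Finset.sum_add_distrib, Finset.sum_const, smul_eq_mul]
    refine Nat.add_le_add_left (le_of_eq ?_) _
    simp only [Finset.card_filter]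
    exact Finset.sum_comm
  have h3 : (∑ l ∈ S, (c l : ℝ)) ≤
      S.card * m + ∑ τ ∈ Finset.Ioc m N, ((S.filter fun l => τ ≤ c l).card : ℝ) := by
    exact_mod_cast h2
  have h4 : ∑ τ ∈ Finset.Ioc m N, ((S.filter fun l => τ ≤ c l).card : ℝ) ≤
      ∑ τ ∈ Finset.Ioc m N, W * ((τ : ℝ) ^ 2)⁻¹ := by
    refine Finset.sum_le_sum fun τ hτ => ?_
    have h5 : 0 < τ := by
      rw [Finset.mem_Ioc] at hτ
      lia
    rw [← div_eq_mul_inv, le_div_iff₀ (by positivity)]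
    exact hW τ h5
  rw [← Finset.mul_sum] at h4
  have h5 := sum_Ioc_inv_sq_le_sub (α := ℝ) (show m ≠ 0 by lia) (show m ≤ N by lia)
  have h6 : (0 : ℝ) ≤ (N : ℝ)⁻¹ := by positivity
  have h7 : W * ∑ τ ∈ Finset.Ioc m N, ((τ : ℝ) ^ 2)⁻¹ ≤ W * (m : ℝ)⁻¹ := by
    gcongr
    linarith
  rw [div_eq_mul_inv]
  linarith

theorem exists_nat_mul_between {u v : ℝ} (hu : 0 < u) (huv : u ≤ v) :
    ∃ D : ℕ, 1 ≤ D ∧ v ≤ D * u ∧ D * u ≤ 2 * v := by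
  have h0 : 0 < v / u := div_pos (hu.trans_le huv) hu
  refine ⟨⌈v / u⌉₊, Nat.one_le_iff_ne_zero.2 (Nat.ceil_pos.2 h0).ne', ?_, ?_⟩
  · rw [← div_le_iff₀ hu]
    exact Nat.le_ceil _
  · have h1 := (Nat.ceil_lt_add_one h0.le).le
    have h2 := mul_le_mul_of_nonneg_right h1 hu.le
    rw [add_mul, div_mul_cancel₀ _ hu.ne', one_mul] at h2
    linarith

set_option maxHeartbeats 1000000 in
/-- The number of points of large multiplicity. -/
theorem exists_card_rich_le : ∃ (C : ℝ) (k₀ : ℕ), 1 ≤ C ∧ ∀ (n : ℕ) (L : Finset GLine),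
    LineSystem n L → ∀ k, k₀ ≤ k → ∀ X : Finset (Fin 3 → ℝ),
    (∀ x ∈ X, k ≤ (linesAt L x).card) → (X.card * k ^ 2 : ℝ) ≤ C * n ^ 3 := by
  obtain ⟨K, hK1, hK⟩ := exists_incidence_bound
  obtain ⟨k₀, hk₀⟩ := exists_nat_ge (10 ^ 8 * K)
  refine ⟨2 * (64 * K) ^ 2, k₀, by nlinarith, fun n L hL k hk X hX => ?_⟩
  by_contra! hcon
  set B := 64 * K with hB
  have hkK : 10 ^ 8 * K ≤ k := hk₀.trans (by exact_mod_cast hk)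
  have hk0 : (0 : ℝ) < k := by linarith
  have hXne : X.Nonempty := by
    rw [Finset.nonempty_iff_ne_empty]
    rintro rfl
    have : (0 : ℝ) ≤ 2 * B ^ 2 * n ^ 3 := by positivity
    simp at hcon
    linarith
  have hkn : (k : ℝ) ≤ n := by
    obtain ⟨x, hx⟩ := hXne
    exact_mod_cast (hX x hx).trans (hL.rich x)
  have hn0 : (0 : ℝ) < n := hk0.trans_le hkn
  have hB1 : 1 ≤ B := by linarith
  obtain ⟨M, hM1, hMlo, hMhi⟩ := exists_nat_mul_between (u := (k : ℝ) ^ 2) (v := B ^ 2 * n ^ 3)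
    (by positivity) (by
      calc (k : ℝ) ^ 2 ≤ (n : ℝ) ^ 2 := by gcongr
        _ ≤ (n : ℝ) ^ 3 := pow_le_pow_right₀ (by linarith) (by norm_num)
        _ ≤ B ^ 2 * n ^ 3 := le_mul_of_one_le_left (by positivity) (one_le_pow₀ hB1))
  have hMX : M ≤ X.card := by
    have h1 : (M : ℝ) * k ^ 2 ≤ X.card * k ^ 2 := by linarith
    exact_mod_cast le_of_mul_le_mul_right h1 (by positivity)
  obtain ⟨X', hX'X, hX'c⟩ := Finset.exists_subset_card_eq hMX
  obtain ⟨D, hD1, hDlo, hDhi⟩ := exists_nat_mul_between (u := (k : ℝ)) (v := B * n) hk0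
    (hkn.trans (le_mul_of_one_le_left hn0.le hB1))
  obtain ⟨bad, hbL, hbc, hinc⟩ := hK L (7 * n) X' D hD1 hL.quadric
  rw [hX'c] at hinc
  have hM0 : (0 : ℝ) < M := by exact_mod_cast hM1
  have hD0 : (0 : ℝ) < D := by exact_mod_cast hD1
  have hLn : (L.card : ℝ) ≤ n ^ 2 := by exact_mod_cast hL.card_le
  have e1 : K * M ≤ k * M / 16 := by nlinarith
  have e2 : K * (L.card * D) ≤ k * M / 32 := by
    have h1 : K * (L.card * D) * (k * B) ≤ k * M / 32 * (k * B) := by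
      calc K * (L.card * D) * (k * B) ≤ K * (n ^ 2 * D) * (k * B) := by gcongr
        _ = K * n ^ 2 * B * (D * k) := by ring
        _ ≤ K * n ^ 2 * B * (2 * (B * n)) := by gcongr
        _ = 2 * K * (B ^ 2 * n ^ 3) := by ring
        _ ≤ 2 * K * (M * k ^ 2) := by gcongr
        _ = k * M / 32 * (k * B) := by rw [hB]; ring
    exact le_of_mul_le_mul_right h1 (by positivity)
  have e3 : K * (M ^ 2 / D ^ 3) ≤ k * M / 32 := by
    rw [← mul_div_assoc, div_le_iff₀ (by positivity)]
    have h1 : K * M ^ 2 * k ^ 2 ≤ k * M / 32 * D ^ 3 * k ^ 2 := by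
      calc K * M ^ 2 * k ^ 2 = K * M * (M * k ^ 2) := by ring
        _ ≤ K * M * (2 * (B ^ 2 * n ^ 3)) := by gcongr
        _ = M / 32 * (B * n) ^ 3 := by rw [hB]; ring
        _ ≤ M / 32 * (D * k) ^ 3 := by gcongr
        _ = k * M / 32 * D ^ 3 * k ^ 2 := by ring
    exact le_of_mul_le_mul_right h1 (by positivity)
  have e4 : √((M : ℝ) * L.card * (7 * n : ℕ)) ≤ k * M / 16 := by
    refine Real.sqrt_le_iff.2 ⟨by positivity, ?_⟩
    push_cast
    have h1 : (1792 : ℝ) * n ^ 3 ≤ M * k ^ 2 := by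
      refine le_trans ?_ hMlo
      gcongr
      nlinarith
    calc (M : ℝ) * L.card * (7 * n) ≤ M * n ^ 2 * (7 * n) := by gcongr
      _ = M / 256 * (1792 * n ^ 3) := by ring
      _ ≤ M / 256 * (M * k ^ 2) := by gcongr
      _ = (k * M / 16) ^ 2 := by ring
  have htot : (k * M : ℝ) ≤ ∑ l ∈ L, ((l.ptsOn X').card : ℝ) := by
    have h1 := Finset.card_nsmul_le_sum X' (fun x => (linesAt L x).card) k
      fun x hx => hX x (hX'X hx)
    rw [← sum_card_ptsOn, hX'c, smul_eq_mul, mul_comm] at h1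
    exact_mod_cast h1
  rw [← Finset.sum_sdiff hbL] at htot
  have hbad : (k * M / 2 : ℝ) ≤ ∑ l ∈ bad, ((l.ptsOn X').card : ℝ) := by
    have : (0 : ℝ) < k * M := by positivity
    nlinarith
  have hbk : (bad.card * k ^ 2 : ℝ) ≤ 4 * K * B ^ 2 * n ^ 2 := by
    calc (bad.card * k ^ 2 : ℝ) ≤ K * D ^ 2 * k ^ 2 := by gcongr
      _ = K * (D * k) ^ 2 := by ring
      _ ≤ K * (2 * (B * n)) ^ 2 := by gcongr
      _ = 4 * K * B ^ 2 * n ^ 2 := by ring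
  have hk2 : 2 ≤ k := by
    have : (2 : ℝ) ≤ k := by nlinarith
    exact_mod_cast this
  have hk1' : (1 : ℝ) ≤ k := by nlinarith
  have hKB : 1 ≤ 4 * K * B ^ 2 := one_le_mul_of_one_le_of_one_le (by linarith) (one_le_pow₀ hB1)
  have hlev : ∀ τ : ℕ, 1 ≤ τ → ((bad.filter fun l => τ ≤ (l.ptsOn X').card).card : ℝ) * τ ^ 2 ≤
      10 ^ 6 * (4 * K * B ^ 2) * n ^ 4 / k ^ 2 := by
    intro τ hτ
    rw [le_div_iff₀ (by positivity)]
    have h1 : ((bad.filter fun l => τ ≤ (l.ptsOn X').card).card * k ^ 2 : ℝ) ≤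
        4 * K * B ^ 2 * n ^ 2 := by
      refine le_trans ?_ hbk
      gcongr
      exact Finset.filter_subset _ _
    refine algebraic_bound hKB hL hk2 hτ
      (fun x hx => hX x (hX'X hx)) ((Finset.filter_subset _ _).trans hbL)
      (fun l hl => (Finset.mem_filter.1 hl).2) (le_trans ?_ h1) (Or.inl h1)
    gcongr
    nlinarith
  have hn1 : 1 ≤ n := by exact_mod_cast hn0
  have hsum := sum_le_of_card_level_le bad (fun l => (l.ptsOn X').card) hlev hn1
  have h1 : (k * M / 2 : ℝ) * k ^ 2 ≤ (4 * K * B ^ 2 * (1 + 10 ^ 6)) * n ^ 3 := by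
    calc (k * M / 2 : ℝ) * k ^ 2 ≤
        (n * bad.card + 10 ^ 6 * (4 * K * B ^ 2) * n ^ 4 / k ^ 2 / n) * k ^ 2 := by
          gcongr
          exact hbad.trans hsum
      _ = n * (bad.card * k ^ 2) + 10 ^ 6 * (4 * K * B ^ 2) * n ^ 3 := by field_simp
      _ ≤ n * (4 * K * B ^ 2 * n ^ 2) + 10 ^ 6 * (4 * K * B ^ 2) * n ^ 3 := by gcongr
      _ = (4 * K * B ^ 2 * (1 + 10 ^ 6)) * n ^ 3 := by ring
  have h2 : (10 ^ 8 * K) / 2 * (B ^ 2 * n ^ 3) ≤ (k * M / 2 : ℝ) * k ^ 2 := by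
    calc (10 ^ 8 * K) / 2 * (B ^ 2 * n ^ 3) ≤ (k : ℝ) / 2 * (M * k ^ 2) := by gcongr
      _ = (k * M / 2 : ℝ) * k ^ 2 := by ring
  have h3 : (0 : ℝ) < K * B ^ 2 * n ^ 3 := by positivity
  nlinarith

end RichPoints

section RichLines

open MvPolynomial

/-- The bound on the number of lines with many rich points, for large families of lines. -/
theorem exists_bound_of_large {C₁ : ℝ} (hC₁ : 1 ≤ C₁) : ∃ C C' : ℝ, 1 ≤ C ∧ 1 ≤ C' ∧
    ∀ (n : ℕ) (L : Finset GLine), LineSystem n L → ∀ k t : ℕ, 2 ≤ k → ∀ X : Finset (Fin 3 → ℝ),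
    (∀ x ∈ X, k ≤ (linesAt L x).card) → X.Nonempty → (X.card * k ^ 2 : ℝ) ≤ C₁ * n ^ 3 →
    ∀ A ⊆ L, (∀ l ∈ A, t ≤ (l.ptsOn X).card) → C * n ^ 2 ≤ (A.card * k : ℝ) →
    (A.card * t ^ 2 * k ^ 2 : ℝ) ≤ C' * n ^ 4 := by
  obtain ⟨K, hK1, hK⟩ := exists_incidence_bound
  set E := 2 * (K * (C₁ + 2 + C₁ ^ 2) + 7 * C₁) with hE
  have hE1 : 1 ≤ E := by nlinarith [mul_nonneg (zero_le_one.trans hK1) (sq_nonneg C₁)]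
  refine ⟨8 * K, E ^ 2, by linarith, one_le_pow₀ hE1,
    fun n L hL k t hk X hX hXne hXc A hAL hA hAk => ?_⟩
  have hk0 : (0 : ℝ) < k := by
    have : 0 < k := by lia
    exact_mod_cast this
  have hk1 : (1 : ℝ) ≤ k := by exact_mod_cast (show 1 ≤ k by lia)
  have hkn : (k : ℝ) ≤ n := by
    obtain ⟨x, hx⟩ := hXne
    exact_mod_cast (hX x hx).trans (hL.rich x)
  have hn0 : (0 : ℝ) < n := hk0.trans_le hkn
  have hAn : (A.card : ℝ) ≤ n ^ 2 := by
    exact_mod_cast (Finset.card_le_card hAL).trans hL.card_le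
  set s := √(A.card : ℝ) with hs
  have hs2 : s ^ 2 = A.card := Real.sq_sqrt (Nat.cast_nonneg _)
  have ha0 : (0 : ℝ) < A.card := by
    have h1 : (0 : ℝ) < A.card * k := lt_of_lt_of_le (by positivity) hAk
    exact pos_of_mul_pos_left h1 hk0.le
  have hs0 : 0 < s := Real.sqrt_pos.2 ha0
  have hsn : s ≤ n := Real.sqrt_le_iff.2 ⟨hn0.le, hAn⟩
  have hnks : n ≤ k * s := by
    refine le_of_sq_le_sq ?_ (by positivity)
    rw [mul_pow, hs2]
    calc (n : ℝ) ^ 2 ≤ 8 * K * n ^ 2 := le_mul_of_one_le_left (by positivity) (by linarith)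
      _ ≤ k * A.card := by linarith
      _ ≤ k ^ 2 * A.card := by
        gcongr
        nlinarith
  obtain ⟨D, hD1, hDlo, hDhi⟩ := exists_nat_mul_between (u := k * s) (v := (n : ℝ) ^ 2)
    (by positivity) (by rw [sq]; gcongr)
  have hD0 : (0 : ℝ) < D := by exact_mod_cast hD1
  obtain ⟨bad, hbA, hbc, hinc⟩ := hK A (7 * n) X D hD1 fun F hF hF2 =>
    (Finset.card_le_card (Finset.filter_subset_filter _ hAL)).trans (hL.quadric F hF hF2)
  have hbad : (2 * bad.card : ℝ) ≤ A.card := by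
    have h1 : (2 * bad.card : ℝ) * (A.card * k ^ 2) ≤ A.card * (A.card * k ^ 2) := by
      calc (2 * bad.card : ℝ) * (A.card * k ^ 2) ≤ (2 * (K * D ^ 2)) * (s ^ 2 * k ^ 2) := by
            rw [hs2]
            gcongr
        _ = 2 * K * (D * (k * s)) ^ 2 := by ring
        _ ≤ 2 * K * (2 * n ^ 2) ^ 2 := by gcongr
        _ = (8 * K * n ^ 2) * n ^ 2 := by ring
        _ ≤ (A.card * k) * (A.card * k) := by
          gcongr
          refine le_trans ?_ hAk
          exact le_mul_of_one_le_left (by positivity) (by linarith)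
        _ = A.card * (A.card * k ^ 2) := by ring
    exact le_of_mul_le_mul_right h1 (by positivity)
  have hlow : (A.card * t : ℝ) ≤ 2 * ∑ l ∈ A \ bad, ((l.ptsOn X).card : ℝ) := by
    have h1 := Finset.card_nsmul_le_sum (A \ bad) (fun l => ((l.ptsOn X).card : ℝ)) t
      fun l hl => by exact_mod_cast hA l (Finset.sdiff_subset hl)
    rw [nsmul_eq_mul, Finset.card_sdiff_of_subset hbA, Nat.cast_sub (Finset.card_le_card hbA)] at h1
    have h2 : (0 : ℝ) ≤ t := Nat.cast_nonneg _
    nlinarith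
  set V := (n : ℝ) ^ 2 * s / k with hV
  have e1 : (X.card : ℝ) ≤ C₁ * V := by
    rw [hV, mul_div_assoc', le_div_iff₀ hk0]
    have h1 : (X.card : ℝ) * k * k ≤ C₁ * (n ^ 2 * s) * k := by
      calc (X.card : ℝ) * k * k = X.card * k ^ 2 := by ring
        _ ≤ C₁ * n ^ 3 := hXc
        _ = C₁ * n ^ 2 * n := by ring
        _ ≤ C₁ * n ^ 2 * (k * s) := by gcongr
        _ = C₁ * (n ^ 2 * s) * k := by ring
    exact le_of_mul_le_mul_right h1 hk0
  have e2 : (A.card * D : ℝ) ≤ 2 * V := by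
    rw [hV, mul_div_assoc', le_div_iff₀ hk0, ← hs2]
    calc s ^ 2 * D * k = s * (D * (k * s)) := by ring
      _ ≤ s * (2 * n ^ 2) := by gcongr
      _ = 2 * (n ^ 2 * s) := by ring
  have e3 : (X.card ^ 2 / D ^ 3 : ℝ) ≤ C₁ ^ 2 * V := by
    rw [hV, div_le_iff₀ (by positivity)]
    have h1 : (X.card : ℝ) ^ 2 * k ^ 4 ≤ C₁ ^ 2 * (n ^ 2 * s / k) * D ^ 3 * k ^ 4 := by
      calc (X.card : ℝ) ^ 2 * k ^ 4 = (X.card * k ^ 2) ^ 2 := by ring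
        _ ≤ (C₁ * n ^ 3) ^ 2 := by gcongr
        _ = C₁ ^ 2 * (n ^ 2) ^ 3 := by ring
        _ ≤ C₁ ^ 2 * (D * (k * s)) ^ 3 := by gcongr
        _ = C₁ ^ 2 * (s ^ 2 * s / k) * D ^ 3 * k ^ 4 := by
          field_simp
        _ ≤ C₁ ^ 2 * (n ^ 2 * s / k) * D ^ 3 * k ^ 4 := by gcongr
    exact le_of_mul_le_mul_right h1 (by positivity)
  have e4 : √((X.card : ℝ) * A.card * (7 * n : ℕ)) ≤ 7 * C₁ * V := by
    refine Real.sqrt_le_iff.2 ⟨by positivity, ?_⟩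
    push_cast
    have h1 : (X.card : ℝ) * A.card * (7 * n) * k ^ 2 ≤ (7 * C₁ * V) ^ 2 * k ^ 2 := by
      calc (X.card : ℝ) * A.card * (7 * n) * k ^ 2 = 7 * n * A.card * (X.card * k ^ 2) := by ring
        _ ≤ 7 * n * A.card * (C₁ * n ^ 3) := by gcongr
        _ = 7 * C₁ * (n ^ 4 * s ^ 2) := by rw [hs2]; ring
        _ ≤ (7 * C₁) ^ 2 * (n ^ 4 * s ^ 2) := by
          gcongr
          nlinarith
        _ = (7 * C₁ * V) ^ 2 * k ^ 2 := by
          rw [hV]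
          field_simp
    exact le_of_mul_le_mul_right h1 (by positivity)
  have htot : (A.card * t : ℝ) ≤ E * V := by
    have h1 : K * (X.card + A.card * D + X.card ^ 2 / D ^ 3 : ℝ) ≤ K * (C₁ * V + 2 * V + C₁ ^ 2 * V) := by
      gcongr
    rw [hE]
    linarith
  have hfin : s * t * k ≤ E * n ^ 2 := by
    have h1 : s * t * k * s ≤ E * n ^ 2 * s := by
      rw [hV, mul_div_assoc', le_div_iff₀ hk0, ← hs2] at htot
      linarith
    exact le_of_mul_le_mul_right h1 hs0
  calc (A.card * t ^ 2 * k ^ 2 : ℝ) = (s * t * k) ^ 2 := by rw [← hs2]; ring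
    _ ≤ (E * n ^ 2) ^ 2 := by gcongr
    _ = E ^ 2 * n ^ 4 := by ring

/-- The number of lines of the system carrying many points of large multiplicity. -/
theorem exists_card_lines_rich_le : ∃ C : ℝ, 1 ≤ C ∧ ∀ (n : ℕ) (L : Finset GLine),
    LineSystem n L → ∀ k t : ℕ, 2 ≤ k → 1 ≤ t → ∀ X : Finset (Fin 3 → ℝ),
    (∀ x ∈ X, k ≤ (linesAt L x).card) →
    ((L.filter fun l => t ≤ (l.ptsOn X).card).card * t ^ 2 * k ^ 2 : ℝ) ≤ C * n ^ 4 := by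
  obtain ⟨C₁, k₀, hC₁, hrich⟩ := exists_card_rich_le
  obtain ⟨C₂, C₃, hC₂, hC₃, hlarge⟩ := exists_bound_of_large hC₁
  set k₁ : ℝ := (k₀ : ℝ) + 1 with hk₁
  have hk₁1 : 1 ≤ k₁ := by
    have : (0 : ℝ) ≤ k₀ := Nat.cast_nonneg _
    linarith
  refine ⟨C₃ + 10 ^ 6 * (k₁ ^ 2 + C₁ + C₂), by nlinarith, fun n L hL k t hk ht X hX => ?_⟩
  set A := L.filter fun l => t ≤ (l.ptsOn X).card with hA
  have hAL : A ⊆ L := Finset.filter_subset _ _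
  have hAX : ∀ l ∈ A, t ≤ (l.ptsOn X).card := fun l hl => (Finset.mem_filter.1 hl).2
  have hAn : (A.card : ℝ) ≤ n ^ 2 := by
    exact_mod_cast (Finset.card_le_card hAL).trans hL.card_le
  have hn4 : (0 : ℝ) ≤ n ^ 4 := by positivity
  have hmono : ∀ C : ℝ, 1 ≤ C → C ≤ k₁ ^ 2 + C₁ + C₂ → 10 ^ 6 * C * (n : ℝ) ^ 4 ≤
      (C₃ + 10 ^ 6 * (k₁ ^ 2 + C₁ + C₂)) * n ^ 4 := fun C _ hC => by
    gcongr
    linarith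
  rcases lt_or_ge k k₀ with hkk | hkk
  · have hkk' : (k : ℝ) ≤ k₁ := by
      have : (k : ℝ) ≤ k₀ := by exact_mod_cast hkk.le
      linarith
    refine (algebraic_bound (C := k₁ ^ 2) (one_le_pow₀ hk₁1) hL hk ht hX hAL hAX ?_
      (Or.inl ?_)).trans (hmono _ (one_le_pow₀ hk₁1) (by linarith))
    · rw [mul_comm]
      gcongr
      nlinarith
    · rw [mul_comm]
      gcongr
  · have hXc := hrich n L hL k hkk X hX
    rcases le_total (A.card * k : ℝ) (C₂ * n ^ 2) with h | h
    · refine (algebraic_bound (C := C₁ + C₂) (by linarith) hL hk ht hX hAL hAX ?_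
        (Or.inr ?_)).trans (hmono _ (by linarith) (by nlinarith))
      · refine h.trans ?_
        gcongr
        linarith
      · refine hXc.trans ?_
        gcongr
        linarith
    · rcases X.eq_empty_or_nonempty with rfl | hXne
      · have : A = ∅ := Finset.filter_false_of_mem fun l _ h => by
          simp [GLine.ptsOn] at h
          lia
        rw [this]
        simp only [Finset.card_empty, Nat.cast_zero, zero_mul]
        positivity
      · refine (hlarge n L hL k t hk X hX hXne hXc A hAL hAX h).trans ?_
        gcongr
        nlinarith

end RichLines

section QuadricSpin

open MvPolynomial

/-- A multiple of the derivative of `F` along the line of the rotations that act on `(u, v)`. -/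
noncomputable def spin (u v : ℝ) (F : MvPolynomial (Fin 3) ℝ) : MvPolynomial (Fin 3) ℝ :=
  (X 2 * (X 0 - C u) - (X 1 - C v)) * pderiv 0 F +
    ((X 0 - C u) + X 2 * (X 1 - C v)) * pderiv 1 F + (1 + X 2 ^ 2) * pderiv 2 F

theorem totalDegree_spin_le (u v : ℝ) (F : MvPolynomial (Fin 3) ℝ) :
    (spin u v F).totalDegree ≤ F.totalDegree - 1 + 2 := by
  have hX : ∀ i : Fin 3, (X i : MvPolynomial (Fin 3) ℝ).totalDegree ≤ 1 := fun i =>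
    (totalDegree_X i).le
  have hs : ∀ (i : Fin 3) (w : ℝ), (X i - C w : MvPolynomial (Fin 3) ℝ).totalDegree ≤ 1 :=
    fun i w => totalDegree_sub_le' (hX i) (by simp)
  refine totalDegree_add_le' (totalDegree_add_le' ?_ ?_) ?_
  · refine totalDegree_mul_le' (a := 2) ?_ (totalDegree_pderiv_le 0 F) (by omega)
    exact totalDegree_sub_le' (totalDegree_mul_le' (hX 2) (hs 0 u) le_rfl)
      ((hs 1 v).trans one_le_two)
  · refine totalDegree_mul_le' (a := 2) ?_ (totalDegree_pderiv_le 1 F) (by omega)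
    exact totalDegree_add_le' ((hs 0 u).trans one_le_two)
      (totalDegree_mul_le' (hX 2) (hs 1 v) le_rfl)
  · refine totalDegree_mul_le' (a := 2) ?_ (totalDegree_pderiv_le 2 F) (by omega)
    exact totalDegree_add_le' (by simp) (by simp [totalDegree_X_pow])

theorem GLine.restr_spin {l : GLine} {F : MvPolynomial (Fin 3) ℝ} (hl : l.restr F = 0) :
    l.restr (spin (l.a - l.e) (l.b + l.c) F) = 0 := by
  rw [GLine.restr_eq_zero_iff]
  intro z
  have h := (GLine.forms_eq_zero hl (l.has_pt z)).1
  simp only [form1, Fin.sum_univ_three, GLine.dir] at h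
  simp [GLine.pt] at h
  simp [spin, GLine.pt]
  linear_combination (1 + z ^ 2) * h

theorem exists_eq_C_add_sum {d : ℕ} {F : MvPolynomial (Fin 3) ℝ} (hF : F.totalDegree ≤ d) :
    ∃ (a : ℝ) (G : Fin 3 → MvPolynomial (Fin 3) ℝ), (∀ i, (G i).totalDegree ≤ d - 1) ∧
      F = C a + ∑ i, X i * G i := by
  have key : ∀ S ⊆ F.support, ∃ (a : ℝ) (G : Fin 3 → MvPolynomial (Fin 3) ℝ),
      (∀ i, (G i).totalDegree ≤ d - 1) ∧
        ∑ m ∈ S, monomial m (coeff m F) = C a + ∑ i, X i * G i := by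
    intro S
    induction S using Finset.induction_on with
    | empty => exact fun _ => ⟨0, 0, by simp, by simp⟩
    | insert m S hm ih =>
      intro hS
      obtain ⟨a, G, hG, h⟩ := ih ((Finset.subset_insert m S).trans hS)
      rw [Finset.sum_insert hm, h]
      rcases eq_or_ne m 0 with rfl | hm0
      · refine ⟨coeff 0 F + a, G, hG, ?_⟩
        rw [map_add, add_assoc]
        rfl
      · obtain ⟨i, hi⟩ := Finsupp.ne_iff.1 hm0
        have hle : Finsupp.single i 1 ≤ m := by
          rw [Finsupp.single_le_iff]
          exact Nat.one_le_iff_ne_zero.2 hi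
        have hdeg : (m.sum fun _ e => e) ≤ d :=
          (le_totalDegree (hS (Finset.mem_insert_self m S))).trans hF
        set m' := m - Finsupp.single i 1 with hm'
        have hmm : Finsupp.single i 1 + m' = m := add_tsub_cancel_of_le hle
        have hsum : (m.sum fun _ e => e) = 1 + m'.sum fun _ e => e := by
          rw [← hmm, Finsupp.sum_add_index' (fun _ => rfl) (fun _ _ _ => rfl),
            Finsupp.sum_single_index rfl]
        refine ⟨a, fun j => G j + if j = i then monomial m' (coeff m F) else 0, fun j => ?_, ?_⟩
        · refine totalDegree_add_le' (hG j) ?_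
          split_ifs
          · refine (totalDegree_monomial_le _ _).trans ?_
            change (m'.sum fun _ e => e) ≤ _
            omega
          · simp
        · have : monomial m (coeff m F) = X i * monomial m' (coeff m F) := by
            rw [X, monomial_mul, hmm, one_mul]
          simp only [mul_add, Finset.sum_add_distrib, mul_ite, mul_zero, Finset.sum_ite_eq',
            Finset.mem_univ, if_true]
          rw [this]
          ring
  obtain ⟨a, G, hG, h⟩ := key _ subset_rfl
  exact ⟨a, G, hG, by rw [← h, support_sum_monomial_coeff]⟩

theorem exists_eq_affine {F : MvPolynomial (Fin 3) ℝ} (hF : F.totalDegree ≤ 1) :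
    ∃ a₀ a₁ a₂ a₃ : ℝ, F = C a₀ + C a₁ * X 0 + C a₂ * X 1 + C a₃ * X 2 := by
  obtain ⟨a, G, hG, h⟩ := exists_eq_C_add_sum hF
  have hC := fun i => totalDegree_eq_zero_iff_eq_C.1 (Nat.le_zero.1 (hG i))
  rw [Fin.sum_univ_three, hC 0, hC 1, hC 2] at h
  exact ⟨a, (G 0).coeff 0, (G 1).coeff 0, (G 2).coeff 0, h.trans (by ring)⟩

theorem exists_eq_quadratic {F : MvPolynomial (Fin 3) ℝ} (hF : F.totalDegree ≤ 2) :
    ∃ a₀ a₁ a₂ a₃ b₁₁ b₂₂ b₃₃ b₁₂ b₁₃ b₂₃ : ℝ,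
      F = C a₀ + C a₁ * X 0 + C a₂ * X 1 + C a₃ * X 2 + C b₁₁ * X 0 ^ 2 + C b₂₂ * X 1 ^ 2 +
        C b₃₃ * X 2 ^ 2 + C b₁₂ * (X 0 * X 1) + C b₁₃ * (X 0 * X 2) + C b₂₃ * (X 1 * X 2) := by
  obtain ⟨a, G, hG, h⟩ := exists_eq_C_add_sum hF
  obtain ⟨p₀, p₁, p₂, p₃, h₀⟩ := exists_eq_affine (hG 0)
  obtain ⟨q₀, q₁, q₂, q₃, h₁⟩ := exists_eq_affine (hG 1)
  obtain ⟨r₀, r₁, r₂, r₃, h₂⟩ := exists_eq_affine (hG 2)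
  rw [Fin.sum_univ_three, h₀, h₁, h₂] at h
  refine ⟨a, p₀, q₀, r₀, p₁, q₂, r₃, p₂ + q₁, p₃ + r₁, q₃ + r₂, h.trans ?_⟩
  simp only [C_add]
  ring

end QuadricSpin

section QuadricBound

open MvPolynomial

set_option maxHeartbeats 1000000 in
/-- An irreducible quadric that contains a line cannot be ruled by the rotations that act on a
given point for two distinct such points. -/
theorem not_dvd_spin {F : MvPolynomial (Fin 3) ℝ} (hF : Irreducible F) (hd : F.totalDegree ≤ 2)
    {l : GLine} (hl : l.restr F = 0) {u v u' v' : ℝ} (h : F ∣ spin u v F)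
    (h' : F ∣ spin u' v' F) : u = u' ∧ v = v' := by
  by_contra hne
  have hprime : Prime F := hF.prime
  set w₀ := u' - u with hw₀
  set w₁ := v' - v with hw₁
  have hw : 0 < w₀ ^ 2 + w₁ ^ 2 := by
    rcases not_and_or.1 hne with h0 | h0
    · have := pow_pos (abs_pos.2 (sub_ne_zero.2 (Ne.symm h0))) 2
      rw [sq_abs] at this
      positivity
    · have := pow_pos (abs_pos.2 (sub_ne_zero.2 (Ne.symm h0))) 2
      rw [sq_abs] at this
      positivity
  obtain ⟨c, hc⟩ : ∃ c : ℝ, (X 2 * C w₀ - C w₁) * pderiv 0 F + (C w₀ + X 2 * C w₁) * pderiv 1 F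
      = F * C c := by
    obtain ⟨H, hH⟩ := dvd_sub h h'
    have e : spin u v F - spin u' v' F =
        (X 2 * C w₀ - C w₁) * pderiv 0 F + (C w₀ + X 2 * C w₁) * pderiv 1 F := by
      simp only [spin, hw₀, hw₁, C_sub]
      ring
    rw [e] at hH
    rcases eq_or_ne H 0 with rfl | hH0
    · exact ⟨0, by rw [hH, C_0]⟩
    · have hF1 : 1 ≤ F.totalDegree := by
        by_contra hlt
        have h0 := totalDegree_eq_zero_iff_eq_C.1 (Nat.lt_one_iff.1 (not_le.1 hlt))
        refine hF.not_isUnit ?_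
        rw [h0]
        refine (isUnit_iff_ne_zero.2 fun h1 => hF.ne_zero ?_).map C
        rw [h0, h1, C_0]
      have hdeg : ((X 2 * C w₀ - C w₁) * pderiv 0 F +
          (C w₀ + X 2 * C w₁) * pderiv 1 F).totalDegree ≤ F.totalDegree := by
        have hXC : ∀ w : ℝ, (X 2 * C w : MvPolynomial (Fin 3) ℝ).totalDegree ≤ 1 := fun w =>
          totalDegree_mul_le' (a := 1) (b := 0) (totalDegree_X _).le (by simp) le_rfl
        refine totalDegree_add_le' ?_ ?_
        · exact totalDegree_mul_le' (totalDegree_sub_le' (hXC _) (by simp))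
            (totalDegree_pderiv_le _ _) (by omega)
        · exact totalDegree_mul_le' (totalDegree_add_le' (by simp) (hXC _))
            (totalDegree_pderiv_le _ _) (by omega)
      rw [hH, totalDegree_mul_of_isDomain hF.ne_zero hH0] at hdeg
      exact ⟨coeff 0 H, by rw [hH, ← totalDegree_eq_zero_iff_eq_C.1 (by omega : H.totalDegree = 0)]⟩
  obtain ⟨a₀, a₁, a₂, a₃, b₁₁, b₂₂, b₃₃, b₁₂, b₁₃, b₂₃, hq⟩ := exists_eq_quadratic hd
  have hG : ∀ x y z : ℝ, (z * w₀ - w₁) * (a₁ + 2 * b₁₁ * x + b₁₂ * y + b₁₃ * z) +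
      (w₀ + z * w₁) * (a₂ + 2 * b₂₂ * y + b₁₂ * x + b₂₃ * z) =
      (a₀ + a₁ * x + a₂ * y + a₃ * z + b₁₁ * x ^ 2 + b₂₂ * y ^ 2 + b₃₃ * z ^ 2 + b₁₂ * (x * y) +
        b₁₃ * (x * z) + b₂₃ * (y * z)) * c := by
    intro x y z
    have := congrArg (eval ![x, y, z]) hc
    rw [hq] at this
    simp [pderiv_X] at this
    linear_combination this
  have g0 := hG 0 0 0
  have gx := hG 1 0 0
  have gx' := hG (-1) 0 0
  have gy := hG 0 1 0
  have gy' := hG 0 (-1) 0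
  have gz := hG 0 0 1
  have gz' := hG 0 0 (-1)
  have gxy := hG 1 1 0
  have gxz := hG 1 0 1
  have gyz := hG 0 1 1
  have e1 : b₁₁ * c = 0 := by linear_combination g0 - (gx + gx') / 2
  have e2 : b₂₂ * c = 0 := by linear_combination g0 - (gy + gy') / 2
  have e3 : b₁₂ * c = 0 := by linear_combination gx + gy - gxy - g0
  have e4 : -2 * w₁ * b₁₁ + w₀ * b₁₂ = a₁ * c := by linear_combination (gx - gx') / 2
  have e5 : -w₁ * b₁₂ + 2 * w₀ * b₂₂ = a₂ * c := by linear_combination (gy - gy') / 2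
  have e6 : w₀ * a₁ + w₁ * a₂ - w₁ * b₁₃ + w₀ * b₂₃ = a₃ * c := by
    linear_combination (gz - gz') / 2
  have e7 : w₀ * b₁₃ + w₁ * b₂₃ = b₃₃ * c := by linear_combination (gz + gz') / 2 - g0
  have e8 : 2 * w₀ * b₁₁ + w₁ * b₁₂ = b₁₃ * c := by linear_combination gxz - gx - gz + g0
  have e9 : w₀ * b₁₂ + 2 * w₁ * b₂₂ = b₂₃ * c := by linear_combination gyz - gy - gz + g0
  have e0 : -w₁ * a₁ + w₀ * a₂ = a₀ * c := by linear_combination g0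
  clear g0 gx gx' gy gy' gz gz' gxy gxz gyz hG
  have hc0 : c = 0 := by
    by_contra hcne
    have z1 : b₁₁ = 0 := (mul_eq_zero.1 e1).resolve_right hcne
    have z2 : b₂₂ = 0 := (mul_eq_zero.1 e2).resolve_right hcne
    have z3 : b₁₂ = 0 := (mul_eq_zero.1 e3).resolve_right hcne
    have z4 : a₁ = 0 := (mul_eq_zero.1 (e4.symm.trans (by rw [z1, z3]; ring))).resolve_right hcne
    have z5 : a₂ = 0 := (mul_eq_zero.1 (e5.symm.trans (by rw [z2, z3]; ring))).resolve_right hcne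
    have z8 : b₁₃ = 0 := (mul_eq_zero.1 (e8.symm.trans (by rw [z1, z3]; ring))).resolve_right hcne
    have z9 : b₂₃ = 0 := (mul_eq_zero.1 (e9.symm.trans (by rw [z2, z3]; ring))).resolve_right hcne
    have z6 : a₃ = 0 :=
      (mul_eq_zero.1 (e6.symm.trans (by rw [z4, z5, z8, z9]; ring))).resolve_right hcne
    have z7 : b₃₃ = 0 := (mul_eq_zero.1 (e7.symm.trans (by rw [z8, z9]; ring))).resolve_right hcne
    have z0 : a₀ = 0 := (mul_eq_zero.1 (e0.symm.trans (by rw [z4, z5]; ring))).resolve_right hcne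
    refine hF.ne_zero (hq.trans ?_)
    simp [z1, z2, z3, z4, z5, z6, z7, z8, z9, z0]
  subst hc0
  simp only [mul_zero] at e4 e5 e6 e7 e8 e9 e0
  have z1 : b₁₁ = 0 := by
    have : (w₀ ^ 2 + w₁ ^ 2) * b₁₁ = 0 := by linear_combination (w₀ * e8 - w₁ * e4) / 2
    exact (mul_eq_zero.1 this).resolve_left hw.ne'
  have z3 : b₁₂ = 0 := by
    have : (w₀ ^ 2 + w₁ ^ 2) * b₁₂ = 0 := by linear_combination w₁ * e8 + w₀ * e4
    exact (mul_eq_zero.1 this).resolve_left hw.ne'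
  have z2 : b₂₂ = 0 := by
    have : (w₀ ^ 2 + w₁ ^ 2) * b₂₂ = 0 := by linear_combination (w₁ * e9 + w₀ * e5) / 2
    exact (mul_eq_zero.1 this).resolve_left hw.ne'
  obtain ⟨κ, k1, k2, k3, k4⟩ : ∃ κ : ℝ, a₁ = -κ * w₀ ∧ a₂ = -κ * w₁ ∧ b₁₃ = -κ * w₁ ∧
      b₂₃ = κ * w₀ := by
    refine ⟨-(w₀ * a₁ + w₁ * a₂) / (w₀ ^ 2 + w₁ ^ 2), ?_, ?_, ?_, ?_⟩
    · field_simp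
      linear_combination -w₁ * e0
    · field_simp
      linear_combination w₀ * e0
    · field_simp
      linear_combination w₀ * e7 - w₁ * e6
    · field_simp
      linear_combination w₁ * e7 + w₀ * e6
  subst z1 z2 z3 k1 k2 k3 k4
  set Λ : MvPolynomial (Fin 3) ℝ := C (κ * (w₁ * u - w₀ * v) + a₃) + C (-2 * κ * w₁) * X 0 +
    C (2 * κ * w₀) * X 1 + C (2 * b₃₃) * X 2 with hΛ
  have hspin : spin u v F = (1 + X 2 ^ 2) * Λ := by
    refine MvPolynomial.funext fun x => ?_
    rw [hq]
    simp [spin, hΛ, pderiv_X]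
    ring
  have hunit : ∀ a : ℝ, F ≠ C a := fun a ha => by
    refine hF.not_isUnit ?_
    rw [ha]
    refine (isUnit_iff_ne_zero.2 fun h1 => hF.ne_zero ?_).map C
    rw [ha, h1, C_0]
  rw [hspin] at h
  rcases hprime.dvd_or_dvd h with hdvd | hdvd
  · obtain ⟨H, hH⟩ := hdvd
    have h0 := (l.restr_eq_zero_iff F).1 hl 0
    have := congrArg (eval (l.pt 0)) hH
    rw [map_mul, h0] at this
    simp [GLine.pt] at this
  · have hconst : κ = 0 → b₃₃ = 0 → Λ = C a₃ := by
      rintro hκ hb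
      simp [hΛ, hκ, hb]
    rcases eq_or_ne Λ 0 with h0 | h0
    · have hev : ∀ x y z : ℝ, κ * (w₁ * u - w₀ * v) + a₃ + -2 * κ * w₁ * x + 2 * κ * w₀ * y +
          2 * b₃₃ * z = 0 := by
        intro x y z
        have := congrArg (eval ![x, y, z]) h0
        simp [hΛ] at this
        linear_combination this
      have hb : b₃₃ = 0 := by linear_combination (hev 0 0 1 - hev 0 0 0) / 2
      have hκ : κ = 0 := by
        have : (w₀ ^ 2 + w₁ ^ 2) * κ = 0 := by
          linear_combination w₀ * (hev 0 1 0 - hev 0 0 0) / 2 - w₁ * (hev 1 0 0 - hev 0 0 0) / 2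
        exact (mul_eq_zero.1 this).resolve_left hw.ne'
      have ha : a₃ = 0 := by
        have := hev 0 0 0
        rw [hκ] at this
        linear_combination this
      exact hunit a₀ (by rw [hq]; simp [hb, hκ, ha])
    · have hΛd : Λ.totalDegree ≤ 1 := by
        have hCX : ∀ (w : ℝ) (i : Fin 3), (C w * X i : MvPolynomial (Fin 3) ℝ).totalDegree ≤ 1 :=
          fun w i => totalDegree_mul_le' (a := 0) (b := 1) (by simp) (totalDegree_X _).le le_rfl
        exact totalDegree_add_le' (totalDegree_add_le' (totalDegree_add_le'
          ((totalDegree_C _).trans_le zero_le_one) (hCX _ _)) (hCX _ _)) (hCX _ _)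
      obtain ⟨r₀, r₁, r₂, r₃, hr⟩ :=
        exists_eq_affine ((totalDegree_le_of_dvd_of_isDomain hdvd h0).trans hΛd)
      have hev : ∀ x y z : ℝ, a₀ + -κ * w₀ * x + -κ * w₁ * y + a₃ * z + b₃₃ * z ^ 2 +
          -κ * w₁ * (x * z) + κ * w₀ * (y * z) = r₀ + r₁ * x + r₂ * y + r₃ * z := by
        intro x y z
        have := congrArg (eval ![x, y, z]) (hq.symm.trans hr)
        simp at this
        linear_combination this
      have hb : b₃₃ = 0 := by linear_combination (hev 0 0 1 + hev 0 0 (-1)) / 2 - hev 0 0 0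
      have hκ : κ = 0 := by
        have : (w₀ ^ 2 + w₁ ^ 2) * κ = 0 := by
          linear_combination w₀ * (hev 0 1 1 - hev 0 1 0 - hev 0 0 1 + hev 0 0 0) -
            w₁ * (hev 1 0 1 - hev 1 0 0 - hev 0 0 1 + hev 0 0 0)
        exact (mul_eq_zero.1 this).resolve_left hw.ne'
      rw [hconst hκ hb] at hdvd h0
      refine hF.not_isUnit (isUnit_of_dvd_unit hdvd ?_)
      exact (isUnit_iff_ne_zero.2 fun h1 => h0 (by rw [h1, C_0])).map C

end QuadricBound

section ElekesSharir

open MvPolynomial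

/-- The line parametrizing the rotations that map `p` to `q`, up to translations. -/
noncomputable def esLine (p q : EuclideanSpace ℝ (Fin 2)) : GLine where
  a := (p 0 + q 0) / 2
  b := (p 1 + q 1) / 2
  c := -(q 1 - p 1) / 2
  e := (q 0 - p 0) / 2

/-- The lines attached to all pairs of points of `P`. -/
noncomputable def esLines (P : Finset (EuclideanSpace ℝ (Fin 2))) : Finset GLine :=
  (P ×ˢ P).image fun x => esLine x.1 x.2

theorem esLine_src (p q : EuclideanSpace ℝ (Fin 2)) :
    (esLine p q).a - (esLine p q).e = p 0 ∧ (esLine p q).b + (esLine p q).c = p 1 := by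
  constructor <;> simp only [esLine] <;> ring

theorem esLine_injective {p q p' q' : EuclideanSpace ℝ (Fin 2)} (h : esLine p q = esLine p' q') :
    p = p' ∧ q = q' := by
  rw [GLine.ext_iff] at h
  obtain ⟨ha, hb, hc, he⟩ := h
  simp only [esLine] at ha hb hc he
  constructor <;> ext i <;> fin_cases i <;> simp <;> linarith

/-- Lines with a common source are disjoint. -/
theorem GLine.eq_of_src_eq {l m : GLine} {x : Fin 3 → ℝ} (hl : l.Has x) (hm : m.Has x)
    (h₀ : l.a - l.e = m.a - m.e) (h₁ : l.b + l.c = m.b + m.c) : l = m := by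
  obtain ⟨hl0, hl1⟩ := hl
  obtain ⟨hm0, hm1⟩ := hm
  have key : (1 + x 2 ^ 2) * (l.e - m.e) = 0 := by
    linear_combination hm0 - hl0 - h₀ + x 2 * (hm1 - hl1) - x 2 * h₁
  have hz : (1 + x 2 ^ 2) ≠ 0 := by positivity
  have he : l.e = m.e := sub_eq_zero.1 ((mul_eq_zero.1 key).resolve_left hz)
  have key' : (1 + x 2 ^ 2) * (l.c - m.c) = 0 := by
    linear_combination hl1 - hm1 + h₁ + x 2 * (hm0 - hl0) - x 2 * h₀
  have hc : l.c = m.c := sub_eq_zero.1 ((mul_eq_zero.1 key').resolve_left hz)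
  ext
  · linarith
  · linarith
  · exact hc
  · exact he

/-- Lines whose sources are as far apart as their targets meet or are parallel. -/
theorem exists_has_of_dist_eq {p q p' q' : EuclideanSpace ℝ (Fin 2)}
    (h : dist p q = dist p' q') (hne : p' - q' ≠ p - q) :
    ∃ x, (esLine p p').Has x ∧ (esLine q q').Has x := by
  have hsq : (p 0 - q 0) ^ 2 + (p 1 - q 1) ^ 2 = (p' 0 - q' 0) ^ 2 + (p' 1 - q' 1) ^ 2 := by
    rw [EuclideanSpace.dist_eq, EuclideanSpace.dist_eq, Real.sqrt_inj (by positivity)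
      (by positivity)] at h
    simpa [Fin.sum_univ_two, Real.dist_eq, sq_abs] using h
  set d₀ := (p' 0 - q' 0) - (p 0 - q 0) with hd₀
  set d₁ := (p' 1 - q' 1) - (p 1 - q 1) with hd₁
  set s₀ := ((p' 0 - q' 0) + (p 0 - q 0)) / 2 with hs₀
  set s₁ := ((p' 1 - q' 1) + (p 1 - q 1)) / 2 with hs₁
  have hsd : s₀ * d₀ + s₁ * d₁ = 0 := by
    rw [hs₀, hs₁, hd₀, hd₁]
    linear_combination -hsq / 2
  have hd : 0 < d₀ ^ 2 + d₁ ^ 2 := by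
    by_contra hle
    have h0 : d₀ = 0 := by nlinarith [sq_nonneg d₀, sq_nonneg d₁]
    have h1 : d₁ = 0 := by nlinarith [sq_nonneg d₀, sq_nonneg d₁]
    refine hne ?_
    ext i
    fin_cases i <;> simp <;> linarith
  set z := 2 * (s₀ * d₁ - s₁ * d₀) / (d₀ ^ 2 + d₁ ^ 2) with hz
  have hz0 : s₀ = z * d₁ / 2 := by
    rw [hz]
    field_simp
    linear_combination d₀ * hsd
  have hz1 : s₁ = -z * d₀ / 2 := by
    rw [hz]
    field_simp
    linear_combination d₁ * hsd
  refine ⟨(esLine p p').pt z, GLine.has_pt _ _, ?_⟩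
  constructor
  · simp [GLine.pt, esLine]
    linear_combination hz0
  · simp [GLine.pt, esLine]
    linear_combination hz1

variable (P : Finset (EuclideanSpace ℝ (Fin 2)))

theorem card_linesAt_esLines_le (x : Fin 3 → ℝ) : (linesAt (esLines P) x).card ≤ P.card := by
  have h : ∀ l ∈ linesAt (esLines P) x, ∃ p ∈ P, l.a - l.e = p 0 ∧ l.b + l.c = p 1 := by
    intro l hl
    obtain ⟨y, hy, rfl⟩ := Finset.mem_image.1 (mem_linesAt.1 hl).1
    exact ⟨y.1, (Finset.mem_product.1 hy).1, esLine_src _ _⟩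
  choose! src hsrc h₀ h₁ using h
  refine Finset.card_le_card_of_injOn src hsrc fun l hl m hm hlm => ?_
  refine GLine.eq_of_src_eq (mem_linesAt.1 hl).2 (mem_linesAt.1 hm).2 ?_ ?_
  · rw [h₀ l hl, h₀ m hm, hlm]
  · rw [h₁ l hl, h₁ m hm, hlm]

theorem card_esLines_quadric_le {F : MvPolynomial (Fin 3) ℝ} (hF : Irreducible F)
    (hd : F.totalDegree ≤ 2) : ((esLines P).filter fun l => l.restr F = 0).card ≤ 7 * P.card := by
  set S : EuclideanSpace ℝ (Fin 2) → Finset GLine := fun p =>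
    (P.image fun q => esLine p q).filter fun l => l.restr F = 0 with hS
  have hcover : ((esLines P).filter fun l => l.restr F = 0) ⊆ P.biUnion S := by
    intro l hl
    rw [Finset.mem_filter] at hl
    obtain ⟨y, hy, rfl⟩ := Finset.mem_image.1 hl.1
    rw [Finset.mem_product] at hy
    exact Finset.mem_biUnion.2 ⟨y.1, hy.1, Finset.mem_filter.2
      ⟨Finset.mem_image_of_mem _ hy.2, hl.2⟩⟩
  have hcard : ∀ p, (S p).card ≤ P.card := fun p =>
    (Finset.card_filter_le _ _).trans Finset.card_image_le
  have hsmall : ∀ p, ¬ F ∣ spin (p 0) (p 1) F → (S p).card ≤ 6 := by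
    intro p hp
    refine (line_bezout hF hp (S p) fun l hl => ?_).trans ?_
    · rw [hS, Finset.mem_filter] at hl
      obtain ⟨q, -, rfl⟩ := Finset.mem_image.1 hl.1
      have := GLine.restr_spin hl.2
      rw [(esLine_src p q).1, (esLine_src p q).2] at this
      exact ⟨hl.2, this⟩
    · calc _ ≤ 2 * 3 := Nat.mul_le_mul hd ((totalDegree_spin_le _ _ _).trans (by omega))
        _ = 6 := rfl
  rcases ((esLines P).filter fun l => l.restr F = 0).eq_empty_or_nonempty with h0 | ⟨l, hl⟩
  · simp [h0]
  · have hl := (Finset.mem_filter.1 hl).2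
    refine (Finset.card_le_card hcover).trans (Finset.card_biUnion_le.trans ?_)
    have hone : (P.filter fun p => F ∣ spin (p 0) (p 1) F).card ≤ 1 := by
      rw [Finset.card_le_one]
      intro p hp q hq
      have := not_dvd_spin hF hd hl (Finset.mem_filter.1 hp).2 (Finset.mem_filter.1 hq).2
      ext i
      fin_cases i
      exacts [this.1, this.2]
    rw [← Finset.sum_filter_add_sum_filter_not P fun p => F ∣ spin (p 0) (p 1) F]
    have h1 : ∑ p ∈ P.filter (fun p => F ∣ spin (p 0) (p 1) F), (S p).card ≤ 1 * P.card :=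
      (Finset.sum_le_card_nsmul _ _ _ fun p _ => hcard p).trans (Nat.mul_le_mul_right _ hone)
    have h2 : ∑ p ∈ P.filter (fun p => ¬ F ∣ spin (p 0) (p 1) F), (S p).card ≤ P.card * 6 :=
      (Finset.sum_le_card_nsmul _ _ _ fun p hp => hsmall p (Finset.mem_filter.1 hp).2).trans
        (Nat.mul_le_mul_right _ (Finset.card_filter_le _ _))
    omega

theorem lineSystem_esLines : LineSystem P.card (esLines P) where
  card_le := by
    refine Finset.card_image_le.trans ?_
    rw [Finset.card_product, sq]
  quadric F hF hd := card_esLines_quadric_le P hF hd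
  rich := card_linesAt_esLines_le P

/-- Pairs at a given distance are counted by lines that meet a given line. -/
theorem card_pairs_le {q q' : EuclideanSpace ℝ (Fin 2)} :
    ((P ×ˢ P).filter fun y => dist y.1 q = dist y.2 q').card ≤ P.card +
      ((esLines P).filter fun l => l ≠ esLine q q' ∧
        ∃ x, l.Has x ∧ (esLine q q').Has x).card := by
  rw [← Finset.card_filter_add_card_filter_not (p := fun y => y.2 - q' = y.1 - q)]
  refine add_le_add ?_ ?_
  · refine Finset.card_le_card_of_injOn Prod.fst (fun y hy => ?_) fun y hy y' hy' h => ?_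
    · exact (Finset.mem_product.1 (Finset.mem_filter.1 (Finset.mem_filter.1 hy).1).1).1
    · have h1 := (Finset.mem_filter.1 hy).2
      have h2 := (Finset.mem_filter.1 hy').2
      rw [h, ← h2] at h1
      exact Prod.ext h (sub_left_injective h1)
  · refine Finset.card_le_card_of_injOn (fun y => esLine y.1 y.2) (fun y hy => ?_)
      fun y hy y' hy' h => Prod.ext (esLine_injective h).1 (esLine_injective h).2
    have h1 := Finset.mem_filter.1 hy
    have h2 := Finset.mem_filter.1 h1.1
    refine Finset.mem_filter.2 ⟨Finset.mem_image_of_mem _ h2.1, fun h => h1.2 ?_,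
      exists_has_of_dist_eq h2.2 h1.2⟩
    rw [(esLine_injective h).1, (esLine_injective h).2, sub_self, sub_self]

end ElekesSharir

section Energy

theorem sum_sq_le_sum_level {ι : Type*} (s : Finset ι) (f : ι → ℕ) {N : ℕ}
    (hf : ∀ i ∈ s, f i ≤ N) :
    ∑ i ∈ s, f i ^ 2 ≤ ∑ t ∈ Finset.Icc 1 N, 2 * t * (s.filter fun i => t ≤ f i).card := by
  have hsq : ∀ m : ℕ, m ^ 2 ≤ ∑ t ∈ Finset.Icc 1 m, 2 * t := by
    intro m
    induction m with
    | zero => simp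
    | succ m ih =>
      rw [Finset.sum_Icc_succ_top (by omega)]
      nlinarith
  calc ∑ i ∈ s, f i ^ 2 ≤ ∑ i ∈ s, ∑ t ∈ Finset.Icc 1 N, if t ≤ f i then 2 * t else 0 := by
        refine Finset.sum_le_sum fun i hi => (hsq (f i)).trans ?_
        rw [← Finset.sum_filter]
        refine Finset.sum_le_sum_of_subset fun t ht => ?_
        rw [Finset.mem_Icc] at ht
        rw [Finset.mem_filter, Finset.mem_Icc]
        exact ⟨⟨ht.1, ht.2.trans (hf i hi)⟩, ht.2⟩
    _ = _ := by
        rw [Finset.sum_comm]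
        refine Finset.sum_congr rfl fun t _ => ?_
        rw [← Finset.sum_filter, Finset.sum_const, smul_eq_mul, mul_comm]

/-- The number of lines of `L` other than `m` that meet `m`. -/
noncomputable def meetCount (L : Finset GLine) (m : GLine) : ℕ :=
  (L.filter fun l => l ≠ m ∧ ∃ x, l.Has x ∧ m.Has x).card

theorem exists_crossing_points (L : Finset GLine) : ∃ X : Finset (Fin 3 → ℝ),
    ∀ l ∈ L, ∀ m ∈ L, (∃ x, l.Has x ∧ m.Has x) → ∃ x ∈ X, l.Has x ∧ m.Has x := by
  refine ⟨(L ×ˢ L).image fun y => if h : ∃ x, y.1.Has x ∧ y.2.Has x then h.choose else 0,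
    fun l hl m hm h => ⟨_, Finset.mem_image_of_mem _ (Finset.mk_mem_product hl hm), ?_⟩⟩
  simp only [dif_pos h]
  exact h.choose_spec

theorem meetCount_le_sum {n : ℕ} {L : Finset GLine} (hL : LineSystem n L)
    {X : Finset (Fin 3 → ℝ)} {m : GLine} (hm : m ∈ L)
    (hX : ∀ l ∈ L, ∀ m ∈ L, (∃ x, l.Has x ∧ m.Has x) → ∃ x ∈ X, l.Has x ∧ m.Has x) :
    meetCount L m ≤
      ∑ k ∈ Finset.Icc 2 n, (m.ptsOn (X.filter fun x => k ≤ (linesAt L x).card)).card := by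
  calc meetCount L m ≤ ((m.ptsOn X).biUnion fun x => (linesAt L x).erase m).card := by
        refine Finset.card_le_card fun l hl => ?_
        obtain ⟨hlL, hlm, hex⟩ := Finset.mem_filter.1 hl
        obtain ⟨x, hxX, hlx, hmx⟩ := hX l hlL m hm hex
        exact Finset.mem_biUnion.2 ⟨x, GLine.mem_ptsOn.2 ⟨hxX, hmx⟩,
          Finset.mem_erase.2 ⟨hlm, mem_linesAt.2 ⟨hlL, hlx⟩⟩⟩
    _ ≤ ∑ x ∈ m.ptsOn X, ((linesAt L x).erase m).card := Finset.card_biUnion_le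
    _ = ∑ x ∈ m.ptsOn X, ((Finset.Icc 2 n).filter fun k => k ≤ (linesAt L x).card).card := by
        refine Finset.sum_congr rfl fun x hx => ?_
        rw [Finset.card_erase_of_mem (mem_linesAt.2 ⟨hm, (GLine.mem_ptsOn.1 hx).2⟩)]
        have h : ((Finset.Icc 2 n).filter fun k => k ≤ (linesAt L x).card) =
            Finset.Icc 2 (linesAt L x).card := by
          ext k
          have := hL.rich x
          simp only [Finset.mem_filter, Finset.mem_Icc]
          omega
        rw [h, Nat.card_Icc]
        omega
    _ = _ := by
        simp only [Finset.card_filter]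
        rw [Finset.sum_comm]
        refine Finset.sum_congr rfl fun k _ => ?_
        rw [← Finset.card_filter]
        congr 1
        ext x
        simp only [Finset.mem_filter, GLine.mem_ptsOn]
        tauto

theorem card_ptsOn_rich_le {n : ℕ} {L : Finset GLine} (hL : LineSystem n L) {k : ℕ} (hk : 2 ≤ k)
    {X : Finset (Fin 3 → ℝ)} (hX : ∀ x ∈ X, k ≤ (linesAt L x).card) (m : GLine) :
    (m.ptsOn X).card ≤ n ^ 2 := by
  refine le_trans ?_ ((sum_card_linesAt_erase_le m L (m.ptsOn X) fun x hx =>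
    (GLine.mem_ptsOn.1 hx).2).trans hL.card_le)
  rw [Finset.card_eq_sum_ones]
  refine Finset.sum_le_sum fun x hx => ?_
  have h1 := hX x (GLine.mem_ptsOn.1 hx).1
  have h2 := Finset.pred_card_le_card_erase (a := m) (s := linesAt L x)
  omega

theorem sum_inv_le_one_add_log (n : ℕ) :
    ∑ k ∈ Finset.Icc 1 n, (k : ℝ)⁻¹ ≤ 1 + Real.log n := by
  have h := harmonic_le_one_add_log n
  rw [harmonic_eq_sum_Icc] at h
  push_cast at h
  exact h

/-- Summation of second moments by the Cauchy–Schwarz inequality with weights `k⁻¹`. -/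
theorem sum_sq_le_of_moment {ι : Type*} (s : Finset ι) (N : ι → ℝ) (c : ℕ → ι → ℝ) {n : ℕ} {W : ℝ}
    (hN0 : ∀ i ∈ s, 0 ≤ N i) (hN : ∀ i ∈ s, N i ≤ ∑ k ∈ Finset.Icc 2 n, c k i)
    (hc : ∀ k, 2 ≤ k → (∑ i ∈ s, c k i ^ 2) * k ^ 2 ≤ W) :
    ∑ i ∈ s, N i ^ 2 ≤ W * (∑ k ∈ Finset.Icc 1 n, (k : ℝ)⁻¹) ^ 2 := by
  have hW : 0 ≤ W := le_trans
    (mul_nonneg (Finset.sum_nonneg fun i _ => sq_nonneg _) (sq_nonneg _)) (hc 2 le_rfl)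
  set H := ∑ k ∈ Finset.Icc 1 n, (k : ℝ)⁻¹ with hH
  have hH0 : 0 ≤ H := Finset.sum_nonneg fun k _ => by positivity
  have hle : ∑ k ∈ Finset.Icc 2 n, (k : ℝ)⁻¹ ≤ H :=
    Finset.sum_le_sum_of_subset_of_nonneg (Finset.Icc_subset_Icc_left one_le_two)
      fun k _ _ => by positivity
  have hpos : ∀ k ∈ Finset.Icc 2 n, (0 : ℝ) < k := fun k hk => by
    have := (Finset.mem_Icc.1 hk).1
    exact_mod_cast (by omega : 0 < k)
  have hcs : ∀ i ∈ s, N i ^ 2 ≤ H * ∑ k ∈ Finset.Icc 2 n, k * c k i ^ 2 := fun i hi => by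
    refine (pow_le_pow_left₀ (hN0 i hi) (hN i hi) 2).trans ?_
    refine (Finset.sum_sq_le_sum_mul_sum_of_sq_le_mul (Finset.Icc 2 n)
      (f := fun k => (k : ℝ)⁻¹) (g := fun k => k * c k i ^ 2) (fun k _ => by positivity)
      (fun k _ => by positivity) fun k hk => ?_).trans ?_
    · rw [inv_mul_cancel_left₀ (hpos k hk).ne']
    · exact mul_le_mul_of_nonneg_right hle (Finset.sum_nonneg fun k _ => by positivity)
  calc ∑ i ∈ s, N i ^ 2 ≤ ∑ i ∈ s, H * ∑ k ∈ Finset.Icc 2 n, k * c k i ^ 2 :=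
        Finset.sum_le_sum hcs
    _ = H * ∑ k ∈ Finset.Icc 2 n, k * ∑ i ∈ s, c k i ^ 2 := by
        rw [← Finset.mul_sum, Finset.sum_comm]
        simp only [Finset.mul_sum]
    _ ≤ H * ∑ k ∈ Finset.Icc 2 n, W * (k : ℝ)⁻¹ := by
        refine mul_le_mul_of_nonneg_left (Finset.sum_le_sum fun k hk => ?_) hH0
        have := hc k (Finset.mem_Icc.1 hk).1
        rw [← div_eq_mul_inv, le_div_iff₀ (hpos k hk)]
        linarith
    _ ≤ H * (W * H) := by
        rw [← Finset.mul_sum]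
        exact mul_le_mul_of_nonneg_left (mul_le_mul_of_nonneg_left hle hW) hH0
    _ = W * H ^ 2 := by ring

/-- The second moment of the number of rich points on a line. -/
theorem exists_sum_card_ptsOn_sq_le : ∃ C : ℝ, 1 ≤ C ∧ ∀ (n : ℕ) (L : Finset GLine),
    LineSystem n L → ∀ k, 2 ≤ k → ∀ X : Finset (Fin 3 → ℝ), (∀ x ∈ X, k ≤ (linesAt L x).card) →
      (∑ m ∈ L, ((m.ptsOn X).card : ℝ) ^ 2) * k ^ 2 ≤
        C * n ^ 4 * ∑ t ∈ Finset.Icc 1 (n ^ 2), (t : ℝ)⁻¹ := by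
  obtain ⟨C, hC, hrich⟩ := exists_card_lines_rich_le
  refine ⟨2 * C, by linarith, fun n L hL k hk X hX => ?_⟩
  have h1 : ∑ m ∈ L, ((m.ptsOn X).card : ℝ) ^ 2 ≤ ∑ t ∈ Finset.Icc 1 (n ^ 2),
      2 * t * ((L.filter fun m => t ≤ (m.ptsOn X).card).card : ℝ) := by
    exact_mod_cast sum_sq_le_sum_level L (fun m => (m.ptsOn X).card) fun m _ =>
      card_ptsOn_rich_le hL hk hX m
  refine (mul_le_mul_of_nonneg_right h1 (by positivity)).trans ?_
  rw [Finset.sum_mul, Finset.mul_sum]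
  refine Finset.sum_le_sum fun t ht => ?_
  have ht1 := (Finset.mem_Icc.1 ht).1
  have ht0 : (0 : ℝ) < t := by exact_mod_cast ht1
  have h2 := hrich n L hL k t hk ht1 X hX
  rw [← div_eq_mul_inv, le_div_iff₀ ht0]
  linear_combination 2 * h2

theorem exists_sum_meetCount_sq_le : ∃ C : ℝ, 1 ≤ C ∧ ∀ (n : ℕ) (L : Finset GLine),
    LineSystem n L → ∑ m ∈ L, (meetCount L m : ℝ) ^ 2 ≤
      C * n ^ 4 * (∑ k ∈ Finset.Icc 1 n, (k : ℝ)⁻¹) ^ 2 *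
        ∑ t ∈ Finset.Icc 1 (n ^ 2), (t : ℝ)⁻¹ := by
  obtain ⟨C, hC, hmoment⟩ := exists_sum_card_ptsOn_sq_le
  refine ⟨C, hC, fun n L hL => ?_⟩
  obtain ⟨X, hX⟩ := exists_crossing_points L
  refine (sum_sq_le_of_moment L _
    (fun k m => ((m.ptsOn (X.filter fun x => k ≤ (linesAt L x).card)).card : ℝ))
    (fun m _ => Nat.cast_nonneg _) (fun m hm => by exact_mod_cast meetCount_le_sum hL hm hX)
    fun k hk => hmoment n L hL k hk _ fun x hx => (Finset.mem_filter.1 hx).2).trans_eq ?_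
  ring

/-- The hinge energy, as a sum over the pairs of middle points. -/
theorem card_hinge_pairs_le (P : Finset (EuclideanSpace ℝ (Fin 2))) :
    (((P ×ˢ P ×ˢ P) ×ˢ (P ×ˢ P ×ˢ P)).filter (fun x =>
      dist x.1.1 x.1.2.1 = dist x.2.1 x.2.2.1 ∧
        dist x.1.2.2 x.1.2.1 = dist x.2.2.2 x.2.2.1)).card ≤
      ∑ w ∈ P ×ˢ P, ((P ×ˢ P).filter fun y => dist y.1 w.1 = dist y.2 w.2).card ^ 2 := by
  rw [Finset.card_eq_sum_card_fiberwise (f := fun x => (x.1.2.1, x.2.2.1)) (t := P ×ˢ P)]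
  · refine Finset.sum_le_sum fun w _ => ?_
    rw [sq, ← Finset.card_product]
    refine Finset.card_le_card_of_injOn (fun x => ((x.1.1, x.2.1), (x.1.2.2, x.2.2.2)))
      (fun x hx => ?_) fun x hx x' hx' h => ?_
    · simp only [Finset.coe_filter, Finset.mem_filter, Finset.mem_product, Set.mem_ofPred_eq,
        Finset.coe_product, Set.mem_prod] at hx ⊢
      obtain ⟨⟨h1, h2⟩, rfl⟩ := hx
      exact ⟨⟨⟨h1.1.1, h1.2.1⟩, h2.1⟩, ⟨h1.1.2.2, h1.2.2.2⟩, h2.2⟩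
    · have h1 := (Finset.mem_filter.1 hx).2
      have h2 := (Finset.mem_filter.1 hx').2
      simp only [← h2, Prod.mk.injEq] at h h1
      ext1 <;> ext1
      exacts [h.1.1, Prod.ext h1.1 h.2.1, h.1.2, Prod.ext h1.2 h.2.2]
  · intro x hx
    simp only [Finset.coe_filter, Finset.mem_product, Set.mem_ofPred_eq, Finset.coe_product,
      Set.mem_prod, Finset.mem_coe] at hx ⊢
    exact ⟨hx.1.1.2.1, hx.1.2.2.1⟩

theorem sum_card_pairs_sq_le (P : Finset (EuclideanSpace ℝ (Fin 2))) :
    (∑ w ∈ P ×ˢ P, (((P ×ˢ P).filter fun y => dist y.1 w.1 = dist y.2 w.2).card : ℝ) ^ 2) ≤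
      2 * P.card ^ 4 + 2 * ∑ m ∈ esLines P, (meetCount (esLines P) m : ℝ) ^ 2 := by
  have hinj : Set.InjOn (fun x : EuclideanSpace ℝ (Fin 2) × EuclideanSpace ℝ (Fin 2) =>
      esLine x.1 x.2) (P ×ˢ P : Finset _) := fun x _ y _ h =>
    Prod.ext (esLine_injective h).1 (esLine_injective h).2
  rw [esLines, Finset.sum_image hinj, ← esLines]
  calc _ ≤ ∑ w ∈ P ×ˢ P, (2 * (P.card : ℝ) ^ 2 +
        2 * (meetCount (esLines P) (esLine w.1 w.2) : ℝ) ^ 2) := by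
        refine Finset.sum_le_sum fun w _ => ?_
        have h : (((P ×ˢ P).filter fun y => dist y.1 w.1 = dist y.2 w.2).card : ℝ) ≤
            P.card + meetCount (esLines P) (esLine w.1 w.2) := by
          exact_mod_cast card_pairs_le P
        calc _ ≤ (P.card + meetCount (esLines P) (esLine w.1 w.2) : ℝ) ^ 2 := by gcongr
          _ ≤ _ := by
            nlinarith [sq_nonneg ((P.card : ℝ) - meetCount (esLines P) (esLine w.1 w.2))]
    _ = _ := by
        rw [Finset.sum_add_distrib, Finset.sum_const, Finset.card_product, nsmul_eq_mul,
          Finset.mul_sum]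
        push_cast
        ring

end Energy

/-- **Hinge energy bound.** There is an absolute constant `C > 0` such that for every
finite set `P` of `n` points in the plane, with `n` sufficiently large, the number of
pairs of triples `((p,q,r),(p',q',r')) ∈ P³ × P³` with `‖p−q‖ = ‖p'−q'‖` and
`‖r−q‖ = ‖r'−q'‖` is at most `C · n⁴ · (log n)³`. -/
theorem hinge_energy_upper_bound :
    ∃ C : ℝ, 0 < C ∧ ∃ N₀ : ℕ, ∀ n : ℕ, N₀ ≤ n →
      ∀ P : Finset (EuclideanSpace ℝ (Fin 2)), P.card = n →
        ((((P ×ˢ P ×ˢ P) ×ˢ (P ×ˢ P ×ˢ P)).filter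
            (fun x => dist x.1.1 x.1.2.1 = dist x.2.1 x.2.2.1 ∧
                      dist x.1.2.2 x.1.2.1 = dist x.2.2.2 x.2.2.1)).card : ℝ)
          ≤ C * (n : ℝ) ^ 4 * (Real.log n) ^ 3 := by
  obtain ⟨C, hC, hmeet⟩ := exists_sum_meetCount_sq_le
  refine ⟨2 + 24 * C, by linarith, 3, fun n hn P hP => ?_⟩
  subst hP
  set n := P.card
  have hn3 : (3 : ℝ) ≤ n := by exact_mod_cast hn
  have hlog : 1 ≤ Real.log n := by
    rw [Real.le_log_iff_exp_le (by linarith)]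
    exact Real.exp_one_lt_three.le.trans hn3
  have h1 : ∑ k ∈ Finset.Icc 1 n, (k : ℝ)⁻¹ ≤ 2 * Real.log n := by
    have := sum_inv_le_one_add_log n
    linarith
  have h2 : ∑ t ∈ Finset.Icc 1 (n ^ 2), (t : ℝ)⁻¹ ≤ 3 * Real.log n := by
    have := sum_inv_le_one_add_log (n ^ 2)
    rw [Nat.cast_pow, Real.log_pow] at this
    push_cast at this
    linarith
  calc _ ≤ ∑ w ∈ P ×ˢ P,
        (((P ×ˢ P).filter fun y => dist y.1 w.1 = dist y.2 w.2).card : ℝ) ^ 2 := by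
        exact_mod_cast card_hinge_pairs_le P
    _ ≤ 2 * n ^ 4 + 2 * ∑ m ∈ esLines P, (meetCount (esLines P) m : ℝ) ^ 2 :=
        sum_card_pairs_sq_le P
    _ ≤ 2 * n ^ 4 * Real.log n ^ 3 +
        2 * (C * n ^ 4 * (2 * Real.log n) ^ 2 * (3 * Real.log n)) := by
        refine add_le_add ?_ ?_
        · exact le_mul_of_one_le_right (by positivity) (one_le_pow₀ hlog)
        · refine mul_le_mul_of_nonneg_left ((hmeet n _ (lineSystem_esLines P)).trans ?_) two_pos.le
          gcongr
    _ = _ := by ring
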